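/- arXiv:2106.08179 — 4 statements merged into one kernel-verified Lean document; each statement's English description precedes it below -/
import Mathlib

section
/- Let N be a normal subgroup of a finite group G of odd index, and let θ be a real-valued irreducible complex character of N. Then there exists a unique real-valued irreducible character χ of G lying over θ (i.e., with ⟨χ|_N, θ⟩ ≠ 0). -/
open CategoryTheory

/-- `χ` is the character of an irreducible complex representation of `G`. -/
def IsIrrChar (G : Type) [Group G] (χ : G → ℂ) : Prop :=
  ∃ V : FDRep ℂ G, Simple V ∧ χ = V.character

/-- `χ` is real-valued. -/
def IsRealValued {G : Type} (χ : G → ℂ) : Prop := ∀ g, (χ g).im = 0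

/-- The irreducible character `χ` of `G` lies over the irreducible character `θ` of the
subgroup `N`, i.e. `θ` is a constituent of the restriction of `χ` to `N`:
the inner product of `χ|_N` with `θ` is nonzero. -/
def LiesOver {G : Type} [Group G] [Fintype G] (N : Subgroup G)
    (χ : G → ℂ) (θ : ↥N → ℂ) : Prop :=
  haveI : Fintype ↥N := Fintype.ofFinite ↥N
  ∑ n : ↥N, χ ↑n * (starRingEnd ℂ) (θ n) ≠ 0

namespace IsIrrChar

variable {G : Type} [Group G] {χ ψ : G → ℂ}

theorem map_conj (hχ : IsIrrChar G χ) (x g : G) : χ (x * g * x⁻¹) = χ g := by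
  obtain ⟨V, -, rfl⟩ := hχ
  exact V.char_conj g x

theorem map_mul_comm (hχ : IsIrrChar G χ) (g h : G) : χ (g * h) = χ (h * g) := by
  obtain ⟨V, -, rfl⟩ := hχ
  exact V.char_mul_comm h g

variable [Fintype G]

theorem sum_mul_inv_self (hχ : IsIrrChar G χ) : ∑ g, χ g * χ g⁻¹ = Nat.card G := by
  obtain ⟨V, hV, rfl⟩ := hχ
  exact (FDRep.simple_iff_char_is_norm_one V).1 hV

theorem apply_one_ne_zero (hχ : IsIrrChar G χ) : χ 1 ≠ 0 := by
  intro h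
  have hs := hχ.sum_mul_inv_self
  obtain ⟨V, hV, rfl⟩ := hχ
  rw [FDRep.char_one, Nat.cast_eq_zero, Module.finrank_eq_zero_iff_of_free] at h
  have hz : ∀ g, V.character g = 0 := fun g ↦ by
    rw [FDRep.character, Subsingleton.elim (V.ρ g) 0, map_zero]
  simp [hz, eq_comm, Nat.card_eq_fintype_card] at hs

theorem of_sum_mul_inv_self (V : FDRep ℂ G)
    (h : ∑ g, V.character g * V.character g⁻¹ = Nat.card G) : IsIrrChar G V.character :=
  ⟨V, (FDRep.simple_iff_char_is_norm_one V).2 h, rfl⟩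

theorem _root_.FDRep.simple_of_isIrreducible {V : Type} [AddCommGroup V] [Module ℂ V]
    [FiniteDimensional ℂ V] (ρ : Representation ℂ G V) [ρ.IsIrreducible] :
    Simple (FDRep.of ρ) := by
  have := invertibleOfNonzero (NeZero.ne (Nat.card G : ℂ))
  rw [FDRep.simple_iff_char_is_norm_one]
  have h := Representation.char_orthonormal ρ ρ
  rw [if_pos ⟨.refl ρ⟩, inv_mul_eq_one₀ (NeZero.ne _)] at h
  exact h.symm

open Classical in
/-- First orthogonality relation. -/
theorem sum_mul_inv (hχ : IsIrrChar G χ) (hψ : IsIrrChar G ψ) :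
    ∑ g, χ g * ψ g⁻¹ = if χ = ψ then (Nat.card G : ℂ) else 0 := by
  split_ifs with h
  · rw [← h, hχ.sum_mul_inv_self]
  · obtain ⟨V, hV, rfl⟩ := hχ
    obtain ⟨W, hW, rfl⟩ := hψ
    have := invertibleOfNonzero (NeZero.ne (Nat.card G : ℂ))
    have ho := FDRep.char_orthonormal V W
    rw [if_neg fun ⟨i⟩ ↦ h (FDRep.char_iso i)] at ho
    exact (mul_eq_zero.1 ho).resolve_left (inv_ne_zero (NeZero.ne _))

theorem comp_inv (hχ : IsIrrChar G χ) : IsIrrChar G fun g ↦ χ g⁻¹ := by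
  have hs := hχ.sum_mul_inv_self
  obtain ⟨V, hV, rfl⟩ := hχ
  have hc : (FDRep.of (Representation.dual V.ρ)).character = fun g ↦ V.character g⁻¹ :=
    funext V.char_dual
  rw [← hc]
  refine of_sum_mul_inv_self _ ?_
  simpa [hc, mul_comm] using hs

theorem comp_mulEquiv (hχ : IsIrrChar G χ) (e : G ≃* G) : IsIrrChar G fun g ↦ χ (e g) := by
  have hs := hχ.sum_mul_inv_self
  obtain ⟨V, hV, rfl⟩ := hχ
  refine of_sum_mul_inv_self (FDRep.of (V.ρ.comp e.toMonoidHom)) ?_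
  rw [← hs]
  exact Fintype.sum_equiv e.toEquiv _ _ fun g ↦ by
    rw [MulEquiv.toEquiv_eq_coe, MulEquiv.coe_toEquiv, ← map_inv]; rfl

end IsIrrChar

theorem Representation.trace_inv_eq_conj {G V : Type} [Group G] [Fintype G] [AddCommGroup V]
    [Module ℂ V] [FiniteDimensional ℂ V] (ρ : Representation ℂ G V) (g : G) :
    LinearMap.trace ℂ V (ρ g⁻¹) = starRingEnd ℂ (LinearMap.trace ℂ V (ρ g)) := by
  classical
  open scoped Matrix ComplexOrder in
  let b := Module.finBasis ℂ V
  let M : G → Matrix _ _ ℂ := fun g ↦ LinearMap.toMatrix b b (ρ g)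
  have hM : ∀ x y, M (x * y) = M x * M y := fun x y ↦ by
    simp only [M, map_mul, LinearMap.toMatrix_mul]
  have hM1 : M 1 = 1 := by simp only [M, map_one, LinearMap.toMatrix_one]
  let H := ∑ x, (M x)ᴴ * M x
  have hH : H.PosDef := by
    simp only [H]
    rw [← Finset.add_sum_erase _ _ (Finset.mem_univ (1 : G)), hM1, Matrix.conjTranspose_one,
      Matrix.one_mul]
    exact Matrix.PosDef.one.add_posSemidef
      (Matrix.posSemidef_sum _ fun x _ ↦ Matrix.posSemidef_conjTranspose_mul_self _)
  have hinv : (M g)ᴴ * H = H * M g⁻¹ := by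
    have : (M g)ᴴ * H * M g = H := by
      simp only [H, Finset.mul_sum, Finset.sum_mul]
      exact Fintype.sum_equiv (Equiv.mulRight g) _ _ fun x ↦ by
        simp [hM, Matrix.conjTranspose_mul, Matrix.mul_assoc]
    nth_rewrite 2 [← this]
    rw [Matrix.mul_assoc _ (M g), ← hM, mul_inv_cancel, hM1, Matrix.mul_one]
  have hu : IsUnit H.det := (Matrix.isUnit_iff_isUnit_det _).1 hH.isUnit
  calc LinearMap.trace ℂ V (ρ g⁻¹) = (H⁻¹ * (H * M g⁻¹)).trace := by
        rw [Matrix.nonsing_inv_mul_cancel_left _ _ hu, LinearMap.trace_eq_matrix_trace ℂ b]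
    _ = (M g)ᴴ.trace := by
        rw [← hinv, Matrix.trace_mul_comm, Matrix.mul_nonsing_inv_cancel_right _ _ hu]
    _ = starRingEnd ℂ (LinearMap.trace ℂ V (ρ g)) := by
        rw [Matrix.trace_conjTranspose, LinearMap.trace_eq_matrix_trace ℂ b, starRingEnd_apply]

theorem IsIrrChar.map_inv {G : Type} [Group G] [Fintype G] {χ : G → ℂ} (hχ : IsIrrChar G χ)
    (g : G) : χ g⁻¹ = starRingEnd ℂ (χ g) := by
  obtain ⟨V, -, rfl⟩ := hχ
  exact Representation.trace_inv_eq_conj V.ρ g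

namespace IsIrrChar

variable {G : Type} [Group G] [Fintype G] {χ ψ : G → ℂ}

theorem _root_.FDRep.exists_sum_smul_eq_smul_id (V : FDRep ℂ G) [Simple V] (f : G → ℂ)
    (hf : ∀ x g, f (x * g * x⁻¹) = f g) :
    ∃ c : ℂ, ∑ h, f h • V.ρ h = c • LinearMap.id := by
  have := invertibleOfNonzero (NeZero.ne (Nat.card G : ℂ))
  have hr : Module.finrank ℂ (Representation.IntertwiningMap V.ρ V.ρ) = 1 := by
    have h := Representation.card_inv_mul_sum_char_mul_char_eq_finrank V.ρ V.ρ
    have h' := (FDRep.simple_iff_char_is_norm_one V).1 inferInstance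
    change (Nat.card G : ℂ)⁻¹ * ∑ g, V.character g * V.character g⁻¹ = _ at h
    rw [h', inv_mul_cancel₀ (NeZero.ne _)] at h
    exact_mod_cast h.symm
  have h1 : (Representation.IntertwiningMap.id V.ρ) ≠ 0 := by
    intro h0
    have hs : Subsingleton (Representation.IntertwiningMap V.ρ V.ρ) := by
      refine ⟨fun a b ↦ ?_⟩
      have key : ∀ a : Representation.IntertwiningMap V.ρ V.ρ, a = 0 := fun a ↦ by
        ext v
        have := congrArg (fun i ↦ i v) h0
        have hv : v = 0 := this
        rw [hv, map_zero, map_zero]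
      rw [key a, key b]
    rw [Module.finrank_zero_of_subsingleton] at hr
    exact zero_ne_one hr
  let T : Representation.IntertwiningMap V.ρ V.ρ :=
    ⟨∑ h, f h • V.ρ h, fun g ↦ by
      rw [← Module.End.mul_eq_comp, ← Module.End.mul_eq_comp, Finset.sum_mul, Finset.mul_sum]
      exact Fintype.sum_equiv (MulAut.conj g⁻¹).toEquiv _ _ fun h ↦ by
        simp only [MulEquiv.toEquiv_eq_coe, MulEquiv.coe_toEquiv, MulAut.conj_apply, hf,
          smul_mul_assoc, mul_smul_comm, ← map_mul]
        congr 2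
        group⟩
  obtain ⟨c, hc⟩ := (finrank_eq_one_iff_of_nonzero' _ h1).1 hr T
  refine ⟨c, ?_⟩
  ext v
  exact (congrArg (fun i ↦ i v) hc).symm

/-- A class function acts on an irreducible representation as a scalar. -/
theorem sum_mul_apply_mul (hχ : IsIrrChar G χ) {f : G → ℂ}
    (hf : ∀ x g, f (x * g * x⁻¹) = f g) (g : G) :
    (∑ h, f h * χ (h * g)) = (∑ h, f h * χ h) / χ 1 * χ g := by
  have h1 := hχ.apply_one_ne_zero
  obtain ⟨V, hV, rfl⟩ := hχ
  obtain ⟨c, hc⟩ := V.exists_sum_smul_eq_smul_id f hf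
  have key : ∀ g, ∑ h, f h * V.character (h * g) = c * V.character g := fun g ↦ by
    have := congrArg (fun T ↦ LinearMap.trace ℂ V (T * V.ρ g)) hc
    simpa [Finset.sum_mul, FDRep.character, ← Module.End.one_eq_id] using this
  have k1 := key 1
  simp only [mul_one] at k1
  rw [key, k1, mul_div_cancel_right₀ _ h1]

/-- Completeness of the irreducible characters among class functions. -/
theorem eq_zero_of_forall_sum_mul_eq_zero {f : G → ℂ} (hf : ∀ x g, f (x * g * x⁻¹) = f g)
    (h : ∀ χ, IsIrrChar G χ → ∑ g, f g * χ g = 0) : f = 0 := by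
  let a : MonoidAlgebra ℂ G := ∑ g, MonoidAlgebra.single g (f g)
  have ha : a ∈ Ring.jacobson (MonoidAlgebra ℂ G) := by
    rw [Ring.jacobson, Module.jacobson, Submodule.mem_sInf]
    intro m hm
    have hs : IsSimpleModule (MonoidAlgebra ℂ G) (MonoidAlgebra ℂ G ⧸ m) :=
      isSimpleModule_iff_isCoatom.2 hm
    let ρ : Representation ℂ G (MonoidAlgebra ℂ G ⧸ m) := Representation.ofModule' _
    have hact : ∀ (r : MonoidAlgebra ℂ G) v, ρ.asAlgebraHom r v = r • v := fun r v ↦ by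
      simp [ρ, Representation.asAlgebraHom, Representation.ofModule']
    let e : ρ.asModule ≃ₗ[MonoidAlgebra ℂ G] (MonoidAlgebra ℂ G ⧸ m) :=
      { ρ.asModuleEquiv with
        map_smul' := fun r v ↦ by
          have := ρ.asModuleEquiv_map_smul r v
          rw [hact] at this
          exact this }
    have hρ : ρ.IsIrreducible :=
      (Representation.irreducible_iff_isSimpleModule_asModule ρ).2 (IsSimpleModule.congr e)
    have hfin : FiniteDimensional ℂ (MonoidAlgebra ℂ G ⧸ m) := inferInstance
    have hV := FDRep.simple_of_isIrreducible ρ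
    have hχ : IsIrrChar G (FDRep.of ρ).character := ⟨_, hV, rfl⟩
    obtain ⟨c, hc⟩ := (FDRep.of ρ).exists_sum_smul_eq_smul_id f hf
    have hc0 : c = 0 := by
      have ht := congrArg (LinearMap.trace ℂ (FDRep.of ρ)) hc
      rw [map_sum, map_smul, LinearMap.trace_id, ← FDRep.char_one, smul_eq_mul] at ht
      simp only [map_smul, smul_eq_mul] at ht
      exact (mul_eq_zero.1 (ht.symm.trans (h _ hχ))).resolve_right hχ.apply_one_ne_zero
    have h0 : ρ.asAlgebraHom a = 0 := by
      rw [hc0, zero_smul] at hc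
      simp only [a, map_sum, Representation.asAlgebraHom_single]
      exact hc
    have hm1 := hact a (Submodule.Quotient.mk 1)
    rw [h0, LinearMap.zero_apply, ← Submodule.Quotient.mk_smul, smul_eq_mul, mul_one, eq_comm,
      Submodule.Quotient.mk_eq_zero] at hm1
    exact hm1
  rw [IsSemisimpleRing.jacobson_eq_bot] at ha
  have ha0 : a = 0 := ha
  ext g
  classical
  have := congrArg (fun b : MonoidAlgebra ℂ G ↦ b.coeff g) ha0
  simpa [a, MonoidAlgebra.coeff_sum, Finsupp.finsetSum_apply, Finsupp.single_apply] using this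

theorem finite_setOf : {χ | IsIrrChar G χ}.Finite := by
  classical
  have hli : LinearIndependent ℂ (Subtype.val : {χ | IsIrrChar G χ} → G → ℂ) := by
    rw [linearIndependent_iff']
    intro s c hc ψ hψ
    have h := congrArg (fun F : G → ℂ ↦ ∑ g, F g * ψ.1 g⁻¹) hc
    simp only [Finset.sum_apply, Pi.smul_apply, smul_eq_mul, Finset.sum_mul, Pi.zero_apply,
      zero_mul, Finset.sum_const_zero] at h
    rw [Finset.sum_comm] at h
    simp only [mul_assoc, ← Finset.mul_sum] at h
    rw [Finset.sum_eq_single_of_mem ψ hψ, sum_mul_inv ψ.2 ψ.2, if_pos rfl] at h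
    · exact (mul_eq_zero.1 h).resolve_right (NeZero.ne _)
    · intro χ _ hne
      rw [sum_mul_inv χ.2 ψ.2, if_neg fun h ↦ hne (Subtype.ext h), mul_zero]
  exact hli.finite

/-- The irreducible characters of a finite group. -/
noncomputable def _root_.irrChars (G : Type) [Group G] [Fintype G] : Finset (G → ℂ) :=
  (finite_setOf (G := G)).toFinset

theorem _root_.mem_irrChars : χ ∈ irrChars G ↔ IsIrrChar G χ :=
  Set.Finite.mem_toFinset _

open Classical in
theorem _root_.sum_sum_ite_eq_conj_mul (u : G) (F : G → ℂ) :
    ∑ h, (∑ x, if h = x⁻¹ * u * x then 1 else 0) * F h = ∑ x, F (x⁻¹ * u * x) := by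
  simp only [Finset.sum_mul]
  rw [Finset.sum_comm]
  simp

open Classical in
theorem _root_.sum_ite_conj_eq_conj (u x g : G) :
    (∑ y, if x * g * x⁻¹ = y⁻¹ * u * y then (1 : ℂ) else 0) =
      ∑ y, if g = y⁻¹ * u * y then 1 else 0 := by
  refine Fintype.sum_equiv (Equiv.mulRight x) _ _ fun y ↦ if_congr ?_ rfl rfl
  rw [Equiv.coe_mulRight, mul_inv_eq_iff_eq_mul, ← eq_inv_mul_iff_mul_eq]
  simp only [mul_inv_rev, mul_assoc]

open Classical in
/-- Second orthogonality relation. -/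
theorem sum_apply_mul_apply (u v : G) :
    ∑ χ ∈ irrChars G, χ u * χ v =
      ∑ x : G, if u = x⁻¹ * v⁻¹ * x then 1 else 0 := by
  let f : G → ℂ := fun u ↦ ∑ χ ∈ irrChars G, χ u * χ v -
      ∑ x : G, if u = x⁻¹ * v⁻¹ * x then 1 else 0
  suffices hf : f = 0 from sub_eq_zero.1 (congrFun hf u)
  refine eq_zero_of_forall_sum_mul_eq_zero (fun x g ↦ ?_) fun ψ hψ ↦ ?_
  · simp only [f, sum_ite_conj_eq_conj]
    congr 1
    exact Finset.sum_congr rfl fun χ hχ ↦ by rw [(mem_irrChars.1 hχ).map_conj]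
  · have hψ' := hψ.comp_inv
    simp only [f, sub_mul, Finset.sum_sub_distrib, sum_sum_ite_eq_conj_mul]
    simp only [Finset.sum_mul]
    rw [sub_eq_zero, Finset.sum_comm]
    calc ∑ χ ∈ irrChars G, ∑ g, χ g * χ v * ψ g
        = ∑ χ ∈ irrChars G,
            if χ = (fun g ↦ ψ g⁻¹) then Nat.card G * ψ v⁻¹ else 0 := by
          refine Finset.sum_congr rfl fun χ hχ ↦ ?_
          have h := sum_mul_inv (mem_irrChars.1 hχ) hψ'
          simp only [inv_inv] at h
          simp only [mul_right_comm _ (χ v), ← Finset.sum_mul, h]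
          split_ifs with h' <;> simp [h']
      _ = Nat.card G * ψ v⁻¹ := by
          rw [Finset.sum_ite_eq', if_pos (mem_irrChars.2 hψ')]
      _ = _ := by
          have : ∀ x, ψ (x⁻¹ * v⁻¹ * x) = ψ v⁻¹ := fun x ↦ by
            simpa using hψ.map_conj x⁻¹ v⁻¹
          simp [this]

open Classical in
theorem sum_mul_self (hχ : IsIrrChar G χ) :
    ∑ g, χ g * χ g = if IsRealValued χ then (Nat.card G : ℂ) else 0 := by
  have h := sum_mul_inv hχ hχ.comp_inv
  simp only [inv_inv] at h
  rw [h]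
  refine if_congr ⟨fun h g ↦ ?_, fun h ↦ funext fun g ↦ ?_⟩ rfl rfl
  · have := congrFun h g
    rw [hχ.map_inv, eq_comm, Complex.conj_eq_iff_im] at this
    exact this
  · rw [hχ.map_inv, eq_comm, Complex.conj_eq_iff_im]
    exact h g

theorem map_inv_of_isRealValued (hχ : IsIrrChar G χ) (h : IsRealValued χ) (g : G) :
    χ g⁻¹ = χ g := by
  rw [hχ.map_inv, Complex.conj_eq_iff_im]
  exact h g

open Classical in
theorem sum_mul_apply_inv_mul (hχ : IsIrrChar G χ) (hψ : IsIrrChar G ψ) (g : G) :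
    ∑ h, χ h * ψ (h⁻¹ * g) = if χ = ψ then Nat.card G / ψ 1 * ψ g else 0 := by
  rw [← Equiv.sum_comp (Equiv.inv G)]
  simp only [Equiv.inv_apply, inv_inv]
  rw [hψ.sum_mul_apply_mul (f := fun h ↦ χ h⁻¹) hχ.comp_inv.map_conj]
  have h := sum_mul_inv hχ hψ
  rw [← Equiv.sum_comp (Equiv.inv G)] at h
  simp only [Equiv.inv_apply, inv_inv] at h
  rw [h]
  split_ifs <;> simp

theorem sum_apply_conj_mul (hχ : IsIrrChar G χ) (u g : G) :
    ∑ n, χ (n⁻¹ * u * n * g) = Nat.card G / χ 1 * (χ u * χ g) := by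
  classical
  have key := hχ.sum_mul_apply_mul
    (f := fun h ↦ ∑ n : G, if h = n⁻¹ * u * n then 1 else 0) (sum_ite_conj_eq_conj u) g
  have hc : ∀ x, χ (x⁻¹ * u * x) = χ u := fun x ↦ by simpa using hχ.map_conj x⁻¹ u
  simp only [sum_sum_ite_eq_conj_mul u fun h ↦ χ (h * g), sum_sum_ite_eq_conj_mul u χ, hc,
    Finset.sum_const, nsmul_eq_mul, Finset.card_univ] at key
  rw [key, Nat.card_eq_fintype_card]
  ring

end IsIrrChar

/-- In a group of odd order only the identity is conjugate to its inverse. -/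
theorem eq_one_of_conj_eq_inv_of_odd_card {Q : Type*} [Group Q] (hQ : Odd (Nat.card Q))
    {x g : Q} (h : x⁻¹ * g * x = g⁻¹) : g = 1 := by
  have hcomm : Commute (x ^ 2) g := by
    have h2 : x⁻¹ * (x⁻¹ * g * x) * x = g := by
      have h' := congrArg (·⁻¹) h
      simp only [mul_inv_rev, inv_inv] at h'
      rw [h, mul_assoc]
      exact h'
    have h3 : g = x ^ 2 * g * (x ^ 2)⁻¹ := by
      nth_rewrite 2 [← h2]
      group
    exact (eq_mul_inv_iff_mul_eq.1 h3).symm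
  obtain ⟨k, hk⟩ := hQ
  have hx : x = ((x ^ 2) ^ (k + 1)) := by
    rw [← pow_mul, show 2 * (k + 1) = Nat.card Q + 1 by lia, pow_succ, pow_card_eq_one', one_mul]
  have hxg : Commute x g := by
    rw [hx]
    exact hcomm.pow_left _
  have hg : g ^ 2 = 1 := by
    rw [mul_assoc, ← hxg.eq, inv_mul_cancel_left] at h
    rw [pow_two]
    nth_rewrite 1 [h]
    exact inv_mul_cancel g
  have : g ^ Nat.card Q = 1 := pow_card_eq_one'
  rwa [hk, pow_succ, pow_mul, hg, one_pow, one_mul] at this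

section ZeroExtend

variable {G : Type} [Group G] {N : Subgroup G}

/-- Extension by zero to `G` of a function on the subgroup `N`. -/
noncomputable def zeroExtend (θ : N → ℂ) : G → ℂ := Function.extend Subtype.val θ 0

@[simp]
theorem zeroExtend_coe (θ : N → ℂ) (n : N) : zeroExtend θ n = θ n :=
  Subtype.val_injective.extend_apply _ _ _

theorem zeroExtend_of_notMem (θ : N → ℂ) {g : G} (hg : g ∉ N) : zeroExtend θ g = 0 :=
  Function.extend_apply' _ _ _ fun ⟨n, hn⟩ ↦ hg (hn ▸ n.2)

theorem zeroExtend_conj [N.Normal] (θ : N → ℂ) (y g : G) :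
    zeroExtend θ (y * g * y⁻¹) = zeroExtend (fun n ↦ θ (MulAut.conjNormal y n)) g := by
  by_cases hg : g ∈ N
  · lift g to N using hg
    rw [zeroExtend_coe, ← MulAut.conjNormal_apply, zeroExtend_coe]
  · rw [zeroExtend_of_notMem _ hg, zeroExtend_of_notMem]
    rwa [← Subgroup.Normal.mem_comm_iff inferInstance, inv_mul_cancel_left]

theorem mem_of_conj_mul_mem [N.Normal] (hodd : Odd N.index) {x g : G} (h : x⁻¹ * g * x * g ∈ N) :
    g ∈ N := by
  rw [← QuotientGroup.eq_one_iff] at h ⊢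
  refine eq_one_of_conj_eq_inv_of_odd_card (Q := G ⧸ N) hodd (x := (x : G ⧸ N)) ?_
  exact eq_inv_of_mul_eq_one_left h

variable [Fintype G]

theorem card_mul_sum_zeroExtend_mul {χ : G → ℂ} (hχ : IsIrrChar G χ) (θ : N → ℂ) (u : G) :
    ∑ h, (∑ y : G, zeroExtend θ (y * h * y⁻¹)) * χ (h * u) =
      Nat.card G * (∑ h, zeroExtend θ h * χ h) / χ 1 * χ u := by
  rw [hχ.sum_mul_apply_mul]
  · congr 2
    simp only [Finset.sum_mul]
    rw [Finset.sum_comm, Nat.card_eq_fintype_card, ← nsmul_eq_mul, ← Finset.card_univ,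
      ← Finset.sum_const]
    refine Finset.sum_congr rfl fun y _ ↦ ?_
    exact Fintype.sum_equiv (MulAut.conj y).toEquiv _ _ fun h ↦ by
      simp [hχ.map_conj]
  · exact fun x g ↦ Fintype.sum_equiv (Equiv.mulRight x) _ _ fun y ↦ by
      simp [mul_assoc]

variable [Fintype N]

theorem sum_zeroExtend_mul (θ : N → ℂ) (F : G → ℂ) :
    ∑ g, zeroExtend θ g * F g = ∑ n : N, θ n * F n := by
  classical
  rw [← Finset.sum_subset (Finset.subset_univ (Finset.univ.map (Function.Embedding.subtype (· ∈ N))))]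
  · rw [Finset.sum_map]
    simp
  · intro g _ hg
    rw [zeroExtend_of_notMem, zero_mul]
    simpa using hg

open Classical in
theorem sum_zeroExtend_mul_zeroExtend_inv_mul {α β : N → ℂ} (hα : IsIrrChar N α)
    (hβ : IsIrrChar N β) (w : G) :
    ∑ m, zeroExtend α m * zeroExtend β (m⁻¹ * w) =
      if α = β then Nat.card N / β 1 * zeroExtend β w else 0 := by
  rw [sum_zeroExtend_mul]
  by_cases hw : w ∈ N
  · lift w to N using hw
    rw [zeroExtend_coe, ← hα.sum_mul_apply_inv_mul hβ]
    exact Finset.sum_congr rfl fun m _ ↦ by rw [← zeroExtend_coe β]; rfl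
  · rw [zeroExtend_of_notMem _ hw, mul_zero, ite_self]
    refine Finset.sum_eq_zero fun m _ ↦ ?_
    rw [zeroExtend_of_notMem, mul_zero]
    rwa [N.mul_mem_cancel_left (N.inv_mem m.2)]

theorem liesOver_iff_sum_zeroExtend_ne_zero {θ : N → ℂ} {χ : G → ℂ} (hreal : IsRealValued θ) :
    LiesOver N χ θ ↔ ∑ h, zeroExtend θ h * χ h ≠ 0 := by
  have hc : ∀ n, starRingEnd ℂ (θ n) = θ n := fun n ↦ Complex.conj_eq_iff_im.2 (hreal n)
  rw [sum_zeroExtend_mul, LiesOver]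
  simp only [hc, mul_comm]
  convert Iff.rfl

end ZeroExtend

section Main

variable {G : Type} [Group G] [Fintype G] {N : Subgroup G} [N.Normal] [Fintype N]
  {θ : N → ℂ} {χ : G → ℂ}

open Classical in
/-- The order of the stabilizer of `θ` in `G`. -/
noncomputable def stabilizerCard (θ : N → ℂ) : ℂ :=
  ∑ y : G, if θ = (fun n ↦ θ (MulAut.conjNormal y n)) then 1 else 0

theorem stabilizerCard_ne_zero (θ : N → ℂ) : stabilizerCard θ ≠ 0 := by
  classical
  rw [stabilizerCard, Finset.sum_boole, Nat.cast_ne_zero]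
  exact Finset.card_ne_zero.2 ⟨1, by simp⟩

theorem card_mul_sum_zeroExtend_mul_div_eq (hχ : IsIrrChar G χ) (hθ : IsIrrChar N θ)
    (h0 : ∑ h, zeroExtend θ h * χ h ≠ 0) :
    Nat.card G * (∑ h, zeroExtend θ h * χ h) / χ 1 = stabilizerCard θ * (Nat.card N / θ 1) := by
  classical
  refine mul_right_cancel₀ h0 ?_
  calc _ = ∑ m, zeroExtend θ m *
        ∑ h, (∑ y : G, zeroExtend θ (y * h * y⁻¹)) * χ (h * m) := by
        rw [Finset.mul_sum]
        exact Finset.sum_congr rfl fun m _ ↦ by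
          rw [card_mul_sum_zeroExtend_mul hχ]; ring
    _ = ∑ m, ∑ w, ∑ y : G, zeroExtend θ m *
          zeroExtend (fun n ↦ θ (MulAut.conjNormal y n)) (m⁻¹ * w) * χ w := by
        refine Finset.sum_congr rfl fun m _ ↦ ?_
        rw [Finset.mul_sum]
        refine Fintype.sum_equiv (Equiv.mulLeft m) _ _ fun h ↦ ?_
        simp only [Equiv.coe_mulLeft, inv_mul_cancel_left, ← zeroExtend_conj, Finset.mul_sum,
          Finset.sum_mul, hχ.map_mul_comm m h, mul_assoc]
    _ = ∑ w, ∑ y : G, (∑ m, zeroExtend θ m *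
          zeroExtend (fun n ↦ θ (MulAut.conjNormal y n)) (m⁻¹ * w)) * χ w := by
        rw [Finset.sum_comm]
        refine Finset.sum_congr rfl fun w _ ↦ ?_
        rw [Finset.sum_comm]
        simp only [Finset.sum_mul]
    _ = ∑ w, ∑ y : G, (if θ = (fun n ↦ θ (MulAut.conjNormal y n)) then 1 else 0) *
          (Nat.card N / θ 1 * zeroExtend θ w) * χ w := by
        refine Finset.sum_congr rfl fun w _ ↦ Finset.sum_congr rfl fun y _ ↦ ?_
        rw [sum_zeroExtend_mul_zeroExtend_inv_mul hθ (hθ.comp_mulEquiv (MulAut.conjNormal y))]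
        split_ifs with h
        · rw [← h, map_one, one_mul]
        · simp only [zero_mul]
    _ = _ := by
        rw [stabilizerCard, Finset.mul_sum]
        refine Finset.sum_congr rfl fun w _ ↦ ?_
        rw [← Finset.sum_mul, ← Finset.sum_mul]
        ring

open Classical in
theorem sum_sum_zeroExtend_mul_mul (hχ : IsIrrChar G χ) (hθ : IsIrrChar N θ) :
    ∑ g, ∑ h, zeroExtend θ h * χ (h * g) * χ g =
      if IsRealValued χ ∧ ∑ h, zeroExtend θ h * χ h ≠ 0 then
        stabilizerCard θ * (Nat.card N / θ 1) else 0 := by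
  refine mul_left_cancel₀ (NeZero.ne (Nat.card G : ℂ)) ?_
  calc _ = ∑ y : G, ∑ g, ∑ h, zeroExtend θ h * χ (h * g) * χ g := by
        rw [Finset.sum_const, nsmul_eq_mul, Finset.card_univ, Nat.card_eq_fintype_card]
    _ = ∑ y : G, ∑ g, ∑ h, zeroExtend θ (y * h * y⁻¹) * χ (h * g) * χ g := by
        refine Finset.sum_congr rfl fun y _ ↦ ?_
        refine Fintype.sum_equiv (MulAut.conj y⁻¹).toEquiv _ _ fun g ↦ ?_
        refine Fintype.sum_equiv (MulAut.conj y⁻¹).toEquiv _ _ fun h ↦ ?_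
        have h1 := hχ.map_conj y⁻¹ (h * g)
        have h2 := hχ.map_conj y⁻¹ g
        simp only [inv_inv] at h1 h2
        simp [← h1, ← h2, mul_assoc]
    _ = ∑ g, (∑ h, (∑ y : G, zeroExtend θ (y * h * y⁻¹)) * χ (h * g)) * χ g := by
        rw [Finset.sum_comm]
        refine Finset.sum_congr rfl fun g _ ↦ ?_
        rw [Finset.sum_comm]
        simp only [Finset.sum_mul]
    _ = _ := by
        simp only [card_mul_sum_zeroExtend_mul hχ, mul_assoc _ (χ _) (χ _), ← Finset.mul_sum,
          hχ.sum_mul_self]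
        by_cases h0 : ∑ h, zeroExtend θ h * χ h = 0
        · simp [h0]
        · rw [card_mul_sum_zeroExtend_mul_div_eq hχ hθ h0]
          rw [if_congr (and_iff_left h0) rfl rfl]
          split_ifs <;> simp [mul_comm]

theorem sum_zeroExtend_conj_mul (hθ : IsIrrChar N θ) (hodd : Odd N.index) (g : G) :
    ∑ x, zeroExtend θ (x⁻¹ * g * x * g) =
      (∑ x, zeroExtend θ (x⁻¹ * g * x) * zeroExtend θ g) / θ 1 := by
  by_cases hg : g ∈ N
  · refine mul_left_cancel₀ (NeZero.ne (Nat.card N : ℂ)) ?_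
    calc _ = ∑ n : N, ∑ x, zeroExtend θ (x⁻¹ * g * x * g) := by
          rw [Finset.sum_const, nsmul_eq_mul, Finset.card_univ, Nat.card_eq_fintype_card]
      _ = ∑ n : N, ∑ x, zeroExtend θ ((n : G)⁻¹ * (x⁻¹ * g * x) * n * g) := by
          refine Finset.sum_congr rfl fun n _ ↦ ?_
          refine Fintype.sum_equiv (Equiv.mulRight (n : G)⁻¹) _ _ fun x ↦ ?_
          simp [mul_assoc]
      _ = ∑ x, Nat.card N / θ 1 * (zeroExtend θ (x⁻¹ * g * x) * zeroExtend θ g) := by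
          rw [Finset.sum_comm]
          refine Finset.sum_congr rfl fun x _ ↦ ?_
          have hx : x⁻¹ * g * x ∈ N := by
            simpa using Subgroup.Normal.conj_mem inferInstance g hg x⁻¹
          calc _ = ∑ n : N, θ (n⁻¹ * ⟨_, hx⟩ * n * ⟨g, hg⟩) :=
                Finset.sum_congr rfl fun n _ ↦ zeroExtend_coe θ (n⁻¹ * ⟨_, hx⟩ * n * ⟨g, hg⟩)
            _ = _ := by
                rw [hθ.sum_apply_conj_mul, ← zeroExtend_coe θ ⟨_, hx⟩, ← zeroExtend_coe θ ⟨g, hg⟩]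
      _ = _ := by
          rw [← Finset.mul_sum]
          ring
  · simp only [zeroExtend_of_notMem θ hg, mul_zero, Finset.sum_const_zero, zero_div]
    exact Finset.sum_eq_zero fun x _ ↦
      zeroExtend_of_notMem _ fun h ↦ hg (mem_of_conj_mul_mem hodd h)

theorem sum_irrChars_sum_sum_zeroExtend (hθ : IsIrrChar N θ) (hreal : IsRealValued θ)
    (hodd : Odd N.index) :
    ∑ χ ∈ irrChars G, ∑ g, ∑ h, zeroExtend θ h * χ (h * g) * χ g =
      stabilizerCard θ * (Nat.card N / θ 1) := by
  classical
  calc _ = ∑ g, ∑ h, zeroExtend θ h * ∑ χ ∈ irrChars G, χ (h * g) * χ g := by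
        rw [Finset.sum_comm]
        refine Finset.sum_congr rfl fun g _ ↦ ?_
        rw [Finset.sum_comm]
        simp only [Finset.mul_sum, mul_assoc]
    _ = ∑ g : G, ∑ x : G, zeroExtend θ (x⁻¹ * g⁻¹ * x * g⁻¹) := by
        refine Finset.sum_congr rfl fun g _ ↦ ?_
        simp only [IsIrrChar.sum_apply_mul_apply, Finset.mul_sum, ← eq_mul_inv_iff_mul_eq]
        rw [Finset.sum_comm]
        simp
    _ = ∑ g : G, ∑ x : G, zeroExtend θ (x⁻¹ * g * x * g) :=
        Fintype.sum_equiv (Equiv.inv G) _ _ fun g ↦ by simp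
    _ = (∑ x : G, ∑ g, zeroExtend θ g * zeroExtend θ (x⁻¹ * g * x)) / θ 1 := by
        simp only [sum_zeroExtend_conj_mul hθ hodd, ← Finset.sum_div]
        rw [Finset.sum_comm]
        simp only [mul_comm]
    _ = (∑ y : G, ∑ g, zeroExtend θ g * zeroExtend θ (y * g * y⁻¹)) / θ 1 := by
        exact congrArg (· / θ 1) (Fintype.sum_equiv (Equiv.inv G) _ _ fun x ↦ by simp)
    _ = (∑ y : G, (if θ = (fun n ↦ θ (MulAut.conjNormal y n)) then 1 else 0) * (Nat.card N : ℂ))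
          / θ 1 := by
        refine congrArg (· / θ 1) (Finset.sum_congr rfl fun y _ ↦ ?_)
        simp only [zeroExtend_conj, sum_zeroExtend_mul, zeroExtend_coe]
        have h := hθ.sum_mul_inv (hθ.comp_mulEquiv (MulAut.conjNormal y))
        simp only [map_inv, hθ.map_inv_of_isRealValued hreal] at h
        rw [h, ite_mul, one_mul, zero_mul]
    _ = _ := by
        rw [stabilizerCard, ← Finset.sum_mul, mul_div_assoc]

end Main

theorem exists_unique_real_irr_char_over_of_odd_index
    (G : Type) [Group G] [Fintype G] (N : Subgroup G) (hN : N.Normal)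
    (hodd : Odd N.index) (θ : ↥N → ℂ) (hθ : IsIrrChar ↥N θ)
    (hθreal : IsRealValued θ) :
    ∃! χ : G → ℂ, IsIrrChar G χ ∧ IsRealValued χ ∧ LiesOver N χ θ := by
  classical
  have : Fintype N := Fintype.ofFinite N
  have hκ : stabilizerCard θ * (Nat.card N / θ 1) ≠ 0 :=
    mul_ne_zero (stabilizerCard_ne_zero θ) (div_ne_zero (NeZero.ne _) hθ.apply_one_ne_zero)
  have h := sum_irrChars_sum_sum_zeroExtend hθ hθreal hodd
  rw [Finset.sum_congr rfl fun χ hχ ↦ sum_sum_zeroExtend_mul_mul (mem_irrChars.1 hχ) hθ,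
    ← Finset.sum_filter, Finset.sum_const, nsmul_eq_mul, mul_eq_right₀ hκ, Nat.cast_eq_one,
    Finset.card_eq_one] at h
  obtain ⟨χ, hχ⟩ := h
  have key : ∀ ψ, (IsIrrChar G ψ ∧ IsRealValued ψ ∧ LiesOver N ψ θ) ↔ ψ = χ := fun ψ ↦ by
    rw [← Finset.mem_singleton, ← hχ, Finset.mem_filter, mem_irrChars,
      liesOver_iff_sum_zeroExtend_ne_zero hθreal]
  exact ⟨χ, (key χ).2 rfl, fun ψ hψ ↦ (key ψ).1 hψ⟩
end

section
/- Let K be a finite perfect group and M a minimal normal subgroup of K which is an elementary abelian 2-group, noncentral in K, with K/M isomorphic to A₅. Then K has a real-valued irreducible complex character whose degree is odd and not a prime power (in fact a character of degree 15). -/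
open CategoryTheory

namespace AltFive

/-- The five-cycle `(0 1 2 3 4)`. -/
def f : alternatingGroup (Fin 5) :=
  ⟨⟨![1, 2, 3, 4, 0], ![4, 0, 1, 2, 3], by decide, by decide⟩,
    Equiv.Perm.mem_alternatingGroup.2 (by decide +kernel)⟩

/-- The involution `(1 4)(2 3)`, which inverts `f`. -/
def x : alternatingGroup (Fin 5) :=
  ⟨⟨![0, 4, 3, 2, 1], ![0, 4, 3, 2, 1], by decide, by decide⟩,
    Equiv.Perm.mem_alternatingGroup.2 (by decide +kernel)⟩

/-- The involution `(1 2)(3 4)`, which commutes with `x`. -/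
def t : alternatingGroup (Fin 5) :=
  ⟨⟨![0, 2, 1, 4, 3], ![0, 2, 1, 4, 3], by decide, by decide⟩,
    Equiv.Perm.mem_alternatingGroup.2 (by decide +kernel)⟩

/-- The three-cycle `(1 2 3)`. -/
def c : alternatingGroup (Fin 5) :=
  ⟨⟨![0, 2, 3, 1, 4], ![0, 3, 1, 2, 4], by decide, by decide⟩,
    Equiv.Perm.mem_alternatingGroup.2 (by decide +kernel)⟩

/-- The Klein four-group `{1, x, t, x * t}`. -/
def V4 : Subgroup (alternatingGroup (Fin 5)) where
  carrier := {g | g = 1 ∨ g = x ∨ g = t ∨ g = x * t}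
  one_mem' := Or.inl rfl
  mul_mem' := @fun a b ↦ (by decide +kernel : ∀ a b : alternatingGroup (Fin 5),
    (a = 1 ∨ a = x ∨ a = t ∨ a = x * t) → (b = 1 ∨ b = x ∨ b = t ∨ b = x * t) →
      (a * b = 1 ∨ a * b = x ∨ a * b = t ∨ a * b = x * t)) a b
  inv_mem' := @fun a ↦ (by decide +kernel : ∀ a : alternatingGroup (Fin 5),
    (a = 1 ∨ a = x ∨ a = t ∨ a = x * t) →
      (a⁻¹ = 1 ∨ a⁻¹ = x ∨ a⁻¹ = t ∨ a⁻¹ = x * t)) a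

instance (g) : Decidable (g ∈ V4) :=
  inferInstanceAs (Decidable (g = 1 ∨ g = x ∨ g = t ∨ g = x * t))

lemma index_V4 : V4.index = 15 := by
  have h : Nat.card V4 = 4 := by
    rw [Nat.card_eq_fintype_card]; decide +kernel
  have h2 : Nat.card (alternatingGroup (Fin 5)) = 60 := by
    rw [Nat.card_eq_fintype_card]; decide +kernel
  have := V4.card_mul_index
  rw [h, h2] at this
  omega

lemma normal_form : ∀ g : alternatingGroup (Fin 5),
    ∃ j k : Fin 5, ∃ l : Fin 2, g = f ^ (j : ℕ) * x ^ (l : ℕ) ∨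
      g = f ^ (j : ℕ) * t * (f ^ (k : ℕ) * x ^ (l : ℕ)) := by
  decide +kernel

lemma exists_mul_eq_conj : ∀ g : alternatingGroup (Fin 5), (g : Equiv.Perm (Fin 5)) 0 ≠ 0 →
    ∃ v ∈ V4, ∃ k, g * v = k * f * k⁻¹ := by
  decide +kernel

lemma exists_inverted : ∀ v ∈ V4, v ≠ 1 → ∃ k, v * (k * f * k⁻¹) * v⁻¹ = (k * f * k⁻¹)⁻¹ := by
  decide +kernel

lemma eq_mul_c : ∀ g : alternatingGroup (Fin 5), (g : Equiv.Perm (Fin 5)) 0 = 0 → g ∉ V4 →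
    g * c⁻¹ ∈ V4 ∨ g * c ∈ V4 := by
  decide +kernel

lemma f_pow_five : f ^ 5 = 1 := by decide +kernel

lemma sq_eq_one : ∀ v ∈ V4, v ^ 2 = 1 := by decide +kernel

lemma x_mem : x ∈ V4 := by decide +kernel

lemma c_conj_mem : ∀ v ∈ V4, c * v * c⁻¹ ∈ V4 := by decide +kernel

lemma x_inv_mul_c_conj_ne_one : x⁻¹ * (c * x * c⁻¹) ≠ 1 := by decide +kernel

lemma t_mul_x : x * t = t * x := by decide +kernel

lemma t_mul_f_pow_mul_t :
    t * f * t = f ^ 4 * t * f ^ 4 ∧ t * f ^ 2 * t = f ^ 2 * t * (f ^ 3 * x) ∧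
      t * f ^ 3 * t = f ^ 3 * t * (f ^ 2 * x) ∧ t * f ^ 4 * t = f * t * f ∧ t * t = 1 := by
  decide +kernel

section Module

variable {V : Type*} [AddCommGroup V] [DistribMulAction (alternatingGroup (Fin 5)) V]

/-- The sum of the translates of `v` by the first five powers of `h`. -/
def cyclicSum (h : alternatingGroup (Fin 5)) (v : V) : V :=
  v + h • v + h ^ 2 • v + h ^ 3 • v + h ^ 4 • v

lemma smul_cyclicSum_f (v : V) : f • cyclicSum f v = cyclicSum f v := by
  have h1 : f * f = f ^ 2 := by decide +kernel
  have h2 : f * f ^ 2 = f ^ 3 := by decide +kernel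
  have h3 : f * f ^ 3 = f ^ 4 := by decide +kernel
  have h4 : f * f ^ 4 = 1 := by decide +kernel
  simp only [cyclicSum, smul_add, ← mul_smul, h1, h2, h3, h4, one_smul]
  abel

lemma cyclicSum_f_smul (v : V) : cyclicSum f (f • v) = cyclicSum f v := by
  rw [← smul_cyclicSum_f v]
  simp only [cyclicSum, smul_add, ← mul_smul, ← pow_succ, ← pow_succ']

lemma cyclicSum_f_pow_smul (n : ℕ) (v : V) : cyclicSum f (f ^ n • v) = cyclicSum f v := by
  induction n with
  | zero => simp
  | succ n ih => rw [pow_succ', mul_smul, cyclicSum_f_smul, ih]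

lemma cyclicSum_of_smul_eq (h2 : ∀ v : V, v + v = 0) {h : alternatingGroup (Fin 5)} {w : V}
    (hw : h • w = w) : cyclicSum h w = w := by
  have hp (n : ℕ) : h ^ n • w = w := by
    induction n with
    | zero => simp
    | succ n ih => rw [pow_succ, mul_smul, hw, ih]
  simp only [cyclicSum, hp, hw, h2, zero_add]

lemma x_smul_cyclicSum_f (v : V) : x • cyclicSum f v = cyclicSum f (x • v) := by
  have h1 : x * f = f ^ 4 * x := by decide +kernel
  have h2 : x * f ^ 2 = f ^ 3 * x := by decide +kernel
  have h3 : x * f ^ 3 = f ^ 2 * x := by decide +kernel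
  have h4 : x * f ^ 4 = f * x := by decide +kernel
  simp only [cyclicSum, smul_add, ← mul_smul, h1, h2, h3, h4]
  abel

/-- If `w` is fixed by the dihedral group `⟨f, x⟩`, then its six translates under the group add up
to zero, and the five translates other than `w` form an orbit of `f`. -/
lemma cyclicSum_f_smul_of_smul_eq (h2 : ∀ v : V, v + v = 0)
    (hfix : ∀ v : V, (∀ g : alternatingGroup (Fin 5), g • v = v) → v = 0)
    {w : V} (hf : f • w = w) (hx : x • w = w) (g : alternatingGroup (Fin 5)) :
    cyclicSum f (g • w) = w := by
  have hfp (n : ℕ) : f ^ n • w = w := by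
    induction n with
    | zero => simp
    | succ n ih => rw [pow_succ, mul_smul, hf, ih]
  have hxp (l : Fin 2) : x ^ (l : ℕ) • w = w := by
    fin_cases l <;> simp [hx]
  set S := w + cyclicSum f (t • w) with hS
  have hSf : f • S = S := by rw [hS, smul_add, hf, smul_cyclicSum_f]
  have hSx : x • S = S := by
    rw [hS, smul_add, hx, x_smul_cyclicSum_f, ← mul_smul, t_mul_x, mul_smul, hx]
  have hSt : t • S = S := by
    obtain ⟨h1, h2, h3, h4, h5⟩ := t_mul_f_pow_mul_t
    simp only [hS, cyclicSum, smul_add, ← mul_smul, ← mul_assoc, h1, h2, h3, h4, h5]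
    simp only [mul_smul, hf, hx, hfp, one_smul]
    abel
  have hSfp (n : ℕ) : f ^ n • S = S := by
    induction n with
    | zero => simp
    | succ n ih => rw [pow_succ, mul_smul, hSf, ih]
  have hSxp (l : Fin 2) : x ^ (l : ℕ) • S = S := by
    fin_cases l <;> simp [hSx]
  have hS0 : S = 0 := hfix S fun g ↦ by
    obtain ⟨j, k, l, rfl | rfl⟩ := normal_form g <;> simp only [mul_smul, hSfp, hSxp, hSt]
  have hsum : cyclicSum f (t • w) = w := by
    have := h2 w
    rw [← hS0, hS] at this
    exact (add_left_cancel this).symm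
  obtain ⟨j, k, l, rfl | rfl⟩ := normal_form g
  · rw [mul_smul, hxp, hfp, cyclicSum_of_smul_eq h2 hf]
  · rw [mul_smul, mul_smul, mul_smul, hxp, hfp, cyclicSum_f_pow_smul, hsum]

/-- A vector fixed by the dihedral group `⟨f, x⟩` of order `10` vanishes. -/
lemma eq_zero_of_smul_eq (h2 : ∀ v : V, v + v = 0)
    (hfix : ∀ v : V, (∀ g : alternatingGroup (Fin 5), g • v = v) → v = 0)
    (hirr : ∀ W : AddSubgroup V,
      (∀ g : alternatingGroup (Fin 5), ∀ w ∈ W, g • w ∈ W) → W = ⊥ ∨ W = ⊤)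
    {w : V} (hf : f • w = w) (hx : x • w = w) : w = 0 := by
  have hw := cyclicSum_f_smul_of_smul_eq h2 hfix hf hx
  let W : AddSubgroup V :=
    { carrier := {v | ∀ g : alternatingGroup (Fin 5), cyclicSum f (g • v) = 0}
      zero_mem' := by simp [cyclicSum]
      add_mem' := by
        intro a b ha hb g
        have : cyclicSum f (g • a) + cyclicSum f (g • b) = 0 := by rw [ha, hb, add_zero]
        rw [← this]
        simp only [cyclicSum, smul_add]
        abel
      neg_mem' := by
        intro a ha g
        rw [neg_eq_of_add_eq_zero_left (h2 a)]
        exact ha g }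
  obtain hW | hW := hirr W fun g v hv h ↦ by rw [← mul_smul]; exact hv _
  · refine hfix w fun g ↦ ?_
    have : w + g • w ∈ W := fun h ↦ by
      have : cyclicSum f (h • (w + g • w)) =
          cyclicSum f (h • w) + cyclicSum f ((h * g) • w) := by
        simp only [cyclicSum, smul_add, mul_smul]
        abel
      rw [this, hw, hw, h2]
    rw [hW, AddSubgroup.mem_bot, ← h2 w] at this
    exact add_left_cancel this
  · have : w ∈ W := hW ▸ AddSubgroup.mem_top w
    rw [← hw 1]
    exact this 1

/-- Five-cycles have no nonzero fixed points on a nontrivial simple module in characteristic `2`. -/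
theorem cyclicSum_conj_eq_zero (h2 : ∀ v : V, v + v = 0)
    (hfix : ∀ v : V, (∀ g : alternatingGroup (Fin 5), g • v = v) → v = 0)
    (hirr : ∀ W : AddSubgroup V,
      (∀ g : alternatingGroup (Fin 5), ∀ w ∈ W, g • w ∈ W) → W = ⊥ ∨ W = ⊤)
    (k : alternatingGroup (Fin 5)) (v : V) : cyclicSum (k * f * k⁻¹) v = 0 := by
  have key (v : V) : cyclicSum f v = 0 := by
    have hu := smul_cyclicSum_f v
    set u := cyclicSum f v
    have hxu : f • x • u = x • u := by
      have : f * x = x * f⁻¹ := by decide +kernel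
      rw [← mul_smul, this, mul_smul, inv_smul_eq_iff.2 hu.symm]
    have hxx : x • x • u = u := by
      rw [← mul_smul, ← sq, sq_eq_one x x_mem, one_smul]
    have h0 : u + x • u = 0 := eq_zero_of_smul_eq h2 hfix hirr
      (by rw [smul_add, hu, hxu]) (by rw [smul_add, hxx, add_comm])
    refine eq_zero_of_smul_eq h2 hfix hirr hu ?_
    rw [← h2 u] at h0
    exact add_left_cancel h0
  have : cyclicSum (k * f * k⁻¹) v = k • cyclicSum f (k⁻¹ • v) := by
    simp only [cyclicSum, conj_pow, smul_add, mul_smul, smul_inv_smul]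
  rw [this, key, smul_zero]

/-- Involutions `v` of `V4` act freely: every fixed vector is of the form `n + v • n`. -/
theorem exists_add_smul_eq (h2 : ∀ v : V, v + v = 0)
    (hfix : ∀ v : V, (∀ g : alternatingGroup (Fin 5), g • v = v) → v = 0)
    (hirr : ∀ W : AddSubgroup V,
      (∀ g : alternatingGroup (Fin 5), ∀ w ∈ W, g • w ∈ W) → W = ⊥ ∨ W = ⊤)
    {g : alternatingGroup (Fin 5)} (hg : g ∈ V4) (hg1 : g ≠ 1) {m : V} (hm : g • m = m) :
    ∃ n : V, g • n + n = m := by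
  obtain ⟨k, hk⟩ := exists_inverted g hg hg1
  have h5 : (k * f * k⁻¹) ^ 5 = 1 := by rw [conj_pow, f_pow_five, mul_one, mul_inv_cancel]
  have hs := cyclicSum_conj_eq_zero h2 hfix hirr k m
  set h := k * f * k⁻¹
  have hgh (n : ℕ) (hn : n ≤ 5) : g • h ^ n • m = h ^ (5 - n) • m := by
    have : g * h ^ n = h ^ (5 - n) * g := by
      rw [← mul_inv_eq_iff_eq_mul, ← conj_pow, hk, inv_pow, inv_eq_iff_mul_eq_one, ← pow_add,
        Nat.add_sub_cancel' hn, h5]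
    rw [← mul_smul, this, mul_smul, hm]
  refine ⟨h ^ 1 • m + h ^ 2 • m, ?_⟩
  rw [smul_add, hgh 1 (by simp), hgh 2 (by simp)]
  rw [← h2 m] at hs
  simp only [cyclicSum, add_assoc] at hs
  refine Eq.trans ?_ (add_left_cancel hs)
  simp only [pow_one, Nat.reduceSub]
  abel

end Module

end AltFive

namespace MonomialRep

variable {K : Type} [Group K] (P : Subgroup K)

/-- The element of `P` by which `g` moves the chosen representative of `g⁻¹ • c` to that of
`c`. -/
noncomputable def cocycle (g : K) (c : K ⧸ P) : P :=
  ⟨c.out⁻¹ * (g * (g⁻¹ • c).out), by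
    rw [← QuotientGroup.eq, QuotientGroup.out_eq', ← smul_eq_mul, ← MulAction.Quotient.smul_coe,
      QuotientGroup.out_eq', smul_inv_smul]⟩

lemma cocycle_mul (g h : K) (c : K ⧸ P) :
    cocycle P (g * h) c = cocycle P g c * cocycle P h (g⁻¹ • c) := by
  ext
  simp [cocycle, mul_smul, mul_assoc]

lemma cocycle_one (c : K ⧸ P) : cocycle P 1 c = 1 := by
  ext
  simp [cocycle]

variable {P}

/-- The representation of `K` induced from the linear character `μ` of `P`. -/
noncomputable def rep (μ : P →* ℂ) : Representation ℂ K (K ⧸ P → ℂ) where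
  toFun g :=
    { toFun := fun φ c ↦ μ (cocycle P g c) * φ (g⁻¹ • c)
      map_add' := fun φ ψ ↦ by ext; simp [mul_add]
      map_smul' := fun a φ ↦ by ext; simp [mul_left_comm] }
  map_one' := by ext; simp [cocycle_one]
  map_mul' g h := by
    ext
    simp [cocycle_mul, mul_smul, mul_assoc]

lemma rep_apply (μ : P →* ℂ) (g : K) (φ : K ⧸ P → ℂ) (c : K ⧸ P) :
    rep μ g φ c = μ (cocycle P g c) * φ (g⁻¹ • c) := rfl

lemma apply_ne_zero (μ : P →* ℂ) (p : P) : μ p ≠ 0 :=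
  ((Group.isUnit p).map μ).ne_zero

variable [Fintype K]

open Classical in
lemma trace_im (μ : P →* ℂ) (hμ : ∀ p, (μ p).im = 0) (g : K) :
    (LinearMap.trace ℂ _ (rep μ g)).im = 0 := by
  rw [LinearMap.trace_eq_matrix_trace ℂ (Pi.basisFun ℂ (K ⧸ P)), Matrix.trace, Complex.im_sum]
  refine Finset.sum_eq_zero fun c _ ↦ ?_
  simp [rep_apply, Pi.single_apply, apply_ite, hμ]

open Classical in
/-- Under Mackey's criterion, every endomorphism of the induced representation is scalar. -/
lemma exists_smul_eq (μ : P →* ℂ)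
    (hμ : ∀ g, g ∉ P → ∃ p : P, ∃ h : g * p * g⁻¹ ∈ P, μ p ≠ μ ⟨g * p * g⁻¹, h⟩)
    (A : Module.End ℂ (K ⧸ P → ℂ)) (hA : ∀ g φ, A (rep μ g φ) = rep μ g (A φ)) :
    ∃ a : ℂ, ∀ φ, A φ = a • φ := by
  set e : K ⧸ P := ((1 : K) : K ⧸ P) with he
  have heP : e.out ∈ P := by
    have := QuotientGroup.out_eq' e
    rw [he, eq_comm, QuotientGroup.eq] at this
    simpa using this
  let b : K ⧸ P → ℂ := Pi.single e 1
  have hb (g : K) : rep μ g b = μ (cocycle P g (g • e)) • Pi.single (g • e) 1 := by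
    ext c
    by_cases h : c = g • e
    · subst h
      simp [rep_apply, b]
    · have : g⁻¹ • c ≠ e := fun h' ↦ h (by rw [← h', smul_inv_smul])
      simp [rep_apply, b, h, this]
  have hAb : A b = A b e • b := by
    ext c
    by_cases hc : c = e
    · simp [hc, b]
    have hcP : c.out ∉ P := fun h ↦ hc (by
      rw [← QuotientGroup.out_eq' c, he, eq_comm, QuotientGroup.eq]
      simpa using h)
    obtain ⟨p, hp, hne⟩ := hμ _ hcP
    have hfixe : (c.out * p * c.out⁻¹) • e = e := by
      rw [he, MulAction.Quotient.smul_coe, eq_comm, QuotientGroup.eq]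
      simpa using hp
    have hfixc : (c.out * p * c.out⁻¹)⁻¹ • c = c := by
      conv_lhs => rw [← QuotientGroup.out_eq' c]
      conv_rhs => rw [← QuotientGroup.out_eq' c]
      rw [MulAction.Quotient.smul_coe, eq_comm, QuotientGroup.eq]
      simp [mul_assoc]
    have h1 : cocycle P (c.out * p * c.out⁻¹) c = p := by
      ext
      rw [cocycle]
      simp only [hfixc]
      group
    have h2 : μ (cocycle P (c.out * p * c.out⁻¹) e) = μ ⟨c.out * p * c.out⁻¹, hp⟩ := by
      have : cocycle P (c.out * p * c.out⁻¹) e =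
          ⟨e.out, heP⟩⁻¹ * ⟨c.out * p * c.out⁻¹, hp⟩ * ⟨e.out, heP⟩ := by
        ext
        have : (c.out * p * c.out⁻¹)⁻¹ • e = e := inv_smul_eq_iff.2 hfixe.symm
        simp only [cocycle, this]
        simp [mul_assoc]
      rw [this, map_mul, map_mul, mul_comm, ← mul_assoc, ← map_mul, mul_inv_cancel, map_one,
        one_mul]
    have h3 := congrFun (hA (c.out * p * c.out⁻¹) b) c
    rw [hb, hfixe, h2, rep_apply, h1, hfixc, map_smul, Pi.smul_apply, smul_eq_mul] at h3
    have h4 : A b c = 0 := by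
      by_contra h
      exact hne (mul_right_cancel₀ h h3).symm
    simp [h4, b, hc]
  refine ⟨A b e, fun φ ↦ ?_⟩
  suffices A = A b e • LinearMap.id by rw [this]; simp [b]
  refine (Pi.basisFun ℂ (K ⧸ P)).ext fun c ↦ ?_
  have hc : c.out • e = c := by
    rw [he, MulAction.Quotient.smul_coe, smul_eq_mul, mul_one, QuotientGroup.out_eq']
  have h1 := hA c.out b
  rw [hAb, map_smul, hb, hc, map_smul, smul_comm] at h1
  simpa using smul_right_injective _ (apply_ne_zero μ _) h1

theorem simple (μ : P →* ℂ)
    (hμ : ∀ g, g ∉ P → ∃ p : P, ∃ h : g * p * g⁻¹ ∈ P, μ p ≠ μ ⟨g * p * g⁻¹, h⟩) :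
    Simple (FDRep.of (rep μ)) := by
  have : NeZero (Nat.card K : ℂ) := ⟨Nat.cast_ne_zero.2 Nat.card_pos.ne'⟩
  rw [FDRep.simple_iff_end_is_rank_one]
  have h1 : 𝟙 (FDRep.of (rep μ)) ≠ 0 := by
    intro h
    have h2 := congrArg (fun F : FDRep.of (rep μ) ⟶ FDRep.of (rep μ) ↦ F.hom.hom.hom) h
    have h3 : (1 : Module.End ℂ (K ⧸ P → ℂ)) = 0 := h2
    exact one_ne_zero h3
  rw [finrank_eq_one_iff_of_nonzero' _ h1]
  intro F
  obtain ⟨a, ha⟩ := exists_smul_eq μ hμ F.hom.hom.hom fun g φ ↦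
    congrArg (fun T : (FDRep.of (rep μ)).V ⟶ (FDRep.of (rep μ)).V ↦ T.hom.hom φ) (F.comm g)
  refine ⟨a, ?_⟩
  ext φ
  exact congrFun (ha φ).symm _

theorem exists_irrChar (μ : P →* ℂ) (hre : ∀ p, (μ p).im = 0)
    (hμ : ∀ g, g ∉ P → ∃ p : P, ∃ h : g * p * g⁻¹ ∈ P, μ p ≠ μ ⟨g * p * g⁻¹, h⟩) :
    ∃ χ : K → ℂ, IsIrrChar K χ ∧ IsRealValued χ ∧ χ 1 = P.index := by
  refine ⟨_, ⟨_, simple μ hμ, rfl⟩, fun g ↦ trace_im μ hre g, ?_⟩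
  rw [FDRep.char_one]
  have : Module.finrank ℂ (K ⧸ P → ℂ) = P.index := by
    classical
    rw [Module.finrank_fintype_fun_eq_card, Subgroup.index, Nat.card_eq_fintype_card]
  exact_mod_cast this

end MonomialRep

lemma exists_monoidHom_apply_ne_one {G : Type*} [Group G] [Finite G] (D : Subgroup G) [D.Normal]
    (hD : ∀ g : G, g ^ 2 ∈ D) {q : G} (hq : q ∉ D) :
    ∃ μ : G →* ℂ, (∀ g, μ g ^ 2 = 1) ∧ μ q ≠ 1 := by
  have hsq (a : G ⧸ D) : a ^ 2 = 1 := by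
    obtain ⟨g, rfl⟩ := QuotientGroup.mk_surjective a
    exact (QuotientGroup.eq_one_iff _).2 (hD g)
  let : CommGroup (G ⧸ D) :=
    { (inferInstance : Group (G ⧸ D)) with
      mul_comm := fun a b ↦ by
        have hinv (a : G ⧸ D) : a⁻¹ = a := inv_eq_of_mul_eq_one_left (by rw [← sq, hsq])
        rw [← hinv (a * b), mul_inv_rev, hinv, hinv] }
  obtain ⟨ν, hν⟩ := CommGroup.exists_apply_ne_one_of_hasEnoughRootsOfUnity (G ⧸ D) ℂ
    (a := (q : G ⧸ D)) (by rwa [Ne, QuotientGroup.eq_one_iff])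
  refine ⟨(Units.coeHom ℂ).comp (ν.comp (QuotientGroup.mk' D)), fun g ↦ ?_, fun h ↦ hν ?_⟩
  · rw [← map_pow, MonoidHom.comp_apply, MonoidHom.comp_apply, map_pow, QuotientGroup.mk'_apply,
      hsq, map_one, map_one]
  · exact Units.ext h

lemma exists_monoidHom_apply_ne_one₂ {G : Type*} [Group G] [Finite G] (D : Subgroup G) [D.Normal]
    (hD : ∀ g : G, g ^ 2 ∈ D) {q r : G} (hq : q ∉ D) (hr : r ∉ D) :
    ∃ μ : G →* ℂ, (∀ g, μ g ^ 2 = 1) ∧ μ q ≠ 1 ∧ μ r ≠ 1 := by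
  obtain ⟨μ, hμ, hμq⟩ := exists_monoidHom_apply_ne_one D hD hq
  obtain ⟨ν, hν, hνr⟩ := exists_monoidHom_apply_ne_one D hD hr
  by_cases h1 : μ r = 1
  · by_cases h2 : ν q = 1
    · refine ⟨μ * ν, fun g ↦ ?_, ?_, ?_⟩
      · rw [MonoidHom.mul_apply, mul_pow, hμ, hν, one_mul]
      · rwa [MonoidHom.mul_apply, h2, mul_one]
      · rwa [MonoidHom.mul_apply, h1, one_mul]
    · exact ⟨ν, hν, h2, hνr⟩
  · exact ⟨μ, hμ, hμq, h1⟩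

lemma commutator_top_ne_of_isNilpotent {G : Type*} [Group G] [Group.IsNilpotent G]
    {N : Subgroup G} (hN : N ≠ ⊥) : ⁅N, (⊤ : Subgroup G)⁆ ≠ N := by
  intro h
  have key (n : ℕ) : N ≤ (⊤ : Subgroup G).lowerCentralSeries n := by
    induction n with
    | zero => simp
    | succ n ih =>
      rw [Subgroup.lowerCentralSeries_succ]
      exact h.ge.trans (Subgroup.commutator_mono ih le_rfl)
  obtain ⟨n, hn⟩ := Subgroup.nilpotent_iff_lowerCentralSeries.1 ‹Group.IsNilpotent G›
  exact hN (le_bot_iff.1 ((key n).trans hn.le))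

namespace AltFive

variable {K : Type} [Group K] {M : Subgroup K} [M.Normal]

/-- The action of `K` on an abelian minimal normal subgroup by conjugation, as a simple module
for the quotient. -/
lemma exists_distribMulAction {G : Type*} [Group G]
    (hmin : ∀ N : Subgroup K, N.Normal → N ≤ M → N = ⊥ ∨ N = M)
    (helem : ∀ m : M, m ^ 2 = 1) (hnc : ¬ M ≤ Subgroup.center K)
    (φ : K →* G) (hφ : Function.Surjective φ) (hker : φ.ker = M) :
    ∃ (V : Type) (_ : AddCommGroup V) (_ : DistribMulAction G V) (i : M ≃ V),
      (∀ a b : M, i a + i b = i (a * b)) ∧ 0 = i 1 ∧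
      (∀ k (m : M), φ k • i m = i (MulAut.conjNormal k m)) ∧
      (∀ v : V, v + v = 0) ∧
      (∀ v : V, (∀ g : G, g • v = v) → v = 0) ∧
      (∀ W : AddSubgroup V, (∀ g : G, ∀ w ∈ W, g • w ∈ W) → W = ⊥ ∨ W = ⊤) := by
  have hinv (a : M) : a⁻¹ = a := inv_eq_of_mul_eq_one_left (by rw [← sq, helem])
  have hcomm (a b : M) : a * b = b * a := by
    rw [← hinv (a * b), mul_inv_rev, hinv, hinv]
  let : CommGroup M := { (inferInstance : Group M) with mul_comm := hcomm }
  have hle : φ.ker ≤ (MulAut.conjNormal : K →* MulAut M).ker := by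
    rw [hker]
    intro m hm
    rw [MonoidHom.mem_ker]
    ext n
    have := congrArg Subtype.val (hcomm ⟨m, hm⟩ n)
    simp only [Subgroup.coe_mul] at this
    rw [MulAut.conjNormal_apply, this]
    simp
  let ψ : G →* MulAut M := φ.liftOfSurjective hφ ⟨MulAut.conjNormal, hle⟩
  have hψ (k : K) : ψ (φ k) = MulAut.conjNormal k :=
    φ.liftOfRightInverse_comp_apply _ _ ⟨MulAut.conjNormal, hle⟩ k
  let act : DistribMulAction G (Additive M) :=
    { smul := fun g v ↦ Additive.ofMul (ψ g v.toMul)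
      one_smul := fun v ↦ congrArg Additive.ofMul (by rw [map_one]; rfl)
      mul_smul := fun g h v ↦ congrArg Additive.ofMul (by rw [map_mul]; rfl)
      smul_zero := fun g ↦ congrArg Additive.ofMul (map_one (ψ g))
      smul_add := fun g v w ↦ congrArg Additive.ofMul (map_mul (ψ g) v.toMul w.toMul) }
  have hsmul (k : K) (m : M) :
      φ k • Additive.ofMul m = Additive.ofMul (MulAut.conjNormal k m) :=
    congrArg Additive.ofMul (by rw [hψ]; rfl)
  refine ⟨Additive M, inferInstance, act, Additive.ofMul, fun _ _ ↦ rfl, rfl, hsmul, fun v ↦ ?_, fun v hv ↦ ?_,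
    fun W hW ↦ ?_⟩
  · exact congrArg Additive.ofMul ((sq v.toMul).symm.trans (helem _))
  · have hbot : Subgroup.center K ⊓ M = ⊥ :=
      (hmin _ inferInstance inf_le_right).resolve_right fun h ↦ hnc (inf_eq_right.1 h)
    have hmem : (v.toMul : K) ∈ Subgroup.center K ⊓ M := by
      refine ⟨Subgroup.mem_center_iff.2 fun k ↦ ?_, v.toMul.2⟩
      have h1 : MulAut.conjNormal k v.toMul = v.toMul :=
        congrArg Additive.toMul ((hsmul k v.toMul).symm.trans (hv (φ k)))
      have h2 := congrArg Subtype.val h1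
      rwa [MulAut.conjNormal_apply, mul_inv_eq_iff_eq_mul] at h2
    rw [hbot, Subgroup.mem_bot] at hmem
    exact congrArg Additive.ofMul (Subtype.ext hmem)
  · let N : Subgroup K := (AddSubgroup.toSubgroup' W).map M.subtype
    have hmemN (m : M) : (m : K) ∈ N ↔ Additive.ofMul m ∈ W := by
      refine ⟨?_, fun h ↦ ⟨m, h, rfl⟩⟩
      rintro ⟨m', hm', h⟩
      rw [← Subtype.ext h]
      exact hm'
    have hN : N.Normal := ⟨by
      rintro _ ⟨m, hm, rfl⟩ k
      have h1 := hW (φ k) _ hm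
      exact ⟨MulAut.conjNormal k m, h1 |> fun h ↦ (hsmul k m) ▸ h, rfl⟩⟩
    have hNM : N ≤ M := Subgroup.map_subtype_le _
    refine (hmin N hN hNM).imp (fun h ↦ ?_) (fun h ↦ ?_)
    · refine (AddSubgroup.eq_bot_iff_forall _).2 fun v hv ↦ ?_
      have := (hmemN v.toMul).2 hv
      rw [h, Subgroup.mem_bot] at this
      exact congrArg Additive.ofMul (Subtype.ext this)
    · refine (AddSubgroup.eq_top_iff' _).2 fun v ↦ (hmemN v.toMul).1 ?_
      rw [h]
      exact v.toMul.2

open scoped commutatorElement in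
/-- The preimage of `V4` has a linear character with values `±1` satisfying Mackey's criterion
for the irreducibility of the induced character. -/
theorem exists_mackey_character [Finite K]
    (hmin : M ≠ ⊥ ∧ ∀ N : Subgroup K, N.Normal → N ≤ M → N = ⊥ ∨ N = M)
    (helem : ∀ m : M, m ^ 2 = 1) (hnc : ¬ M ≤ Subgroup.center K)
    (φ : K →* alternatingGroup (Fin 5)) (hφ : Function.Surjective φ) (hker : φ.ker = M) :
    ∃ μ : V4.comap φ →* ℂ, (∀ p, μ p ^ 2 = 1) ∧
      ∀ g, g ∉ V4.comap φ → ∃ p : V4.comap φ, ∃ h : g * p * g⁻¹ ∈ V4.comap φ,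
        μ p ≠ μ ⟨g * p * g⁻¹, h⟩ := by
  obtain ⟨V, _, _, i, hadd, hzero, hsmul, h2, hfix, hirr⟩ :=
    exists_distribMulAction hmin.2 helem hnc φ hφ hker
  have hmemM (k : K) : k ∈ M ↔ φ k = 1 := by rw [← hker, MonoidHom.mem_ker]
  set P := V4.comap φ with hP
  have hMP : M ≤ P := fun m hm ↦ by
    rw [hP, Subgroup.mem_comap, (hmemM m).1 hm]
    exact one_mem _
  have hsqM (p : P) : (p : K) ^ 2 ∈ M := by
    rw [hmemM, map_pow]
    exact sq_eq_one _ p.2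
  have : Fact (Nat.Prime 2) := ⟨Nat.prime_two⟩
  have : Group.IsNilpotent P := by
    refine IsPGroup.isNilpotent (p := 2) fun p ↦ ⟨2, Subtype.ext ?_⟩
    have := congrArg Subtype.val (helem ⟨_, hsqM p⟩)
    rwa [Subgroup.coe_pow, ← pow_mul] at this
  set N : Subgroup P := M.subgroupOf P with hN
  have hN0 : N ≠ ⊥ := by
    rw [hN, Ne, Subgroup.subgroupOf_eq_bot, disjoint_iff, inf_eq_left.2 hMP]
    exact hmin.1
  set D : Subgroup P := ⁅N, ⊤⁆ with hD
  have hDN : D ≤ N := Subgroup.commutator_le_left _ _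
  have hsqD (p : P) : p ^ 2 ∈ D := by
    by_cases hp : φ p = 1
    · have := congrArg Subtype.val (helem ⟨p, (hmemM p).2 hp⟩)
      have : p ^ 2 = 1 := Subtype.ext this
      rw [this]
      exact one_mem _
    · have hm : φ p • i (⟨_, hsqM p⟩ : M) = i ⟨_, hsqM p⟩ := by
        rw [hsmul]
        congr 1
        ext
        simp [sq, mul_assoc]
      obtain ⟨n, hn⟩ := exists_add_smul_eq h2 hfix hirr p.2 hp hm
      obtain ⟨n, rfl⟩ := i.surjective n
      rw [hsmul, hadd] at hn
      have hn' : (p : K) * n * (p : K)⁻¹ * n = (p : K) ^ 2 :=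
        congrArg Subtype.val (i.injective hn)
      have hninv : (n : K)⁻¹ = n :=
        inv_eq_of_mul_eq_one_left (by simpa [sq] using congrArg Subtype.val (helem n))
      have : p ^ 2 = ⁅p, ⟨n, hMP n.2⟩⁆ := by
        ext
        rw [commutatorElement_def]
        simp [hninv, hn']
      rw [this, hD, Subgroup.commutator_comm]
      exact Subgroup.commutator_mem_commutator (Subgroup.mem_top _)
        (Subgroup.mem_subgroupOf.2 n.2)
  obtain ⟨q, hqN, hqD⟩ := Set.exists_of_ssubset
    (hDN.lt_of_ne (commutator_top_ne_of_isNilpotent hN0))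
  obtain ⟨c', hc'⟩ := hφ c
  obtain ⟨x', hx'⟩ := hφ x
  have hxP : x' ∈ P := by rw [hP, Subgroup.mem_comap, hx']; exact x_mem
  have hcP (p : K) (hp : p ∈ P) : c' * p * c'⁻¹ ∈ P := by
    rw [hP, Subgroup.mem_comap, map_mul, map_mul, map_inv, hc']
    exact c_conj_mem _ hp
  have hr : (⟨x', hxP⟩⁻¹ * ⟨c' * x' * c'⁻¹, hcP x' hxP⟩ : P) ∉ D := fun h ↦ by
    have := Subgroup.mem_subgroupOf.1 (hDN h)
    rw [hmemM] at this
    apply x_inv_mul_c_conj_ne_one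
    simpa [hx', hc'] using this
  obtain ⟨μ, hμ, hμq, hμr⟩ := exists_monoidHom_apply_ne_one₂ D hsqD hqD hr
  have hconj (a b : P) : μ (a * b * a⁻¹) = μ b := by
    rw [map_mul, map_mul, mul_comm, ← mul_assoc, ← map_mul, inv_mul_cancel, map_one, one_mul]
  have hμx : μ ⟨x', hxP⟩ ≠ μ ⟨c' * x' * c'⁻¹, hcP x' hxP⟩ := fun h ↦ hμr (by
    rw [map_mul, ← h, ← map_mul, inv_mul_cancel, map_one])
  refine ⟨μ, hμ, fun g hg ↦ ?_⟩
  by_cases hg0 : (φ g : Equiv.Perm (Fin 5)) 0 = 0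
  · obtain h | h := eq_mul_c _ hg0 hg
    · rw [← hc', ← map_inv, ← map_mul] at h
      have heq : g * x' * g⁻¹ = (g * c'⁻¹) * (c' * x' * c'⁻¹) * (g * c'⁻¹)⁻¹ := by group
      have hmem : g * x' * g⁻¹ ∈ P := by
        rw [heq]
        exact mul_mem (mul_mem h (hcP x' hxP)) (inv_mem h)
      refine ⟨⟨x', hxP⟩, hmem, ?_⟩
      have : (⟨g * x' * g⁻¹, hmem⟩ : P) =
          ⟨g * c'⁻¹, h⟩ * ⟨c' * x' * c'⁻¹, hcP x' hxP⟩ * ⟨g * c'⁻¹, h⟩⁻¹ := Subtype.ext heq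
      rwa [this, hconj]
    · rw [← hc', ← map_mul] at h
      have heq : g * (c' * x' * c'⁻¹) * g⁻¹ = (g * c') * x' * (g * c')⁻¹ := by group
      have hmem : g * (c' * x' * c'⁻¹) * g⁻¹ ∈ P := by
        rw [heq]
        exact mul_mem (mul_mem h hxP) (inv_mem h)
      refine ⟨⟨c' * x' * c'⁻¹, hcP x' hxP⟩, hmem, ?_⟩
      have : (⟨g * (c' * x' * c'⁻¹) * g⁻¹, hmem⟩ : P) =
          ⟨g * c', h⟩ * ⟨x', hxP⟩ * ⟨g * c', h⟩⁻¹ := Subtype.ext heq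
      rw [this, hconj]
      exact hμx.symm
  · by_contra! hall
    obtain ⟨v, hv, k, hk⟩ := exists_mul_eq_conj _ hg0
    obtain ⟨v', rfl⟩ := hφ v
    rw [← map_mul] at hk
    let l : M →* ℂ := μ.comp (Subgroup.inclusion hMP)
    have hlg (m : M) : l (MulAut.conjNormal g m) = l m :=
      (hall (Subgroup.inclusion hMP m) (hMP (MulAut.conjNormal g m).2)).symm
    have hlv (m : M) : l (MulAut.conjNormal v' m) = l m :=
      hconj ⟨v', hv⟩ (Subgroup.inclusion hMP m)
    have hlpow (n : ℕ) (m : M) : l (MulAut.conjNormal ((g * v') ^ n) m) = l m := by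
      induction n with
      | zero => simp
      | succ n ih =>
        rw [pow_succ', map_mul, MulAut.mul_apply, map_mul, MulAut.mul_apply, hlg, hlv, ih]
    have hsum := cyclicSum_conj_eq_zero h2 hfix hirr k (i ⟨q, hqN⟩)
    rw [← hk] at hsum
    simp only [cyclicSum, ← map_pow, hsmul, hadd, hzero] at hsum
    have hprod := congrArg l (i.injective hsum)
    have hl1 := hlpow 1
    rw [pow_one] at hl1
    simp only [map_mul l, hlpow, hl1, map_one l] at hprod
    have hlq : l ⟨q, hqN⟩ = μ q := rfl
    have hq2 := hμ q
    rw [hlq] at hprod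
    exact hμq (by linear_combination hprod - (μ q ^ 3 + μ q) * hq2)

end AltFive

theorem perfect_extension_of_A5_has_real_char_degree_15
    (K : Type) [Group K] [Fintype K] (hperf : commutator K = ⊤)
    (M : Subgroup K) [hMn : M.Normal]
    (hmin : M ≠ ⊥ ∧ ∀ N : Subgroup K, N.Normal → N ≤ M → N = ⊥ ∨ N = M)
    (helem : ∀ m : ↥M, m ^ 2 = 1)
    (hnc : ¬ M ≤ Subgroup.center K)
    (hquot : Nonempty ((K ⧸ M) ≃* alternatingGroup (Fin 5))) :
    ∃ χ : K → ℂ, IsIrrChar K χ ∧ IsRealValued χ ∧ χ 1 = 15 := by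
  obtain ⟨e⟩ := hquot
  have hφ : Function.Surjective (e.toMonoidHom.comp (QuotientGroup.mk' M)) :=
    e.surjective.comp (QuotientGroup.mk'_surjective M)
  have hker : (e.toMonoidHom.comp (QuotientGroup.mk' M)).ker = M := by
    ext k
    simp
  obtain ⟨μ, hsq, hμ⟩ := AltFive.exists_mackey_character hmin helem hnc _ hφ hker
  have hre (p) : (μ p).im = 0 := by
    obtain h | h := sq_eq_one_iff.1 (hsq p) <;> rw [h] <;> simp
  obtain ⟨χ, h1, h2, h3⟩ := MonomialRep.exists_irrChar μ hre hμ
  refine ⟨χ, h1, h2, ?_⟩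
  rw [h3, Subgroup.index_comap_of_surjective _ hφ, AltFive.index_V4]
  norm_num
end

section
/- Let K be a finite perfect group and M a minimal normal subgroup of K which is an elementary abelian 2-group, noncentral in K, with K/M isomorphic to PSL₂(8). Then K has a real-valued irreducible character of degree 63 (odd and not a prime power). -/
open CategoryTheory Matrix

/-- The field with 8 elements. -/
noncomputable abbrev GF8 := GaloisField 2 3

/-- The group `PSL₂(8)`. -/
noncomputable def PSL2_8 : Type :=
  SpecialLinearGroup (Fin 2) GF8 ⧸ Subgroup.center (SpecialLinearGroup (Fin 2) GF8)

noncomputable instance : Group PSL2_8 :=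
  inferInstanceAs (Group (_ ⧸ Subgroup.center (SpecialLinearGroup (Fin 2) GF8)))

section MonomialRepresentation

variable {K : Type} [Group K] (S : Subgroup K)

/-- The element of `S` by which `k` moves the chosen representative of the coset `x` relative to
the chosen representative of `k • x`. -/
noncomputable def cosetCocycle (k : K) (x : K ⧸ S) : S :=
  ⟨(k • x).out⁻¹ * (k * x.out), by
    rw [← QuotientGroup.eq, QuotientGroup.out_eq', ← smul_eq_mul, ← MulAction.Quotient.smul_mk,
      QuotientGroup.out_eq']⟩

lemma cosetCocycle_mul (k l : K) (x : K ⧸ S) :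
    cosetCocycle S (k * l) x = cosetCocycle S k (l • x) * cosetCocycle S l x := by
  ext
  simp [cosetCocycle, mul_smul, mul_assoc]

lemma cosetCocycle_one (x : K ⧸ S) : cosetCocycle S 1 x = 1 := by
  ext
  simp [cosetCocycle]

/-- The monomial representation induced from a sign character of `S`. -/
noncomputable def monomialRep (μ : S →* ℤˣ) : Representation ℂ K (K ⧸ S → ℂ) where
  toFun k :=
    { toFun := fun f x => ((μ (cosetCocycle S k (k⁻¹ • x)) : ℤ) : ℂ) * f (k⁻¹ • x)
      map_add' := fun f g => by ext x; simp [mul_add]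
      map_smul' := fun c f => by ext x; simp; ring }
  map_one' := by ext f x; simp [cosetCocycle_one]
  map_mul' k l := by
    refine LinearMap.ext fun f => funext fun x => ?_
    simp [cosetCocycle_mul, mul_smul, mul_assoc]

lemma monomialRep_apply (μ : S →* ℤˣ) (k : K) (f : K ⧸ S → ℂ) (x : K ⧸ S) :
    monomialRep S μ k f x = ((μ (cosetCocycle S k (k⁻¹ • x)) : ℤ) : ℂ) * f (k⁻¹ • x) := rfl

lemma monomialRep_character_im [Finite K] (μ : S →* ℤˣ) (k : K) :
    (LinearMap.trace ℂ _ (monomialRep S μ k)).im = 0 := by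
  classical
  have := Fintype.ofFinite (K ⧸ S)
  rw [LinearMap.trace_eq_matrix_trace ℂ (Pi.basisFun ℂ (K ⧸ S)), Matrix.trace, Complex.im_sum]
  refine Finset.sum_eq_zero fun x _ => ?_
  simp only [Matrix.diag_apply, LinearMap.toMatrix_apply, Pi.basisFun_apply, Pi.basisFun_repr,
    monomialRep_apply, Pi.single_apply]
  split_ifs <;> simp

/-- The stabilizer of a coset acts on the corresponding coordinate through the conjugate of `μ`. -/
lemma cosetCocycle_of_mem (μ : S →* ℤˣ) (g : K) (s : K) (h : g⁻¹ * s * g ∈ S) :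
    s • (g : K ⧸ S) = g ∧ μ (cosetCocycle S s g) = μ ⟨g⁻¹ * s * g, h⟩ := by
  have h1 : s • (g : K ⧸ S) = g := by
    rw [MulAction.Quotient.smul_mk, smul_eq_mul, eq_comm, QuotientGroup.eq]
    simpa [mul_assoc] using h
  refine ⟨h1, ?_⟩
  obtain ⟨t, ht⟩ := QuotientGroup.mk_out_eq_mul S g
  have : cosetCocycle S s g = t⁻¹ * ⟨g⁻¹ * s * g, h⟩ * t := by
    ext
    simp [cosetCocycle, h1, ht, mul_assoc]
  rw [this, map_mul, map_mul, map_inv, mul_right_comm, inv_mul_cancel, one_mul]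

/-- Mackey's irreducibility criterion for monomial representations. -/
theorem monomialRep_simple [Finite K] (μ : S →* ℤˣ)
    (hμ : ∀ g : K, g ∉ S → ∃ s : S, ∃ h : g⁻¹ * s * g ∈ S, μ ⟨g⁻¹ * s * g, h⟩ ≠ μ s) :
    Simple (FDRep.of (monomialRep S μ)) := by
  classical
  set V := FDRep.of (monomialRep S μ) with hV
  have hK : NeZero (Nat.card K : ℂ) := ⟨Nat.cast_ne_zero.mpr Nat.card_pos.ne'⟩
  let b : K ⧸ S := ((1 : K) : K ⧸ S)
  let e : K ⧸ S → (K ⧸ S → ℂ) := fun x => Pi.single x 1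
  have he : ∀ s : S, monomialRep S μ s (e b) = ((μ s : ℤ) : ℂ) • e b := by
    intro s
    have hs : ∀ t : S, (t : K) • b = b ∧ μ (cosetCocycle S t b) = μ t := by
      intro t
      have ht : (1 : K)⁻¹ * t * 1 ∈ S := by simp
      obtain ⟨h1, h2⟩ := cosetCocycle_of_mem S μ 1 t ht
      exact ⟨h1, h2.trans (congrArg μ (Subtype.ext (by simp)))⟩
    ext x
    rw [monomialRep_apply, Pi.smul_apply, smul_eq_mul]
    by_cases hx : x = b
    · subst hx
      have h1 := (hs s⁻¹).1
      rw [Subgroup.coe_inv] at h1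
      rw [h1, (hs s).2]
    · have h2 : (s : K)⁻¹ • x ≠ b := fun h => hx (by rw [inv_smul_eq_iff] at h; rw [h, (hs s).1])
      simp [e, hx, h2]
  have hfix : ∀ w : K ⧸ S → ℂ, (∀ s : S, monomialRep S μ s w = ((μ s : ℤ) : ℂ) • w) →
      ∀ x, x ≠ b → w x = 0 := by
    intro w hw x hx
    induction x using QuotientGroup.induction_on with
    | H g =>
      have hg : g ∉ S := fun h => hx (by
        change (g : K ⧸ S) = ((1 : K) : K ⧸ S)
        rw [eq_comm, QuotientGroup.eq]; simpa using h)
      obtain ⟨s, h, hne⟩ := hμ g hg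
      obtain ⟨h1, h2⟩ := cosetCocycle_of_mem S μ g s h
      have h3 := congrFun (hw s) g
      have h4 : (s : K)⁻¹ • (g : K ⧸ S) = g := by rw [inv_smul_eq_iff, h1]
      rw [monomialRep_apply, h4, h2, Pi.smul_apply, smul_eq_mul] at h3
      by_contra h0
      have h5 := mul_right_cancel₀ h0 h3
      exact hne (Units.ext (by exact_mod_cast h5))
  have hgen : ∀ x : K ⧸ S, ∃ k : K, ∃ u : ℤˣ, e x = ((u : ℤ) : ℂ) • monomialRep S μ k (e b) := by
    intro x
    induction x using QuotientGroup.induction_on with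
    | H g =>
      have hg : g • b = (g : K ⧸ S) := by simp [b, MulAction.Quotient.smul_mk]
      refine ⟨g, μ (cosetCocycle S g b), ?_⟩
      ext y
      rw [Pi.smul_apply, smul_eq_mul, monomialRep_apply]
      by_cases hy : y = g
      · subst hy
        have : g⁻¹ • (g : K ⧸ S) = b := by rw [inv_smul_eq_iff, hg]
        rw [this, ← mul_assoc, ← Int.cast_mul, ← Units.val_mul, Int.units_mul_self]
        simp [e]
      · have : g⁻¹ • y ≠ b := fun h => hy (by rw [inv_smul_eq_iff] at h; rw [h, hg])
        simp [e, hy, this]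
  rw [FDRep.simple_iff_end_is_rank_one]
  refine (finrank_eq_one_iff_of_nonzero' (𝟙 V) ?_).mpr fun f => ?_
  · intro h
    have h1 := congrArg (fun f : V ⟶ V => f.hom.hom.hom (e b)) h
    have h2 : e b = 0 := h1
    have h3 := congrFun h2 b
    simp [e] at h3
  · let F : (K ⧸ S → ℂ) →ₗ[ℂ] (K ⧸ S → ℂ) := f.hom.hom.hom
    have hF : ∀ k w, F (monomialRep S μ k w) = monomialRep S μ k (F w) := by
      intro k w
      exact ConcreteCategory.congr_hom ((forget (FGModuleCat ℂ)).congr_map (f.comm k)) w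
    have hFb : F (e b) = F (e b) b • e b := by
      ext x
      by_cases hx : x = b
      · subst hx; simp [e]
      · rw [hfix (F (e b)) (fun s => by rw [← hF, he, map_smul]) x hx]
        simp [e, hx]
    refine ⟨F (e b) b, ?_⟩
    have hFe : ∀ x, F (e x) = F (e b) b • e x := by
      intro x
      obtain ⟨k, u, hx⟩ := hgen x
      rw [hx, map_smul, hF, hFb, map_smul, smul_comm]
      simp [e]
    have : F (e b) b • LinearMap.id = F := by
      have := Fintype.ofFinite (K ⧸ S)
      refine (Pi.basisFun ℂ (K ⧸ S)).ext fun x => ?_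
      rw [Pi.basisFun_apply, hFe x]
      simp [e]
    apply Action.Hom.ext
    apply InducedCategory.hom_ext
    apply ModuleCat.hom_ext
    exact this

end MonomialRepresentation

section SelfPairedDoubleCosets

variable {G V : Type*} [Group G] [AddCommGroup V] [DistribMulAction G V]

lemma exists_ne_zero_common_fixed {ι : Type*} (U : AddSubgroup V)
    (hV : ∀ v : V, v + v = 0) (A : ι → V →+ V) (hU : ∀ i, ∀ v ∈ U, A i v ∈ U)
    (hsq : ∀ i, ∀ v ∈ U, A i (A i v) = v)
    (hcomm : ∀ i j, ∀ v ∈ U, A i (A j v) = A j (A i v)) {v : V} (hv : v ∈ U) (hv0 : v ≠ 0)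
    (s : Finset ι) : ∃ w ∈ U, w ≠ 0 ∧ ∀ i ∈ s, A i w = w := by
  classical
  induction s using Finset.induction_on with
  | empty => exact ⟨v, hv, hv0, by simp⟩
  | insert j s _ ih =>
    obtain ⟨w, hw, hw0, hs⟩ := ih
    by_cases h : A j w = w
    · exact ⟨w, hw, hw0, by simpa [h] using hs⟩
    · refine ⟨w + A j w, U.add_mem hw (hU j w hw), fun h0 => h ?_, fun i hi => ?_⟩
      · exact add_left_cancel (h0.trans (hV w).symm)
      · rcases Finset.mem_insert.mp hi with rfl | hi
        · rw [map_add, hsq _ _ hw, add_comm]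
        · rw [map_add, hcomm _ _ _ hw, hs i hi]

/-- Let `C` be a subgroup of odd order of a finite group `G` all of whose double cosets are closed
under inversion. Then `C` has no nonzero fixed vectors on a nontrivial irreducible module in
characteristic two. -/
theorem fixed_eq_zero_of_selfPaired_doubleCosets [Finite G] (hV : ∀ v : V, v + v = 0)
    (hirr : ∀ W : AddSubgroup V, (∀ g : G, ∀ w ∈ W, g • w ∈ W) → W = ⊥ ∨ W = ⊤)
    (hnt : ∃ g : G, ∃ v : V, g • v ≠ v) (C : Subgroup G) (hodd : Odd (Nat.card C))
    (hC : ∀ z : G, ∃ c ∈ C, ∃ d ∈ C, z⁻¹ = c * z * d)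
    (v : V) (hv : ∀ c ∈ C, c • v = v) : v = 0 := by
  classical
  have := Fintype.ofFinite G
  by_contra hv0
  let U : AddSubgroup V :=
    { carrier := {w | ∀ c ∈ C, c • w = w}
      add_mem' := fun ha hb c hc => by rw [smul_add, ha c hc, hb c hc]
      zero_mem' := fun c _ => smul_zero c
      neg_mem' := fun ha c hc => by rw [smul_neg, ha c hc] }
  let e : V →+ V := ∑ c : C, DistribSMul.toAddMonoidHom V (c : G)
  have he : ∀ w, e w = ∑ c : C, (c : G) • w := fun w => by simp [e]
  have heU : ∀ w, e w ∈ U := by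
    intro w c hc
    rw [he, Finset.smul_sum]
    refine Fintype.sum_equiv (Equiv.mulLeft (⟨c, hc⟩ : C)) _ _ fun d => ?_
    simp [mul_smul]
  have hfix : ∀ w ∈ U, e w = w := by
    intro w hw
    have hc : ∀ c : C, (c : G) • w = w := fun c => hw c c.2
    simp only [he, hc]
    rw [Finset.sum_const, Finset.card_univ,
      ← Nat.card_eq_fintype_card]
    obtain ⟨k, hk⟩ := hodd
    rw [hk, add_smul, mul_comm, mul_smul, two_smul, hV, smul_zero, zero_add, one_smul]
  have heC : ∀ c ∈ C, ∀ w, e (c • w) = e w := by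
    intro c hc w
    rw [he, he]
    refine Fintype.sum_equiv (Equiv.mulRight (⟨c, hc⟩ : C)) _ _ fun d => ?_
    simp [mul_smul]
  let A : G → V →+ V := fun z => e.comp (DistribSMul.toAddMonoidHom V z)
  have hA : ∀ z w, A z w = e (z • w) := fun z w => rfl
  have hinv : ∀ z, ∀ w ∈ U, A z⁻¹ w = A z w := by
    intro z w hw
    obtain ⟨c, hc, d, hd, h⟩ := hC z
    rw [hA, hA, h, mul_smul, mul_smul, heC c hc, hw d hd]
  have hmul : ∀ x y w, A x (A y w) = ∑ c : C, A (x * c * y) w := by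
    intro x y w
    simp only [hA, he (y • w), Finset.smul_sum, map_sum, mul_smul]
  have hsq : ∀ z, ∀ w ∈ U, A z (A z w) = w := by
    intro z w hw
    rw [← hinv z w hw, hmul, ← Finset.add_sum_erase _ _ (Finset.mem_univ (1 : C))]
    rw [Finset.sum_involution (fun c _ => c⁻¹)]
    · simp [hA, hfix w hw]
    · intro c _
      have : z * ((c⁻¹ : C) : G) * z⁻¹ = (z * c * z⁻¹)⁻¹ := by simp [mul_assoc]
      rw [this, hinv _ w hw, hV]
    · intro c hc _ h
      have h2 : c ^ 2 = 1 := by rw [pow_two]; nth_rewrite 1 [← h]; simp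
      have h3 : orderOf c ∣ 2 := orderOf_dvd_of_pow_eq_one h2
      have h4 : orderOf c ∣ Nat.card C := orderOf_dvd_natCard c
      have h5 : orderOf c = 1 := Nat.eq_one_of_dvd_coprimes
        (Nat.coprime_two_left.mpr hodd) h3 h4
      exact (Finset.mem_erase.mp hc).1 (orderOf_eq_one_iff.mp h5)
    · intro c hc
      simpa using hc
    · intro c _; exact inv_inv c
  have hcomm : ∀ x y, ∀ w ∈ U, A x (A y w) = A y (A x w) := by
    intro x y w hw
    have hconj : A x (A y w) = A y⁻¹ (A x⁻¹ w) := by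
      rw [hmul, hmul]
      refine Fintype.sum_equiv (Equiv.inv C) _ _ fun c => ?_
      rw [← hinv _ w hw]
      simp [mul_assoc]
    rw [hconj, hinv y _ (show A x⁻¹ w ∈ U from heU _), hinv x w hw]
  obtain ⟨w, hw, hw0, hAw⟩ := exists_ne_zero_common_fixed U hV A (fun z w _ => heU _) hsq hcomm
    (show v ∈ U from hv) hv0 Finset.univ
  let D : AddSubgroup V := AddSubgroup.closure {x | ∃ g h : G, x = g • w - h • w}
  have hD : ∀ x ∈ D, e x = 0 := by
    intro x hx
    induction hx using AddSubgroup.closure_induction with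
    | mem x hx =>
      obtain ⟨g, h, rfl⟩ := hx
      rw [map_sub, ← hA, ← hA, hAw g (Finset.mem_univ _), hAw h (Finset.mem_univ _), sub_self]
    | zero => exact map_zero e
    | add x y _ _ hx hy => rw [map_add, hx, hy, add_zero]
    | neg x _ hx => rw [map_neg, hx, neg_zero]
  have hgw : ∀ g : G, g • w = w := by
    rcases hirr D fun k x hx => by
      induction hx using AddSubgroup.closure_induction with
      | mem x hx =>
        obtain ⟨g, h, rfl⟩ := hx
        refine AddSubgroup.subset_closure ⟨k * g, k * h, ?_⟩
        rw [smul_sub, mul_smul, mul_smul]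
      | zero => rw [smul_zero]; exact D.zero_mem
      | add x y _ _ hx hy => rw [smul_add]; exact D.add_mem hx hy
      | neg x _ hx => rw [smul_neg]; exact D.neg_mem hx
      with h | h
    · intro g
      have h1 : g • w - (1 : G) • w ∈ D := AddSubgroup.subset_closure ⟨g, 1, rfl⟩
      rw [h, AddSubgroup.mem_bot, one_smul, sub_eq_zero] at h1
      exact h1
    · exact absurd ((hfix w hw).symm.trans (hD w (h ▸ AddSubgroup.mem_top w))) hw0
  obtain ⟨g, u, hgu⟩ := hnt
  let E : AddSubgroup V :=
    { carrier := {w | ∀ g : G, g • w = w}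
      add_mem' := fun ha hb c => by rw [smul_add, ha c, hb c]
      zero_mem' := fun c => smul_zero c
      neg_mem' := fun ha c => by rw [smul_neg, ha c] }
  rcases hirr E fun k x hx g => by rw [hx k, hx g] with h | h
  · have : w ∈ E := hgw
    rw [h, AddSubgroup.mem_bot] at this
    exact hw0 this
  · have : u ∈ E := h ▸ AddSubgroup.mem_top u
    exact hgu (this g)

end SelfPairedDoubleCosets

section FieldWithEightElements

variable {F : Type*} [Field F] [CharP F 2]

lemma exists_cube_eq_add_one (h8 : ∀ x : F, x ^ 8 = x) (hx : ∃ x : F, x ≠ 0 ∧ x ≠ 1) :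
    ∃ τ : F, τ ^ 3 = τ + 1 := by
  have h2 : (2 : F) = 0 := CharTwo.two_eq_zero
  obtain ⟨x, hx0, hx1⟩ := hx
  have hx1' : x + 1 ≠ 0 := fun h => hx1 (by linear_combination h - h2)
  have h : x * ((x + 1) * ((x ^ 3 - (x + 1)) * ((x + 1) ^ 3 - ((x + 1) + 1)))) = 0 := by
    have := h8 x
    grind
  rcases mul_eq_zero.mp ((mul_eq_zero_iff_left hx1').mp ((mul_eq_zero_iff_left hx0).mp h)) with h | h
  · exact ⟨x, sub_eq_zero.mp h⟩
  · exact ⟨x + 1, sub_eq_zero.mp h⟩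

lemma eq_of_cube_eq_add_one (h8 : ∀ x : F, x ^ 8 = x) {τ : F} (hτ : τ ^ 3 = τ + 1) (x : F) :
    x = 0 ∨ x = 1 ∨ x = τ ∨ x = τ + 1 ∨ x = τ ^ 2 ∨ x = τ ^ 2 + 1 ∨ x = τ ^ 2 + τ ∨
      x = τ ^ 2 + τ + 1 := by
  have h2 : (2 : F) = 0 := CharTwo.two_eq_zero
  have := h8 x
  have h : (x - 0) * ((x - 1) * ((x - τ) * ((x - (τ + 1)) * ((x - τ ^ 2) * ((x - (τ ^ 2 + 1)) *
      ((x - (τ ^ 2 + τ)) * (x - (τ ^ 2 + τ + 1)))))))) = 0 := by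
    grind
  simpa only [mul_eq_zero, sub_eq_zero] using h

lemma norm_one_cases (h8 : ∀ x : F, x ^ 8 = x) {τ : F} (hτ : τ ^ 3 = τ + 1) {m n : F}
    (h : m ^ 2 + τ * m * n + n ^ 2 = 1) :
    (m = 1 ∧ n = 0) ∨ (m = 0 ∧ n = 1) ∨ (m = 1 ∧ n = τ) ∨ (m = τ ∧ n = 1 + τ ^ 2) ∨
    (m = 1 + τ ^ 2 ∧ n = τ + 1) ∨ (m = τ + 1 ∧ n = τ + 1) ∨ (m = τ + 1 ∧ n = 1 + τ ^ 2) ∨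
    (m = 1 + τ ^ 2 ∧ n = τ) ∨ (m = τ ∧ n = 1) := by
  have h2 : (2 : F) = 0 := CharTwo.two_eq_zero
  rcases eq_of_cube_eq_add_one h8 hτ m with rfl | rfl | rfl | rfl | rfl | rfl | rfl | rfl <;>
  rcases eq_of_cube_eq_add_one h8 hτ n with rfl | rfl | rfl | rfl | rfl | rfl | rfl | rfl <;>
  grind

end FieldWithEightElements

section SpecialLinearGroupTwo

variable {F : Type*} [Field F]

lemma sl2_ext {g h : SpecialLinearGroup (Fin 2) F} (h00 : g 0 0 = h 0 0) (h01 : g 0 1 = h 0 1)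
    (h10 : g 1 0 = h 1 0) (h11 : g 1 1 = h 1 1) : g = h := by
  ext i j
  fin_cases i <;> fin_cases j <;> assumption

lemma sl2_det (g : SpecialLinearGroup (Fin 2) F) : g 0 0 * g 1 1 - g 0 1 * g 1 0 = 1 := by
  have hd := g.det_coe
  rwa [Matrix.det_fin_two] at hd

lemma sl2_mul_apply (g h : SpecialLinearGroup (Fin 2) F) (i j : Fin 2) :
    (g * h) i j = g i 0 * h 0 j + g i 1 * h 1 j := by
  rw [Matrix.SpecialLinearGroup.coe_mul, Matrix.mul_apply, Fin.sum_univ_two]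

lemma sl2_one_apply : (1 : SpecialLinearGroup (Fin 2) F) 0 0 = 1 ∧
    (1 : SpecialLinearGroup (Fin 2) F) 0 1 = 0 ∧ (1 : SpecialLinearGroup (Fin 2) F) 1 0 = 0 ∧
    (1 : SpecialLinearGroup (Fin 2) F) 1 1 = 1 := by
  simp

lemma sl2_inv_apply (g : SpecialLinearGroup (Fin 2) F) :
    g⁻¹ 0 0 = g 1 1 ∧ g⁻¹ 0 1 = -g 0 1 ∧ g⁻¹ 1 0 = -g 1 0 ∧ g⁻¹ 1 1 = g 0 0 := by
  rw [Matrix.SpecialLinearGroup.SL2_inv_expl]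
  exact ⟨rfl, rfl, rfl, rfl⟩

/-- The element of `SL₂(F)` with rows `(a, b)` and `(c, d)`. -/
def sl2OfEntries (a b c d : F) (h : a * d - b * c = 1) : SpecialLinearGroup (Fin 2) F :=
  ⟨!![a, b; c, d], by rw [Matrix.det_fin_two_of, h]⟩

lemma sl2OfEntries_apply (a b c d : F) (h : a * d - b * c = 1) :
    sl2OfEntries a b c d h 0 0 = a ∧ sl2OfEntries a b c d h 0 1 = b ∧
      sl2OfEntries a b c d h 1 0 = c ∧ sl2OfEntries a b c d h 1 1 = d :=
  ⟨rfl, rfl, rfl, rfl⟩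

/-- The subgroup of upper unitriangular matrices of `SL₂(F)`. -/
def unipotentSubgroup (F : Type*) [Field F] : Subgroup (SpecialLinearGroup (Fin 2) F) where
  carrier := {g | g 0 0 = 1 ∧ g 1 0 = 0}
  one_mem' := by simp
  mul_mem' := by
    rintro a b ⟨ha, ha'⟩ ⟨hb, hb'⟩
    simp only [Set.mem_ofPred_eq, sl2_mul_apply, *]
    simp
  inv_mem' := by
    rintro a ⟨ha, ha'⟩
    have := sl2_det a
    simp only [Set.mem_ofPred_eq, sl2_inv_apply, *] at this ⊢
    simpa using this

lemma mem_unipotentSubgroup {g : SpecialLinearGroup (Fin 2) F} :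
    g ∈ unipotentSubgroup F ↔ g 0 0 = 1 ∧ g 1 0 = 0 := Iff.rfl

/-- The upper unitriangular matrix with off-diagonal entry `b`. -/
def upperUnipotent (b : F) : SpecialLinearGroup (Fin 2) F :=
  sl2OfEntries 1 b 0 1 (by simp)

lemma upperUnipotent_apply (b : F) : upperUnipotent b 0 0 = 1 ∧ upperUnipotent b 0 1 = b ∧
    upperUnipotent b 1 0 = 0 ∧ upperUnipotent b 1 1 = 1 := sl2OfEntries_apply _ _ _ _ _

/-- The lower unitriangular matrix with off-diagonal entry `b`. -/
def lowerUnipotent (b : F) : SpecialLinearGroup (Fin 2) F :=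
  sl2OfEntries 1 0 b 1 (by simp)

lemma lowerUnipotent_apply (b : F) : lowerUnipotent b 0 0 = 1 ∧ lowerUnipotent b 0 1 = 0 ∧
    lowerUnipotent b 1 0 = b ∧ lowerUnipotent b 1 1 = 1 := sl2OfEntries_apply _ _ _ _ _

/-- The diagonal matrix with entries `a` and `a⁻¹`. -/
def diagonalTorus (a : Fˣ) : SpecialLinearGroup (Fin 2) F :=
  sl2OfEntries a 0 0 (a⁻¹ : Fˣ) (by simp)

lemma diagonalTorus_apply (a : Fˣ) : diagonalTorus a 0 0 = a ∧ diagonalTorus a 0 1 = 0 ∧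
    diagonalTorus a 1 0 = 0 ∧ diagonalTorus a 1 1 = (a⁻¹ : Fˣ) := sl2OfEntries_apply _ _ _ _ _

lemma upperUnipotent_mem (b : F) : upperUnipotent b ∈ unipotentSubgroup F :=
  ⟨rfl, rfl⟩

lemma eq_upperUnipotent_of_mem {g : SpecialLinearGroup (Fin 2) F}
    (hg : g ∈ unipotentSubgroup F) : g = upperUnipotent (g 0 1) := by
  obtain ⟨h0, h1⟩ := hg
  have hd := sl2_det g
  rw [h0, h1] at hd
  apply sl2_ext <;> simp only [upperUnipotent_apply, h0, h1]
  simpa using hd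

lemma index_unipotentSubgroup [Finite F] :
    (unipotentSubgroup F).index = Nat.card F ^ 2 - 1 := by
  classical
  have := Fintype.ofFinite F
  let f : SpecialLinearGroup (Fin 2) F → {v : F × F // v ≠ 0} := fun g => ⟨(g 0 0, g 1 0), by
    intro h
    obtain ⟨h0, h1⟩ := Prod.mk_eq_zero.mp h
    have := sl2_det g
    rw [h0, h1] at this
    simp at this⟩
  have hf : ∀ a b, f a = f b ↔ a⁻¹ * b ∈ unipotentSubgroup F := by
    intro a b
    have hda := sl2_det a
    have hdb := sl2_det b
    simp only [f, Subtype.mk.injEq, Prod.mk.injEq, mem_unipotentSubgroup, sl2_mul_apply,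
      sl2_inv_apply]
    grind
  let e : (SpecialLinearGroup (Fin 2) F ⧸ unipotentSubgroup F) → {v : F × F // v ≠ 0} :=
    Quotient.lift f fun a b h => (hf a b).mpr (QuotientGroup.leftRel_apply.mp h)
  have he : Function.Bijective e := by
    constructor
    · intro x y
      induction x using QuotientGroup.induction_on
      induction y using QuotientGroup.induction_on
      exact fun h => QuotientGroup.eq.mpr ((hf _ _).mp h)
    · rintro ⟨⟨x, y⟩, hv⟩
      by_cases hx : x = 0
      · have hy : y ≠ 0 := fun h => hv (by simp [hx, h])
        refine ⟨QuotientGroup.mk (sl2OfEntries 0 (-y⁻¹) y 0 (by simp [hy])), ?_⟩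
        exact Subtype.ext (Prod.ext hx.symm rfl)
      · exact ⟨QuotientGroup.mk (sl2OfEntries x 0 y x⁻¹ (by simp [hx])), rfl⟩
  rw [Subgroup.index, Nat.card_congr (Equiv.ofBijective e he), Nat.card_eq_fintype_card,
    Fintype.card_subtype_compl, Fintype.card_prod, Fintype.card_subtype_eq,
    Nat.card_eq_fintype_card, pow_two]

lemma eq_top_of_unipotentSubgroup_le (H : Subgroup (SpecialLinearGroup (Fin 2) F))
    (hH : unipotentSubgroup F ≤ H) {g : SpecialLinearGroup (Fin 2) F} (hg : g ∈ H)
    (hg0 : g 1 0 ≠ 0) : H = ⊤ := by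
  have hu : ∀ b, upperUnipotent b ∈ H := fun b => hH (upperUnipotent_mem b)
  have hdecomp : ∀ k : SpecialLinearGroup (Fin 2) F, k 1 0 ≠ 0 →
      upperUnipotent ((k 0 0 - 1) / k 1 0) * lowerUnipotent (k 1 0) *
        upperUnipotent ((k 1 1 - 1) / k 1 0) = k := by
    intro k hk
    have hd := sl2_det k
    apply sl2_ext <;>
      simp only [sl2_mul_apply, upperUnipotent_apply, lowerUnipotent_apply] <;>
      field_simp <;> grind
  have hl0 : lowerUnipotent (g 1 0) ∈ H := by
    rwa [← hdecomp g hg0, H.mul_mem_cancel_right (hu _), H.mul_mem_cancel_left (hu _)] at hg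
  set c := g 1 0
  have hw : upperUnipotent (-c⁻¹) * lowerUnipotent c * upperUnipotent (-c⁻¹) ∈ H :=
    H.mul_mem (H.mul_mem (hu _) hl0) (hu _)
  have hl : ∀ b, lowerUnipotent b ∈ H := by
    intro b
    have : lowerUnipotent b * (upperUnipotent (-c⁻¹) * lowerUnipotent c *
        upperUnipotent (-c⁻¹)) = (upperUnipotent (-c⁻¹) * lowerUnipotent c *
        upperUnipotent (-c⁻¹)) * upperUnipotent (-(b / c ^ 2)) := by
      apply sl2_ext <;>
        simp only [sl2_mul_apply, upperUnipotent_apply, lowerUnipotent_apply] <;>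
        field_simp <;> ring
    rw [← H.mul_mem_cancel_right hw, this]
    exact H.mul_mem hw (hu _)
  have hne : ∀ k : SpecialLinearGroup (Fin 2) F, k 1 0 ≠ 0 → k ∈ H := by
    intro k hk
    rw [← hdecomp k hk]
    exact H.mul_mem (H.mul_mem (hu _) (hl _)) (hu _)
  rw [eq_top_iff]
  intro k _
  by_cases hk : k 1 0 = 0
  · have hd := sl2_det k
    rw [hk] at hd
    have h1 : lowerUnipotent (1 : F) * k ∈ H := by
      apply hne
      simp only [sl2_mul_apply, lowerUnipotent_apply, hk]
      grind
    exact (H.mul_mem_cancel_left (hl 1)).mp h1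
  · exact hne k hk

variable [CharP F 2]

lemma sq_eq_one_of_mem_unipotentSubgroup {g : SpecialLinearGroup (Fin 2) F}
    (hg : g ∈ unipotentSubgroup F) : g ^ 2 = 1 := by
  have h2 : ∀ x : F, x + x = 0 := CharTwo.add_self_eq_zero
  rw [eq_upperUnipotent_of_mem hg, pow_two]
  apply sl2_ext <;> simp only [sl2_mul_apply, upperUnipotent_apply, sl2_one_apply] <;> grind

lemma center_eq_bot_of_charTwo : Subgroup.center (SpecialLinearGroup (Fin 2) F) = ⊥ := by
  rw [eq_bot_iff]
  intro g hg
  rw [Subgroup.mem_center_iff] at hg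
  have h1 := hg (upperUnipotent 1)
  have h2 := hg (lowerUnipotent 1)
  have hd := sl2_det g
  have h3 := congrArg (fun k : SpecialLinearGroup (Fin 2) F => k 0 0) h1
  have h4 := congrArg (fun k : SpecialLinearGroup (Fin 2) F => k 0 1) h1
  have h5 := congrArg (fun k : SpecialLinearGroup (Fin 2) F => k 0 0) h2
  simp only [sl2_mul_apply, upperUnipotent_apply, lowerUnipotent_apply] at h3 h4 h5
  have hc : (2 : F) = 0 := CharTwo.two_eq_zero
  have h6 : (g 0 0 - 1) ^ 2 = 0 := by grind
  have h7 : g 0 0 = 1 := sub_eq_zero.mp (pow_eq_zero_iff two_ne_zero |>.mp h6)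
  rw [Subgroup.mem_bot]
  apply sl2_ext <;> simp only [sl2_one_apply] <;> grind

/-- A generator of a nonsplit torus of `SL₂(F)`, with trace `τ`. -/
def nonsplitGenerator (τ : F) : SpecialLinearGroup (Fin 2) F :=
  sl2OfEntries 0 1 1 τ (by simp [CharTwo.neg_eq])

lemma nonsplitGenerator_apply (τ : F) : nonsplitGenerator τ 0 0 = 0 ∧
    nonsplitGenerator τ 0 1 = 1 ∧ nonsplitGenerator τ 1 0 = 1 ∧ nonsplitGenerator τ 1 1 = τ :=
  sl2OfEntries_apply _ _ _ _ _

/-- The involution interchanging the standard basis vectors. -/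
def swapInvolution (F : Type*) [Field F] [CharP F 2] : SpecialLinearGroup (Fin 2) F :=
  sl2OfEntries 0 1 1 0 (by simp [CharTwo.neg_eq])

lemma swapInvolution_apply : swapInvolution F 0 0 = 0 ∧
    swapInvolution F 0 1 = 1 ∧ swapInvolution F 1 0 = 1 ∧ swapInvolution F 1 1 = 0 :=
  sl2OfEntries_apply _ _ _ _ _

lemma swapInvolution_sq : swapInvolution F ^ 2 = 1 := by
  rw [pow_two]
  apply sl2_ext <;> simp only [sl2_mul_apply, swapInvolution_apply, sl2_one_apply] <;> ring

lemma swapInvolution_conj (τ : F) : swapInvolution F * nonsplitGenerator τ * (swapInvolution F)⁻¹ =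
    (nonsplitGenerator τ)⁻¹ := by
  rw [mul_inv_eq_iff_eq_mul]
  apply sl2_ext <;> simp only [sl2_mul_apply, swapInvolution_apply, nonsplitGenerator_apply,
    sl2_inv_apply, CharTwo.neg_eq] <;> ring

lemma exists_conj_swapInvolution {a : F} (ha : a ≠ 0) :
    ∃ g, g * swapInvolution F * g⁻¹ = upperUnipotent (a ^ 2) := by
  have h2 : (2 : F) = 0 := CharTwo.two_eq_zero
  refine ⟨sl2OfEntries 0 a a⁻¹ a⁻¹ (by simp [CharTwo.neg_eq, ha]), ?_⟩
  rw [mul_inv_eq_iff_eq_mul]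
  apply sl2_ext <;> simp only [sl2_mul_apply, swapInvolution_apply, sl2OfEntries_apply,
    upperUnipotent_apply] <;> grind

lemma exists_nonsplitGenerator_pow {τ : F} (h8 : ∀ x : F, x ^ 8 = x) (hτ : τ ^ 3 = τ + 1)
    {g : SpecialLinearGroup (Fin 2) F} (h01 : g 0 1 = g 1 0)
    (h11 : g 1 1 = g 0 0 + τ * g 1 0) : g ∈ Subgroup.zpowers (nonsplitGenerator τ) := by
  have h2 : (2 : F) = 0 := CharTwo.two_eq_zero
  set c := nonsplitGenerator τ with hc
  have hstep : ∀ (k : ℕ) (m n : F), (c ^ k) 0 0 = m → (c ^ k) 1 0 = n →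
      (c ^ (k + 1)) 0 0 = n ∧ (c ^ (k + 1)) 1 0 = m + τ * n := by
    rintro k m n rfl rfl
    rw [pow_succ']
    simp only [sl2_mul_apply, hc, nonsplitGenerator_apply]
    constructor <;> ring
  have hcomm : ∀ k : ℕ, (c ^ k) 0 1 = (c ^ k) 1 0 ∧
      (c ^ k) 1 1 = (c ^ k) 0 0 + τ * (c ^ k) 1 0 := by
    intro k
    induction k with
    | zero => simp
    | succ k ih =>
      rw [pow_succ]
      simp only [sl2_mul_apply, hc, nonsplitGenerator_apply] at ih ⊢
      grind
  have hfin : ∀ k : ℕ, (c ^ k) 0 0 = g 0 0 → (c ^ k) 1 0 = g 1 0 →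
      g ∈ Subgroup.zpowers c := by
    intro k h0 h1
    have : c ^ k = g := by
      apply sl2_ext h0 _ h1
      · rw [(hcomm k).2, h11, h0, h1]
      · rw [(hcomm k).1, h01, h1]
    rw [← this]
    exact Subgroup.npow_mem_zpowers _ _
  have p0 : (c ^ 0) 0 0 = 1 ∧ (c ^ 0) 1 0 = 0 := by simp
  have p1 := hstep 0 _ _ p0.1 p0.2
  have p2 := hstep 1 _ _ p1.1 p1.2
  have p3 := hstep 2 _ _ p2.1 p2.2
  have p4 := hstep 3 _ _ p3.1 p3.2
  have p5 := hstep 4 _ _ p4.1 p4.2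
  have p6 := hstep 5 _ _ p5.1 p5.2
  have p7 := hstep 6 _ _ p6.1 p6.2
  have p8 := hstep 7 _ _ p7.1 p7.2
  norm_num only at p0 p1 p2 p3 p4 p5 p6 p7 p8
  have hd := sl2_det g
  have hn : g 0 0 ^ 2 + τ * g 0 0 * g 1 0 + g 1 0 ^ 2 = 1 := by grind
  rcases norm_one_cases h8 hτ hn with h | h | h | h | h | h | h | h | h
  · exact hfin 0 (by grind) (by grind)
  · exact hfin 1 (by grind) (by grind)
  · exact hfin 2 (by grind) (by grind)
  · exact hfin 3 (by grind) (by grind)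
  · exact hfin 4 (by grind) (by grind)
  · exact hfin 5 (by grind) (by grind)
  · exact hfin 6 (by grind) (by grind)
  · exact hfin 7 (by grind) (by grind)
  · exact hfin 8 (by grind) (by grind)

lemma nonsplitGenerator_pow_nine {τ : F} (hτ : τ ^ 3 = τ + 1) :
    nonsplitGenerator τ ^ 9 = 1 := by
  have h2 : (2 : F) = 0 := CharTwo.two_eq_zero
  set c := nonsplitGenerator τ with hc
  obtain ⟨a, ha⟩ : ∃ a, a = c * c * c := ⟨_, rfl⟩
  have ha0 : a 0 0 = τ ∧ a 0 1 = 1 + τ ^ 2 ∧ a 1 0 = 1 + τ ^ 2 ∧ a 1 1 = τ + 1 := by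
    simp only [ha, hc, sl2_mul_apply, nonsplitGenerator_apply]
    grind
  rw [show c ^ 9 = a * a * a by rw [ha, ← pow_three', ← pow_three', ← pow_mul]]
  apply sl2_ext <;> simp only [sl2_mul_apply, sl2_one_apply, ha0] <;> grind

lemma odd_card_zpowers_nonsplitGenerator {τ : F} (hτ : τ ^ 3 = τ + 1) :
    Odd (Nat.card (Subgroup.zpowers (nonsplitGenerator τ))) := by
  rw [Nat.card_zpowers]
  exact Odd.of_dvd_nat (by decide) (orderOf_dvd_of_pow_eq_one (nonsplitGenerator_pow_nine hτ))

lemma exists_inv_eq_mul_mul_of_zpowers {τ : F} (h8 : ∀ x : F, x ^ 8 = x) (hτ : τ ^ 3 = τ + 1)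
    (z : SpecialLinearGroup (Fin 2) F) :
    ∃ d ∈ Subgroup.zpowers (nonsplitGenerator τ), z⁻¹ = d * z * d := by
  have h2 : (2 : F) = 0 := CharTwo.two_eq_zero
  have hτ0 : τ ≠ 0 := by rintro rfl; simp at hτ
  obtain ⟨y, hy⟩ : ∃ y, z 1 1 = z 0 0 + τ * y := ⟨(z 1 1 - z 0 0) / τ, by field_simp; ring⟩
  obtain ⟨v, hv⟩ : ∃ v, z 1 0 = z 0 1 + τ * v := ⟨(z 1 0 - z 0 1) / τ, by field_simp; ring⟩
  obtain ⟨x, hx⟩ : ∃ x, z 0 0 = x + v := ⟨z 0 0 - v, by ring⟩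
  obtain ⟨w, hw⟩ : ∃ w, z 0 1 = y + w := ⟨z 0 1 - y, by ring⟩
  rw [hx] at hy
  rw [hw] at hv
  by_cases h0 : x ^ 2 + τ * x * y + y ^ 2 = 0
  · have hy0 : y = 0 := by
      by_contra hy0
      have h1 : (x / y) ^ 2 + τ * (x / y) + 1 = 0 := by field_simp; linear_combination h0
      rcases eq_of_cube_eq_add_one h8 hτ (x / y) with h | h | h | h | h | h | h | h <;>
        rw [h] at h1 <;> grind
    have hx0 : x = 0 := by simpa [hy0] using h0
    refine ⟨1, one_mem _, ?_⟩
    rw [one_mul, mul_one]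
    apply sl2_ext <;> simp only [sl2_inv_apply, CharTwo.neg_eq] <;> simp [*]
  · set n := x ^ 2 + τ * x * y + y ^ 2 with hn
    have hn7 : n ^ 7 = 1 := mul_right_cancel₀ h0 (by linear_combination h8 n)
    obtain ⟨N, hN⟩ : ∃ N, N ^ 2 * n = 1 := ⟨n ^ 3, by linear_combination hn7⟩
    clear_value n
    refine ⟨sl2OfEntries (N * (x + τ * y)) (N * y) (N * y) (N * x) ?_,
      exists_nonsplitGenerator_pow h8 hτ rfl ?_, ?_⟩
    · grind
    · simp only [sl2OfEntries_apply]
      grind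
    · apply sl2_ext <;> simp only [sl2_inv_apply, sl2_mul_apply, sl2OfEntries_apply, hx, hy, hv, hw]
        <;> grind

lemma conj_mem_unipotentSubgroup {g u : SpecialLinearGroup (Fin 2) F} (hg : g 1 0 = 0)
    (hu : u ∈ unipotentSubgroup F) : g * u * g⁻¹ ∈ unipotentSubgroup F := by
  obtain ⟨h0, h1⟩ := hu
  have hd := sl2_det g
  rw [mem_unipotentSubgroup]
  simp only [sl2_mul_apply, sl2_inv_apply, hg, h0, h1] at hd ⊢
  grind

lemma diagonalTorus_conj (a : Fˣ) (b : F) :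
    diagonalTorus a * upperUnipotent b * (diagonalTorus a)⁻¹ = upperUnipotent (a ^ 2 * b) := by
  have := a.mul_inv
  apply sl2_ext <;>
    simp only [sl2_mul_apply, sl2_inv_apply, diagonalTorus_apply, upperUnipotent_apply] <;> grind

/-- An upper triangular matrix over a field with eight elements which is not unitriangular
generates the Borel subgroup modulo its unipotent radical. -/
lemma exists_pow_mul_mem_unipotentSubgroup {τ : Fˣ} (h8 : ∀ x : F, x ^ 8 = x)
    (hτ : (τ : F) ^ 3 = τ + 1) {g : SpecialLinearGroup (Fin 2) F} (hg : g 1 0 = 0)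
    (hg1 : g ∉ unipotentSubgroup F) :
    ∃ j : ℕ, (g ^ j)⁻¹ * diagonalTorus τ ∈ unipotentSubgroup F := by
  have h2 : (2 : F) = 0 := CharTwo.two_eq_zero
  have hpow : ∀ j : ℕ, (g ^ j) 1 0 = 0 ∧ (g ^ j) 0 0 = (g 0 0) ^ j := by
    intro j
    induction j with
    | zero => simp
    | succ j ih =>
      rw [pow_succ, pow_succ, sl2_mul_apply, sl2_mul_apply, hg, ih.1, ih.2]
      simp
  have hne : g 0 0 ≠ 1 := fun h => hg1 ⟨h, hg⟩
  have hne0 : g 0 0 ≠ 0 := by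
    intro h
    have hd := sl2_det g
    simp [h, hg] at hd
  have hτ' : ∃ j : ℕ, (g 0 0) ^ j = τ := by
    generalize g 0 0 = p at *
    rcases eq_of_cube_eq_add_one h8 hτ p with h | h | h | h | h | h | h | h
    · exact absurd h hne0
    · exact absurd h hne
    · exact ⟨1, by grind⟩
    · exact ⟨5, by grind⟩
    · exact ⟨4, by grind⟩
    · exact ⟨6, by grind⟩
    · exact ⟨2, by grind⟩
    · exact ⟨3, by grind⟩
  obtain ⟨j, hj⟩ := hτ'
  refine ⟨j, ?_⟩
  have hd := sl2_det (g ^ j)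
  rw [mem_unipotentSubgroup]
  simp only [sl2_mul_apply, sl2_inv_apply, diagonalTorus_apply, hpow, hj] at hd ⊢
  grind

end SpecialLinearGroupTwo

section SignCharacters

open scoped commutatorElement

lemma mul_comm_of_forall_sq_eq_one {Q : Type*} [Group Q] (hQ : ∀ q : Q, q ^ 2 = 1) (a b : Q) :
    a * b = b * a := by
  have hinv : ∀ q : Q, q⁻¹ = q := fun q =>
    inv_eq_of_mul_eq_one_right (by rw [← pow_two, hQ])
  rw [← hinv (a * b), _root_.mul_inv_rev, hinv, hinv]

lemma exists_hom_intUnits_ne_one {Q : Type*} [Group Q] [Finite Q] (hQ : ∀ q : Q, q ^ 2 = 1)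
    {z : Q} (hz : z ≠ 1) : ∃ f : Q →* ℤˣ, f z ≠ 1 := by
  let _ : CommGroup Q := { mul_comm := mul_comm_of_forall_sq_eq_one hQ }
  have : HasEnoughRootsOfUnity ℤ 2 :=
    { prim := ⟨-1, IsPrimitiveRoot.neg_one 0 (by decide)⟩
      cyc := inferInstance }
  have : HasEnoughRootsOfUnity ℤ (Monoid.exponent Q) :=
    HasEnoughRootsOfUnity.of_dvd ℤ (Monoid.exponent_dvd_of_forall_pow_eq_one hQ)
  exact CommGroup.exists_apply_ne_one_of_hasEnoughRootsOfUnity Q ℤ hz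

/-- If a nilpotent group has a nontrivial normal subgroup `M` of exponent two such that every
coset of `M` contains an element of order at most two, then some sign character of the group is
nontrivial on `M`. -/
lemma exists_hom_intUnits_nontrivial_on {S : Type*} [Group S] [Finite S] [Group.IsNilpotent S]
    (M : Subgroup S) [M.Normal] (hM : M ≠ ⊥) (hsq : ∀ m ∈ M, m ^ 2 = 1)
    (hlift : ∀ s : S, ∃ m ∈ M, (m * s) ^ 2 = 1) :
    ∃ μ : S →* ℤˣ, ∃ m ∈ M, μ m ≠ 1 := by
  set N : Subgroup S := ⁅M, ⊤⁆ with hN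
  have hNM : ¬ M ≤ N := by
    intro h
    have hlcs : ∀ n, M ≤ (⊤ : Subgroup S).lowerCentralSeries n := by
      intro n
      induction n with
      | zero => exact le_top
      | succ n ih => exact h.trans (Subgroup.commutator_mono ih le_rfl)
    obtain ⟨n, hn⟩ := Subgroup.nilpotent_iff_lowerCentralSeries.mp ‹Group.IsNilpotent S›
    exact hM (eq_bot_iff.mpr (hn ▸ hlcs n))
  obtain ⟨m, hm, hmN⟩ := Set.not_subset.mp hNM
  have hsqN : ∀ s : S, s ^ 2 ∈ N := by
    intro s
    obtain ⟨n, hn, hns⟩ := hlift s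
    have h1 := hsq n hn
    have h2 : s ^ 2 = ⁅n, n * s⁆ := by
      rw [pow_two] at h1 hns
      rw [commutatorElement_def, inv_eq_of_mul_eq_one_right h1, inv_eq_of_mul_eq_one_right hns,
        pow_two]
      simp only [mul_assoc]
      simp only [← mul_assoc n n, h1, one_mul]
    rw [h2]
    exact Subgroup.commutator_mem_commutator hn (Subgroup.mem_top _)
  obtain ⟨f, hf⟩ := exists_hom_intUnits_ne_one (Q := S ⧸ N) (z := (m : S ⧸ N))
    (fun q => by
      induction q using QuotientGroup.induction_on with
      | H s => exact (QuotientGroup.eq_one_iff _).mpr (hsqN s))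
    (fun h => hmN ((QuotientGroup.eq_one_iff _).mp h))
  exact ⟨f.comp (QuotientGroup.mk' N), m, hm, hf⟩

end SignCharacters

section ExtensionByMinimalNormal

variable {K H : Type*} [Group K] [Group H] {φ : K →* H}

/-- If `t` is an involution inverting `c`, and lifts of `c` act without fixed points on an abelian
kernel, then `t` lifts to an element of order at most two. -/
lemma exists_lift_sq_eq_one (hφ : Function.Surjective φ) [Finite φ.ker]
    (hcomm : ∀ m ∈ φ.ker, ∀ n ∈ φ.ker, m * n = n * m) {t c : H} (ht : t ^ 2 = 1)
    (htc : t * c * t⁻¹ = c⁻¹)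
    (hfix : ∀ k, φ k = c → ∀ m ∈ φ.ker, k * m * k⁻¹ = m → m = 1) :
    ∃ x, φ x = t ∧ x ^ 2 = 1 := by
  obtain ⟨x, rfl⟩ := hφ t
  obtain ⟨k, rfl⟩ := hφ c
  have hd : x * k * x⁻¹ * k ∈ φ.ker := by
    rw [MonoidHom.mem_ker, map_mul, map_mul, map_mul, map_inv, htc, inv_mul_cancel]
  let f : φ.ker → φ.ker := fun n => ⟨n * k⁻¹ * (n : K)⁻¹ * k, by
    simp [MonoidHom.mem_ker, (MonoidHom.mem_ker).mp n.2]⟩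
  have hf : Function.Injective f := by
    intro n m hnm
    have h1 : (n : K) * k⁻¹ * (n : K)⁻¹ * k = m * k⁻¹ * (m : K)⁻¹ * k := congrArg Subtype.val hnm
    have h2 := hfix k rfl ((m : K)⁻¹ * n) (mul_mem (inv_mem m.2) n.2) (by
      have h3 : (n : K) * k⁻¹ * (n : K)⁻¹ = m * k⁻¹ * (m : K)⁻¹ := mul_right_cancel h1
      have h4 : (n : K) * k * (n : K)⁻¹ = m * k * (m : K)⁻¹ := by
        simpa [mul_assoc] using congrArg (·⁻¹) h3
      calc k * ((m : K)⁻¹ * n) * k⁻¹ = (m : K)⁻¹ * (m * k * (m : K)⁻¹) * n * k⁻¹ := by group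
        _ = (m : K)⁻¹ * n := by rw [← h4]; group)
    exact Subtype.ext (inv_mul_eq_one.mp h2).symm
  obtain ⟨n, hn⟩ := (Finite.injective_iff_surjective.mp hf) ⟨_, inv_mem hd⟩
  have hn' : (n : K) * k⁻¹ * (n : K)⁻¹ * k = (x * k * x⁻¹ * k)⁻¹ := congrArg Subtype.val hn
  have hφn : φ n = 1 := n.2
  have hinv : (n * x) * k * (n * x)⁻¹ = k⁻¹ := by
    rw [← mul_eq_one_iff_eq_inv]
    have h1 : (x * k * x⁻¹ * k) * ((n : K) * k⁻¹ * (n : K)⁻¹ * k) = 1 := by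
      rw [hn', mul_inv_cancel]
    have h2 := hcomm n n.2 _ hd
    calc (n * x) * k * (n * x)⁻¹ * k = (n * (x * k * x⁻¹ * k)) * k⁻¹ * (n : K)⁻¹ * k := by group
      _ = 1 := by rw [h2, ← h1]; group
  refine ⟨n * x, by rw [map_mul, hφn, one_mul], ?_⟩
  apply hfix k rfl
  · rw [MonoidHom.mem_ker, map_pow, map_mul, hφn, one_mul, ht]
  · have h1 : (n * x) * k⁻¹ * (n * x)⁻¹ = k := by
      simpa [mul_assoc] using congrArg (·⁻¹) hinv
    have h2 : (n * x) ^ 2 * k * ((n * x) ^ 2)⁻¹ = k := by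
      calc (n * x) ^ 2 * k * ((n * x) ^ 2)⁻¹ = (n * x) * ((n * x) * k * (n * x)⁻¹) * (n * x)⁻¹ := by
            rw [pow_two]; group
        _ = k := by rw [hinv, h1]
    rw [mul_inv_eq_iff_eq_mul] at h2 ⊢
    exact h2.symm

/-- A subgroup of odd order with inverse-closed double cosets has no nontrivial fixed points on
a minimal normal elementary abelian `2`-subgroup which is not central. -/
lemma eq_one_of_fixed_of_selfPaired_doubleCosets [Finite H] (hφ : Function.Surjective φ)
    (hmin : ∀ N : Subgroup K, N.Normal → N ≤ φ.ker → N = ⊥ ∨ N = φ.ker)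
    (hsq : ∀ m ∈ φ.ker, m ^ 2 = 1) (hnc : ¬ φ.ker ≤ Subgroup.center K)
    (C : Subgroup H) (hodd : Odd (Nat.card C))
    (hC : ∀ z : H, ∃ c ∈ C, ∃ d ∈ C, z⁻¹ = c * z * d)
    {m : K} (hm : m ∈ φ.ker) (hfix : ∀ k, φ k ∈ C → k * m * k⁻¹ = m) : m = 1 := by
  have hsq' : ∀ n : φ.ker, n ^ 2 = 1 := fun n => Subtype.ext (hsq n n.2)
  let _ : CommGroup φ.ker := { mul_comm := mul_comm_of_forall_sq_eq_one hsq' }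
  let ψ : H →* MulAut φ.ker := φ.liftOfSurjective hφ ⟨MulAut.conjNormal, by
    intro n hn
    rw [MonoidHom.mem_ker]
    ext v
    rw [MulAut.conjNormal_apply, MulAut.one_apply, mul_inv_eq_iff_eq_mul]
    exact congrArg Subtype.val (mul_comm_of_forall_sq_eq_one hsq' ⟨n, hn⟩ v)⟩
  have hψ : ∀ k (n : φ.ker), (ψ (φ k) n : K) = k * n * k⁻¹ := by
    intro k n
    have h : ψ (φ k) = MulAut.conjNormal k := φ.liftOfRightInverse_comp_apply _ _ _ k
    rw [h, MulAut.conjNormal_apply]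
  let _ : DistribMulAction H (Additive φ.ker) :=
    { smul := fun h v => Additive.ofMul (ψ h v.toMul)
      one_smul := fun v => by
        change Additive.ofMul (ψ 1 v.toMul) = v
        rw [map_one]; rfl
      mul_smul := fun g h v => by
        change Additive.ofMul (ψ (g * h) v.toMul) = Additive.ofMul (ψ g (ψ h v.toMul))
        rw [map_mul]; rfl
      smul_zero := fun g => by
        change Additive.ofMul (ψ g 1) = Additive.ofMul 1
        rw [map_one]
      smul_add := fun g v w => by
        change Additive.ofMul (ψ g (v.toMul * w.toMul)) = _
        rw [map_mul]; rfl }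
  have hsmul : ∀ k (n : φ.ker), (((φ k) • Additive.ofMul n).toMul : K) = k * n * k⁻¹ := hψ
  have key := fixed_eq_zero_of_selfPaired_doubleCosets (G := H) (V := Additive φ.ker)
    (fun v => by
      have := hsq v.toMul v.toMul.2
      rw [pow_two] at this
      exact Subtype.ext this)
    (fun W hW => by
      have hmem : ∀ v : φ.ker, (v : K) ∈ (AddSubgroup.toSubgroup' W).map φ.ker.subtype ↔
          Additive.ofMul v ∈ W := by
        intro v
        rw [Subgroup.mem_map]
        constructor
        · rintro ⟨w, hw, hwv⟩
          rwa [← Subtype.ext hwv]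
        · exact fun h => ⟨v, h, rfl⟩
      have hle : (AddSubgroup.toSubgroup' W).map φ.ker.subtype ≤ φ.ker := by
        rintro _ ⟨w, _, rfl⟩
        exact w.2
      have hnormal : ((AddSubgroup.toSubgroup' W).map φ.ker.subtype).Normal := by
        refine ⟨?_⟩
        rintro _ ⟨w, hw, rfl⟩ k
        have h1 : ((ψ (φ k) w : φ.ker) : K) ∈ _ := (hmem _).mpr (hW (φ k) _ hw)
        rwa [hψ] at h1
      rcases hmin _ hnormal hle with h | h
      · left
        rw [eq_bot_iff]
        intro v hv
        have h1 := (hmem v.toMul).mpr hv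
        rw [h, Subgroup.mem_bot] at h1
        exact Subtype.ext h1
      · right
        rw [eq_top_iff]
        intro v _
        refine (hmem v.toMul).mp ?_
        rw [h]
        exact v.toMul.2)
    (by
      by_contra! hcon
      refine hnc fun n hn => Subgroup.mem_center_iff.mpr fun k => ?_
      have h1 := hsmul k ⟨n, hn⟩
      rw [hcon] at h1
      exact (eq_mul_inv_iff_mul_eq.mp h1).symm)
    C hodd hC (Additive.ofMul ⟨m, hm⟩) (fun c hc => by
      obtain ⟨k, rfl⟩ := hφ c
      exact Subtype.ext ((hsmul k _).trans (hfix k hc)))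
  exact congrArg Subtype.val key

end ExtensionByMinimalNormal

section ExtensionOfSL2

variable {F : Type*} [Field F] [CharP F 2] {K : Type*} [Group K] [Finite K]
  {φ : K →* SpecialLinearGroup (Fin 2) F}

lemma isNilpotent_of_mem_iff_unipotentSubgroup (hsq : ∀ m ∈ φ.ker, m ^ 2 = 1)
    (S : Subgroup K) (hS : ∀ k, k ∈ S ↔ φ k ∈ unipotentSubgroup F) : Group.IsNilpotent S := by
  have : IsPGroup 2 S := by
    rintro ⟨s, hs⟩
    refine ⟨2, Subtype.ext ?_⟩
    have h1 : s ^ 2 ∈ φ.ker := by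
      rw [MonoidHom.mem_ker, map_pow]
      exact sq_eq_one_of_mem_unipotentSubgroup ((hS s).mp hs)
    change s ^ (2 ^ 2) = 1
    rw [pow_two 2, pow_mul]
    exact hsq _ h1
  exact this.isNilpotent

lemma exists_lift_of_mem_unipotentSubgroup [Finite F] (hφ : Function.Surjective φ)
    (hmin : ∀ N : Subgroup K, N.Normal → N ≤ φ.ker → N = ⊥ ∨ N = φ.ker)
    (hsq : ∀ m ∈ φ.ker, m ^ 2 = 1) (hnc : ¬ φ.ker ≤ Subgroup.center K)
    (h8 : ∀ x : F, x ^ 8 = x) {τ : F} (hτ : τ ^ 3 = τ + 1)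
    {p : SpecialLinearGroup (Fin 2) F} (hp : p ∈ unipotentSubgroup F) :
    ∃ x, φ x = p ∧ x ^ 2 = 1 := by
  have hcomm : ∀ m ∈ φ.ker, ∀ n ∈ φ.ker, m * n = n * m := fun m hm n hn =>
    congrArg Subtype.val (mul_comm_of_forall_sq_eq_one
      (fun q : φ.ker => Subtype.ext (hsq q q.2)) ⟨m, hm⟩ ⟨n, hn⟩)
  have hfix : ∀ k, φ k = nonsplitGenerator τ → ∀ m ∈ φ.ker, k * m * k⁻¹ = m → m = 1 := by
    intro k hk m hm hkm
    refine eq_one_of_fixed_of_selfPaired_doubleCosets hφ hmin hsq hnc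
      (Subgroup.zpowers (nonsplitGenerator τ)) (odd_card_zpowers_nonsplitGenerator hτ)
      (fun z => ?_) hm fun l hl => ?_
    · obtain ⟨d, hd, h⟩ := exists_inv_eq_mul_mul_of_zpowers h8 hτ z
      exact ⟨d, hd, d, hd, h⟩
    · obtain ⟨i, hi⟩ := Subgroup.mem_zpowers_iff.mp hl
      have hc : k ^ i * m = m * k ^ i :=
        (Commute.zpow_left (mul_inv_eq_iff_eq_mul.mp hkm : Commute k m) i).eq
      have hn : l * (k ^ i)⁻¹ ∈ φ.ker := by
        rw [MonoidHom.mem_ker, map_mul, map_inv, map_zpow, hk, hi, mul_inv_cancel]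
      rw [mul_inv_eq_iff_eq_mul]
      calc l * m = l * (k ^ i)⁻¹ * (k ^ i * m) := by group
        _ = (l * (k ^ i)⁻¹ * m) * k ^ i := by rw [hc]; group
        _ = m * l := by rw [hcomm _ hn m hm]; group
  obtain ⟨x, hx, hx2⟩ := exists_lift_sq_eq_one hφ hcomm (swapInvolution_sq (F := F))
    (swapInvolution_conj τ) hfix
  rw [eq_upperUnipotent_of_mem hp]
  generalize p 0 1 = b
  by_cases hb : b = 0
  · refine ⟨1, ?_, one_pow 2⟩
    rw [map_one, hb]
    apply sl2_ext <;> simp only [sl2_one_apply, upperUnipotent_apply]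
  · obtain ⟨g, hg⟩ := exists_conj_swapInvolution (a := b ^ 4) (pow_ne_zero 4 hb)
    rw [← pow_mul, h8] at hg
    obtain ⟨k, rfl⟩ := hφ g
    refine ⟨k * x * k⁻¹, ?_, ?_⟩
    · rw [map_mul, map_mul, map_inv, hx, hg]
    · rw [conj_pow, hx2, mul_one, mul_inv_cancel]

/-- There is a sign character of the Sylow `2`-subgroup which is nontrivial on the minimal normal
subgroup and not invariant under a given lift of a diagonal matrix. -/
lemma exists_signCharacter_not_invariant [Finite F] (hφ : Function.Surjective φ)
    (hbot : φ.ker ≠ ⊥)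
    (hmin : ∀ N : Subgroup K, N.Normal → N ≤ φ.ker → N = ⊥ ∨ N = φ.ker)
    (hsq : ∀ m ∈ φ.ker, m ^ 2 = 1) (hnc : ¬ φ.ker ≤ Subgroup.center K)
    (h8 : ∀ x : F, x ^ 8 = x) {τ : Fˣ} (hτ : (τ : F) ^ 3 = τ + 1)
    {a : K} (ha : φ a = diagonalTorus τ)
    (S : Subgroup K) (hS : ∀ k, k ∈ S ↔ φ k ∈ unipotentSubgroup F) :
    ∃ μ : S →* ℤˣ, (∃ m : S, φ m = 1 ∧ μ m ≠ 1) ∧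
      ∃ s s' : S, (s' : K) = a * s * a⁻¹ ∧ μ s' ≠ μ s := by
  have h2 : (2 : F) = 0 := CharTwo.two_eq_zero
  have hker : φ.ker ≤ S := fun k hk => (hS k).mpr (by
    rw [MonoidHom.mem_ker.mp hk]
    exact one_mem _)
  have := isNilpotent_of_mem_iff_unipotentSubgroup hsq S hS
  obtain ⟨μ, m, hm, hμm⟩ := exists_hom_intUnits_nontrivial_on (φ.ker.subgroupOf S)
    (fun h => hbot (eq_bot_iff.mpr fun m hm => by
      have h1 : (⟨m, hker hm⟩ : S) ∈ φ.ker.subgroupOf S := hm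
      rw [h, Subgroup.mem_bot] at h1
      exact congrArg Subtype.val h1))
    (fun m hm => Subtype.ext (hsq m hm))
    (fun s => by
      obtain ⟨x, hx, hx2⟩ := exists_lift_of_mem_unipotentSubgroup hφ hmin hsq hnc h8 hτ
        ((hS s).mp s.2)
      have hxs : x * (s : K)⁻¹ ∈ φ.ker := by
        rw [MonoidHom.mem_ker, map_mul, map_inv, hx, mul_inv_cancel]
      refine ⟨⟨x * (s : K)⁻¹, hker hxs⟩, hxs, Subtype.ext ?_⟩
      change (x * (s : K)⁻¹ * s) ^ 2 = 1
      rw [inv_mul_cancel_right, hx2])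
  have hm : φ m = 1 := hm
  by_cases h : ∃ s s' : S, (s' : K) = a * s * a⁻¹ ∧ μ s' ≠ μ s
  · exact ⟨μ, ⟨m, hm, hμm⟩, h⟩
  push Not at h
  have hτ1 : (τ : F) ^ 2 + 1 ≠ 0 := by
    intro h0
    have := τ.ne_zero
    grind
  obtain ⟨ν, hν⟩ := exists_hom_intUnits_ne_one (Q := unipotentSubgroup F)
    (z := ⟨upperUnipotent ((τ : F) ^ 2 + 1), upperUnipotent_mem _⟩)
    (fun q => Subtype.ext (sq_eq_one_of_mem_unipotentSubgroup q.2))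
    (fun h0 => hτ1 (by
      have h1 := congrArg (fun u : unipotentSubgroup F => u.1 0 1) h0
      simpa only [upperUnipotent_apply, OneMemClass.coe_one, sl2_one_apply] using h1))
  let π : S →* unipotentSubgroup F :=
    (φ.comp S.subtype).codRestrict _ fun s => (hS s).mp s.2
  have hνm : ν (π m) = 1 := by
    rw [show π m = 1 from Subtype.ext hm, map_one]
  refine ⟨μ * ν.comp π, ⟨m, hm, ?_⟩, ?_⟩
  · rwa [MonoidHom.mul_apply, MonoidHom.comp_apply, hνm, mul_one]
  · obtain ⟨s, hs⟩ := hφ (upperUnipotent 1)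
    have hs' : φ (a * s * a⁻¹) = upperUnipotent ((τ : F) ^ 2) := by
      rw [map_mul, map_mul, map_inv, ha, hs, diagonalTorus_conj, mul_one]
    have hsS : s ∈ S := by
      rw [hS, hs]
      exact upperUnipotent_mem _
    have hsS' : a * s * a⁻¹ ∈ S := by
      rw [hS, hs']
      exact upperUnipotent_mem _
    refine ⟨⟨s, hsS⟩, ⟨_, hsS'⟩, rfl, fun heq => hν ?_⟩
    rw [MonoidHom.mul_apply, MonoidHom.mul_apply, h ⟨s, hsS⟩ ⟨_, hsS'⟩ rfl, mul_right_inj,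
      MonoidHom.comp_apply, MonoidHom.comp_apply] at heq
    have hmul : π ⟨a * s * a⁻¹, hsS'⟩ =
        ⟨upperUnipotent ((τ : F) ^ 2 + 1), upperUnipotent_mem _⟩ *
          π ⟨s, hsS⟩ := by
      apply Subtype.ext
      change φ (a * s * a⁻¹) = upperUnipotent ((τ : F) ^ 2 + 1) * φ s
      rw [hs', hs]
      apply sl2_ext <;> simp only [sl2_mul_apply, upperUnipotent_apply] <;> grind
    rw [hmul, map_mul] at heq
    exact mul_eq_right.mp heq

/-- Such a sign character satisfies Mackey's irreducibility condition. -/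
lemma exists_signCharacter_ne_conj [Finite F] (hφ : Function.Surjective φ) (hbot : φ.ker ≠ ⊥)
    (hmin : ∀ N : Subgroup K, N.Normal → N ≤ φ.ker → N = ⊥ ∨ N = φ.ker)
    (hsq : ∀ m ∈ φ.ker, m ^ 2 = 1) (hnc : ¬ φ.ker ≤ Subgroup.center K)
    (h8 : ∀ x : F, x ^ 8 = x) {τ : F} (hτ : τ ^ 3 = τ + 1)
    (S : Subgroup K) (hS : ∀ k, k ∈ S ↔ φ k ∈ unipotentSubgroup F) :
    ∃ μ : S →* ℤˣ, ∀ g ∉ S, ∃ s : S, ∃ h : g⁻¹ * s * g ∈ S, μ ⟨g⁻¹ * s * g, h⟩ ≠ μ s := by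
  lift τ to Fˣ using (isUnit_iff_ne_zero.mpr (by rintro rfl; simp at hτ))
  obtain ⟨a, ha⟩ := hφ (diagonalTorus τ)
  obtain ⟨μ, ⟨m, hm, hμm⟩, hμa⟩ :=
    exists_signCharacter_not_invariant hφ hbot hmin hsq hnc h8 hτ ha S hS
  refine ⟨μ, fun g hg => ?_⟩
  have hker : φ.ker ≤ S := fun k hk => (hS k).mpr (by
    rw [MonoidHom.mem_ker.mp hk]
    exact one_mem _)
  by_contra! hcon
  have hinvg : ∀ s s' : S, (s' : K) = g * s * g⁻¹ → μ s' = μ s := by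
    intro s s' hs
    have h1 : g⁻¹ * (s' : K) * g = s := by rw [hs]; group
    have h2 := hcon s' (h1 ▸ s.2)
    rw [← h2]
    congr 1
    exact Subtype.ext h1
  have hinvS : ∀ u ∈ S, ∀ s s' : S, (s' : K) = u * s * u⁻¹ → μ s' = μ s := by
    intro u hu s s' hs
    have h1 : s' = ⟨u, hu⟩ * s * ⟨u, hu⟩⁻¹ := Subtype.ext hs
    rw [h1, map_mul, map_mul, map_inv, mul_comm (μ ⟨u, hu⟩), mul_inv_cancel_right]
  by_cases hg0 : (φ g) 1 0 = 0
  · have hpow : ∀ j : ℕ, ∀ s s' : S, (s' : K) = g ^ j * s * (g ^ j)⁻¹ → μ s' = μ s := by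
      intro j
      induction j with
      | zero => exact fun s s' hs => congrArg μ (Subtype.ext (by simpa using hs))
      | succ j ih =>
        intro s s' hs
        have h1 : g * s * g⁻¹ ∈ S := by
          rw [hS, map_mul, map_mul, map_inv]
          exact conj_mem_unipotentSubgroup hg0 ((hS s).mp s.2)
        rw [ih ⟨_, h1⟩ s' (by rw [hs, pow_succ]; group), hinvg s ⟨_, h1⟩ rfl]
    obtain ⟨j, hj⟩ := exists_pow_mul_mem_unipotentSubgroup h8 hτ hg0 (mt (hS g).mpr hg)
    have hu : (g ^ j)⁻¹ * a ∈ S := by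
      rwa [hS, map_mul, map_inv, map_pow, ha]
    obtain ⟨s, s', hs, hne⟩ := hμa
    have h1 : ((g ^ j)⁻¹ * a) * s * ((g ^ j)⁻¹ * a)⁻¹ ∈ S :=
      mul_mem (mul_mem hu s.2) (inv_mem hu)
    exact hne (by
      rw [hpow j ⟨_, h1⟩ s' (by rw [hs]; group), hinvS _ hu s ⟨_, h1⟩ rfl])
  · let T : Subgroup K :=
      { carrier := {k | ∀ s s' : S, φ s = 1 → (s' : K) = k * s * k⁻¹ → μ s' = μ s}
        one_mem' := fun s s' _ hs => congrArg μ (Subtype.ext (by simpa using hs))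
        mul_mem' := by
          intro k l hk hl s s' hs1 hs
          have h1 : φ (l * s * l⁻¹) = 1 := by
            rw [map_mul, map_mul, hs1, mul_one, ← map_mul, mul_inv_cancel, map_one]
          rw [hk ⟨_, hker h1⟩ s' h1 (by rw [hs]; group), hl s ⟨_, hker h1⟩ hs1 rfl]
        inv_mem' := by
          intro k hk s s' hs1 hs
          have h1 : φ s' = 1 := by
            rw [hs, map_mul, map_mul, hs1, mul_one, ← map_mul, mul_inv_cancel, map_one]
          exact (hk s' s h1 (by rw [hs]; group)).symm }
    have hST : S ≤ T := fun u hu s s' _ hs => hinvS u hu s s' hs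
    have hgT : g ∈ T := fun s s' _ hs => hinvg s s' hs
    have hTtop : ∀ k, k ∈ T := by
      intro k
      have h1 : T.map φ = ⊤ := eq_top_of_unipotentSubgroup_le _ (by
        intro p hp
        obtain ⟨x, rfl⟩ := hφ p
        exact ⟨x, hST ((hS x).mpr hp), rfl⟩) (Subgroup.mem_map_of_mem φ hgT) hg0
      obtain ⟨t, ht, htk⟩ : φ k ∈ T.map φ := h1 ▸ Subgroup.mem_top _
      have h2 : t⁻¹ * k ∈ φ.ker := by
        rw [MonoidHom.mem_ker, map_mul, map_inv, htk, inv_mul_cancel]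
      exact (T.mul_mem_cancel_left (T.inv_mem ht)).mp (hST (hker h2))
    have hN : (μ.ker.map S.subtype ⊓ φ.ker).Normal := by
      refine ⟨?_⟩
      rintro _ ⟨⟨n, hn, rfl⟩, hn1⟩ k
      have h1 : k * n * k⁻¹ ∈ φ.ker := MonoidHom.normal_ker φ |>.conj_mem _ hn1 k
      exact ⟨⟨⟨_, hker h1⟩, (hTtop k n ⟨_, hker h1⟩ hn1 rfl).trans hn, rfl⟩, h1⟩
    rcases hmin _ hN inf_le_right with h | h
    · refine hnc fun n hn => Subgroup.mem_center_iff.mpr fun k => ?_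
      have h1 : k * n * k⁻¹ ∈ φ.ker := MonoidHom.normal_ker φ |>.conj_mem _ hn k
      have h2 : k * n * k⁻¹ * n⁻¹ ∈ φ.ker := mul_mem h1 (inv_mem hn)
      have h3 : k * n * k⁻¹ * n⁻¹ ∈ μ.ker.map S.subtype ⊓ φ.ker := by
        refine ⟨⟨⟨_, hker h1⟩ * ⟨n, hker hn⟩⁻¹, ?_, rfl⟩, h2⟩
        change μ _ = 1
        rw [map_mul, map_inv, hTtop k ⟨n, hker hn⟩ ⟨_, hker h1⟩ hn rfl, mul_inv_cancel]
      rw [h, Subgroup.mem_bot, mul_inv_eq_one, mul_inv_eq_iff_eq_mul] at h3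
      exact h3
    · have h1 : (m : K) ∈ μ.ker.map S.subtype ⊓ φ.ker := by rw [h]; exact hm
      obtain ⟨⟨n, hn, hnm⟩, _⟩ := h1
      exact hμm ((congrArg μ (Subtype.ext hnm)).symm.trans hn)

end ExtensionOfSL2

theorem perfect_extension_of_PSL2_8_has_real_char_degree_63
    (K : Type) [Group K] [Fintype K] (hperf : commutator K = ⊤)
    (M : Subgroup K) [hMn : M.Normal]
    (hmin : M ≠ ⊥ ∧ ∀ N : Subgroup K, N.Normal → N ≤ M → N = ⊥ ∨ N = M)
    (helem : ∀ m : ↥M, m ^ 2 = 1)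
    (hnc : ¬ M ≤ Subgroup.center K)
    (hquot : Nonempty ((K ⧸ M) ≃* PSL2_8)) :
    ∃ χ : K → ℂ, IsIrrChar K χ ∧ IsRealValued χ ∧ χ 1 = 63 := by
  have hcard : Nat.card GF8 = 8 := by rw [GaloisField.card 2 3 (by decide)]; norm_num
  have h8 : ∀ x : GF8, x ^ 8 = x := by
    have := Fintype.ofFinite GF8
    intro x
    rw [← hcard, Nat.card_eq_fintype_card, FiniteField.pow_card]
  obtain ⟨τ, hτ⟩ : ∃ τ : GF8, τ ^ 3 = τ + 1 := by
    refine exists_cube_eq_add_one h8 ?_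
    by_contra! h
    have hle : Nat.card GF8 ≤ 2 := by
      have := Fintype.ofFinite GF8
      classical
      rw [Nat.card_eq_fintype_card, ← Finset.card_univ]
      refine (Finset.card_le_card (t := {0, 1}) fun x _ => ?_).trans Finset.card_le_two
      by_cases hx : x = 0
      · simp [hx]
      · simp [h x hx]
    omega
  obtain ⟨e⟩ := hquot
  let e' : PSL2_8 ≃* SpecialLinearGroup (Fin 2) GF8 :=
    (QuotientGroup.quotientMulEquivOfEq center_eq_bot_of_charTwo).trans QuotientGroup.quotientBot
  obtain ⟨φ, hφ, rfl⟩ : ∃ φ : K →* SpecialLinearGroup (Fin 2) GF8,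
      Function.Surjective φ ∧ φ.ker = M := by
    refine ⟨(e.trans e').toMonoidHom.comp (QuotientGroup.mk' M),
      (e.trans e').surjective.comp (QuotientGroup.mk'_surjective M), ?_⟩
    ext k
    rw [MonoidHom.mem_ker, ← QuotientGroup.eq_one_iff]
    exact map_eq_one_iff (e.trans e') (e.trans e').injective
  obtain ⟨μ, hμ⟩ := exists_signCharacter_ne_conj hφ hmin.1 hmin.2
    (fun m hm => congrArg Subtype.val (helem ⟨m, hm⟩)) hnc h8 hτ
    ((unipotentSubgroup GF8).comap φ) fun _ => Iff.rfl
  have hindex : ((unipotentSubgroup GF8).comap φ).index = 63 := by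
    rw [Subgroup.index_comap_of_surjective _ hφ, index_unipotentSubgroup, hcard]
    norm_num
  refine ⟨(FDRep.of (monomialRep _ μ)).character, ⟨_, monomialRep_simple _ μ hμ, rfl⟩,
    monomialRep_character_im _ μ, ?_⟩
  have := Fintype.ofFinite (K ⧸ (unipotentSubgroup GF8).comap φ)
  rw [FDRep.char_one]
  change ((Module.finrank ℂ (K ⧸ (unipotentSubgroup GF8).comap φ → ℂ) : ℕ) : ℂ) = 63
  rw [Module.finrank_fintype_fun_eq_card, ← Nat.card_eq_fintype_card, ← Subgroup.index, hindex]
  norm_num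
end

section
/- Let G be a finite group, N ⊴ G, and suppose θ ∈ Irr(N) is real-valued of odd degree with determinantal order o(θ) = 1 and N perfect (so o(θ)=1 automatically). Then there exists a real-valued irreducible character χ of G lying over θ. -/
open CategoryTheory

open scoped ComplexOrder in
theorem Representation.character_inv_eq_conj {G V : Type*} [Group G] [Finite G] [AddCommGroup V]
    [Module ℂ V] [FiniteDimensional ℂ V] (ρ : Representation ℂ G V) (g : G) :
    ρ.character g⁻¹ = starRingEnd ℂ (ρ.character g) := by
  classical
  have := Fintype.ofFinite G
  let b := Module.finBasis ℂ V
  let M : G →* Matrix _ _ ℂ := (LinearMap.toMatrixAlgEquiv b).toAlgHom.toRingHom.toMonoidHom.comp ρ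
  have hM (h : G) : ρ.character h = (M h).trace := LinearMap.trace_eq_matrix_trace ℂ b (ρ h)
  let P := ∑ h, (M h).conjTranspose * M h
  have hinv (h : G) : M h * M h⁻¹ = 1 := by rw [← map_mul, mul_inv_cancel, map_one]
  have hinv' (h : G) : M h⁻¹ * M h = 1 := by rw [← map_mul, inv_mul_cancel, map_one]
  have hP : P.PosDef := by
    refine Matrix.posDef_sum Finset.univ_nonempty fun h _ ↦
      Matrix.PosDef.conjTranspose_mul_self _ ?_
    intro v w hvw
    simpa [Matrix.mulVec_mulVec, hinv'] using congrArg (M h⁻¹).mulVec hvw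
  have hPg : (M g).conjTranspose * P * M g = P := by
    simp only [P, Finset.mul_sum, Finset.sum_mul]
    refine Fintype.sum_equiv (Equiv.mulRight g) _ _ fun h ↦ ?_
    simp [Matrix.conjTranspose_mul, mul_assoc]
  have hPg' : (M g).conjTranspose * P = P * M g⁻¹ := by
    rw [← hPg, mul_assoc _ (M g), hinv, mul_one, hPg]
  rw [hM, hM, starRingEnd_apply, ← Matrix.trace_conjTranspose]
  obtain ⟨u, hu⟩ := hP.isUnit
  have h1 : (M g).conjTranspose = P * M g⁻¹ * (u⁻¹ : (Matrix _ _ ℂ)ˣ) := by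
    rw [← hPg', ← hu, mul_assoc, Units.mul_inv, mul_one]
  rw [h1, Matrix.trace_mul_comm, ← mul_assoc, ← hu, Units.inv_mul, one_mul]

theorem FDRep.isIrreducible_of_simple {G : Type} [Group G] (V : FDRep ℂ G) [Simple V] :
    Representation.IsIrreducible V.ρ := by
  have hne : (𝟙 V) ≠ 0 := id_nonzero V
  have hnt : Nontrivial V := by
    by_contra h
    rw [not_nontrivial_iff_subsingleton] at h
    apply hne
    ext x
    exact Subsingleton.elim _ _
  refine { exists_pair_ne := ⟨⊥, ⊤, fun h ↦ ?_⟩, eq_bot_or_eq_top := fun U ↦ ?_ }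
  · obtain ⟨v, hv⟩ := exists_ne (0 : V)
    have : v ∈ (⊤ : Subrepresentation V.ρ) := Submodule.mem_top (R := ℂ)
    rw [← h] at this
    exact hv ((Submodule.mem_bot ℂ).1 this)
  · let ι : FDRep.of U.toRepresentation ⟶ V :=
      ⟨FGModuleCat.ofHom U.toSubmodule.subtype, fun g ↦ by ext x; rfl⟩
    have hι : Mono ι := by
      refine ConcreteCategory.mono_of_injective ι fun x y hxy ↦ ?_
      exact Subtype.ext hxy
    by_cases h0 : ι = 0
    · left
      refine eq_bot_iff.2 fun x hx ↦ ?_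
      have : ι.hom (⟨x, hx⟩ : U.toSubmodule) = 0 := by rw [h0]; rfl
      exact (Submodule.mem_bot ℂ).2 this
    · right
      have := isIso_of_mono_of_nonzero h0
      refine eq_top_iff.2 fun x _ ↦ ?_
      have hx : ι.hom ((inv ι).hom x) = x := by
        have := congrArg (fun f : V ⟶ V ↦ f.hom x) (IsIso.inv_hom_id ι)
        exact this
      rw [← hx]
      exact ((inv ι).hom x : U.toSubmodule).2

theorem FDRep.simple_of_isIrreducible_s16 {G V : Type} [Group G] [Finite G] [AddCommGroup V]
    [Module ℂ V] [FiniteDimensional ℂ V] (ρ : Representation ℂ G V) [ρ.IsIrreducible] :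
    Simple (FDRep.of ρ) := by
  have := Fintype.ofFinite G
  have := invertibleOfNonzero (NeZero.ne (Nat.card G : ℂ))
  rw [FDRep.simple_iff_char_is_norm_one]
  have h := Representation.card_inv_mul_sum_char_mul_char_eq_finrank ρ ρ
  rw [Representation.IsIrreducible.finrank_intertwiningMap_self, Nat.cast_one,
    inv_mul_eq_one₀ (NeZero.ne _)] at h
  exact h.symm

namespace Representation

section Irreducible

variable {N V : Type*} [Group N] [AddCommGroup V] [Module ℂ V] [FiniteDimensional ℂ V]
  (ρ : Representation ℂ N V) [ρ.IsIrreducible]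

omit [FiniteDimensional ℂ V] in
include ρ in
theorem IsIrreducible.nontrivial : Nontrivial V := by
  by_contra h
  rw [not_nontrivial_iff_subsingleton] at h
  obtain ⟨U, U', hU⟩ := exists_pair_ne (Subrepresentation ρ)
  refine hU (SetLike.ext fun x ↦ ?_)
  rw [Subsingleton.elim x 0]
  exact iff_of_true (zero_mem U.toSubmodule) (zero_mem U'.toSubmodule)

/-- Schur's lemma for a linear map commuting with an irreducible representation. -/
theorem IsIrreducible.exists_eq_smul_one {A : Module.End ℂ V} (hA : ∀ n, A * ρ n = ρ n * A) :
    ∃ c : ℂ, A = c • 1 := by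
  obtain ⟨c, hc⟩ := (algebraMap_intertwiningMap_bijective_of_isAlgClosed (ρ := ρ)).2 ⟨A, hA⟩
  exact ⟨c, (congrArg IntertwiningMap.toLinearMap hc).symm⟩

/-- An irreducible complex representation with real character is self-dual. -/
theorem IsIrreducible.exists_equiv_dual [Finite N] (hreal : ∀ n, (ρ.character n).im = 0) :
    ∃ Φ : V ≃ₗ[ℂ] Module.Dual ℂ V, ∀ n v w, Φ (ρ n v) (ρ n w) = Φ v w := by
  have := Fintype.ofFinite N
  have := invertibleOfNonzero (NeZero.ne (Nat.card N : ℂ))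
  have h1 := card_inv_mul_sum_char_mul_char_eq_finrank ρ ρ
  have h2 := card_inv_mul_sum_char_mul_char_eq_finrank ρ ρ.dual
  have hdual : ρ.dual.character = ρ.character := by
    ext n
    rw [char_dual, character_inv_eq_conj, Complex.conj_eq_iff_im.2 (hreal n)]
  rw [hdual, h1, finrank_intertwiningMap_self, Nat.cast_inj] at h2
  have : Nontrivial (IntertwiningMap ρ ρ.dual) := by
    by_contra h
    rw [not_nontrivial_iff_subsingleton] at h
    rw [Module.finrank_eq_zero_of_subsingleton] at h2
    exact one_ne_zero h2
  obtain ⟨Φ, hΦ⟩ := exists_ne (0 : IntertwiningMap ρ ρ.dual)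
  have hinj := (injective_or_eq_zero Φ).resolve_right hΦ
  refine ⟨LinearEquiv.ofInjectiveOfFinrankEq Φ.toLinearMap hinj
    Subspace.dual_finrank_eq.symm, fun n v w ↦ ?_⟩
  change Φ (ρ n v) (ρ n w) = Φ v w
  rw [Φ.isIntertwining]
  change Φ v (ρ n⁻¹ (ρ n w)) = Φ v w
  simp

/-- An invariant bilinear form of an irreducible representation is unique up to a scalar. -/
theorem IsIrreducible.exists_smul_of_invariant (Φ : V ≃ₗ[ℂ] Module.Dual ℂ V)
    (hΦ : ∀ n v w, Φ (ρ n v) (ρ n w) = Φ v w) (Ψ : V →ₗ[ℂ] Module.Dual ℂ V)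
    (hΨ : ∀ n v w, Ψ (ρ n v) (ρ n w) = Ψ v w) : ∃ c : ℂ, ∀ v w, Ψ v w = c * Φ v w := by
  obtain ⟨c, hc⟩ := exists_eq_smul_one ρ (A := Φ.symm.toLinearMap ∘ₗ Ψ) <| by
    intro n
    ext v
    apply Φ.injective
    ext w
    have hw : w = ρ n (ρ n⁻¹ w) := by simp
    have hΨ' := hΨ n v (ρ n⁻¹ w)
    have hΦ' := hΦ n (Φ.symm (Ψ v)) (ρ n⁻¹ w)
    rw [← hw] at hΨ' hΦ'
    simp [hΨ', hΦ']
  refine ⟨c, fun v w ↦ ?_⟩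
  have h : Φ.symm (Ψ v) = c • v := congrArg (fun A : Module.End ℂ V ↦ A v) hc
  rw [LinearEquiv.symm_apply_eq] at h
  simp [h]

/-- A nonzero map twisting an irreducible representation is invertible. -/
theorem IsIrreducible.isUnit_of_twist (σ : MulAut N) {B : Module.End ℂ V} (hB0 : B ≠ 0)
    (hB : ∀ n, B * ρ n = ρ (σ n) * B) : IsUnit B := by
  let U : Subrepresentation ρ := ⟨LinearMap.ker B, fun n v hv ↦ by
    have h : B (ρ n v) = ρ (σ n) (B v) := congrArg (fun A : Module.End ℂ V ↦ A v) (hB n)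
    rw [LinearMap.mem_ker] at hv ⊢
    rw [h, hv, map_zero]⟩
  have hU : U.toSubmodule = LinearMap.ker B := rfl
  rw [Module.End.isUnit_iff]
  have hinj : Function.Injective B := by
    rw [← LinearMap.ker_eq_bot, ← hU]
    rcases eq_bot_or_eq_top U with h | h
    · rw [h]; rfl
    · refine absurd (LinearMap.ker_eq_top.1 ?_) hB0
      rw [← hU, h]; rfl
  exact ⟨hinj, LinearMap.injective_iff_surjective.1 hinj⟩

end Irreducible

section Isometry

variable {G V : Type*} [Group G] {N : Subgroup G} [N.Normal] [AddCommGroup V] [Module ℂ V]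
  [FiniteDimensional ℂ V]

theorem det_eq_one_or_eq_neg_one_of_isometry (Φ : V ≃ₗ[ℂ] Module.Dual ℂ V) {A : Module.End ℂ V}
    (hA : ∀ v w, Φ (A v) (A w) = Φ v w) : LinearMap.det A = 1 ∨ LinearMap.det A = -1 := by
  have h : (Φ.symm.toLinearMap ∘ₗ A.dualMap ∘ₗ Φ.toLinearMap) ∘ₗ A = LinearMap.id := by
    ext v
    apply Φ.injective
    ext w
    simp [hA]
  have h' := LinearMap.det_conj A.dualMap Φ.symm
  rw [LinearEquiv.symm_symm] at h'
  have h2 := congrArg LinearMap.det h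
  rw [LinearMap.det_comp, h', LinearMap.det_dualMap, LinearMap.det_id] at h2
  exact mul_self_eq_one_iff.1 h2

/-- The pairs `(g, A)` such that `A` is an isometry of determinant one carrying `ρ` to its
conjugate by `g`. -/
def twistedIsometries (ρ : Representation ℂ N V) (Φ : V ≃ₗ[ℂ] Module.Dual ℂ V) :
    Subgroup (G × (Module.End ℂ V)ˣ) where
  carrier := {p | (∀ n, (p.2 : Module.End ℂ V) * ρ n = ρ (MulAut.conjNormal p.1 n) * p.2) ∧
    (∀ v w, Φ ((p.2 : Module.End ℂ V) v) ((p.2 : Module.End ℂ V) w) = Φ v w) ∧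
    LinearMap.det (p.2 : Module.End ℂ V) = 1}
  one_mem' := by simp
  mul_mem' := by
    rintro ⟨g, A⟩ ⟨h, B⟩ ⟨hA1, hA2, hA3⟩ ⟨hB1, hB2, hB3⟩
    refine ⟨fun n ↦ ?_, fun v w ↦ ?_, ?_⟩
    · simp only at *
      simp only [Prod.mk_mul_mk, Units.val_mul, map_mul, MulAut.mul_apply]
      rw [mul_assoc, hB1, ← mul_assoc, hA1, mul_assoc]
    · simp_all
    · simp_all
  inv_mem' := by
    rintro ⟨g, A⟩ ⟨hA1, hA2, hA3⟩
    refine ⟨fun n ↦ ?_, fun v w ↦ ?_, ?_⟩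
    · simp only at *
      simp only [Prod.inv_mk]
      rw [Units.inv_mul_eq_iff_eq_mul, ← mul_assoc, hA1, mul_assoc, Units.mul_inv, mul_one]
      simp
    · have h (x : V) : (A : Module.End ℂ V) ((↑A⁻¹ : Module.End ℂ V) x) = x := by
        rw [← Module.End.mul_apply, Units.mul_inv, Module.End.one_apply]
      simp only at *
      simp only [Prod.inv_mk]
      rw [← hA2, h, h]
    · have h := congrArg LinearMap.det (A.mul_inv)
      simp_all

variable (ρ : Representation ℂ N V) (Φ : V ≃ₗ[ℂ] Module.Dual ℂ V)

omit [FiniteDimensional ℂ V] in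
theorem mem_twistedIsometries {g : G} {A : (Module.End ℂ V)ˣ} :
    (g, A) ∈ twistedIsometries ρ Φ ↔
      (∀ n, (A : Module.End ℂ V) * ρ n = ρ (MulAut.conjNormal g n) * A) ∧
      (∀ v w, Φ ((A : Module.End ℂ V) v) ((A : Module.End ℂ V) w) = Φ v w) ∧
      LinearMap.det (A : Module.End ℂ V) = 1 :=
  Iff.rfl

omit [FiniteDimensional ℂ V] in
theorem asGroupHom_mem_twistedIsometries (hperf : commutator N = ⊤)
    (hΦ : ∀ n v w, Φ (ρ n v) (ρ n w) = Φ v w) (n : N) :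
    ((n : G), ρ.asGroupHom n) ∈ twistedIsometries ρ Φ := by
  rw [mem_twistedIsometries]
  refine ⟨fun m ↦ ?_, hΦ n, ?_⟩
  · have : MulAut.conjNormal (n : G) m = n * m * n⁻¹ := by ext; simp
    simp [this, asGroupHom_apply, mul_assoc, ← map_mul]
  · have h := Abelianization.commutator_subset_ker ((Units.map LinearMap.det).comp ρ.asGroupHom)
    rw [hperf] at h
    have := congrArg Units.val (MonoidHom.mem_ker.1 (h (Subgroup.mem_top n)))
    exact this

variable [ρ.IsIrreducible]

theorem eq_of_mem_twistedIsometries (hodd : Odd (Module.finrank ℂ V)) {g : G}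
    {A B : (Module.End ℂ V)ˣ} (hA : (g, A) ∈ twistedIsometries ρ Φ)
    (hB : (g, B) ∈ twistedIsometries ρ Φ) : A = B := by
  have hmem := mul_mem (inv_mem hB) hA
  have h1 : ((g, B)⁻¹ * (g, A) : G × (Module.End ℂ V)ˣ) = (1, B⁻¹ * A) := by simp
  rw [h1, mem_twistedIsometries] at hmem
  obtain ⟨hC1, hC2, hC3⟩ := hmem
  obtain ⟨c, hc⟩ := IsIrreducible.exists_eq_smul_one ρ (A := ↑(B⁻¹ * A)) (by simpa using hC1)
  rw [hc] at hC2 hC3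
  have := IsIrreducible.nontrivial ρ
  obtain ⟨v, hv⟩ := exists_ne (0 : V)
  have hΦv : Φ v ≠ 0 := by simpa using hv
  obtain ⟨w, hw⟩ : ∃ w, Φ v w ≠ 0 := by
    by_contra! h
    exact hΦv (LinearMap.ext h)
  have hc2 : c ^ 2 = 1 := by
    have := hC2 v w
    simp only [LinearMap.smul_apply, Module.End.one_apply, map_smul, smul_eq_mul,
      ← mul_assoc] at this
    rw [pow_two]
    exact mul_right_cancel₀ hw (this.trans (one_mul _).symm)
  have hc1 : c = 1 := by
    rw [LinearMap.det_smul, map_one, mul_one] at hC3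
    obtain ⟨k, hk⟩ := hodd
    rwa [hk, pow_succ, pow_mul, hc2, one_pow, one_mul] at hC3
  rw [hc1, one_smul, Units.val_eq_one, inv_mul_eq_one] at hc
  exact hc.symm

theorem exists_mem_twistedIsometries (hodd : Odd (Module.finrank ℂ V))
    (hΦ : ∀ n v w, Φ (ρ n v) (ρ n w) = Φ v w) {g : G} {B : Module.End ℂ V} (hB0 : B ≠ 0)
    (hB : ∀ n, B * ρ n = ρ (MulAut.conjNormal g n) * B) :
    ∃ A, (g, A) ∈ twistedIsometries ρ Φ := by
  have hBu := IsIrreducible.isUnit_of_twist ρ _ hB0 hB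
  have hBn (n : N) (v : V) : B (ρ n v) = ρ (MulAut.conjNormal g n) (B v) :=
    congrArg (fun A : Module.End ℂ V ↦ A v) (hB n)
  obtain ⟨c, hc⟩ := IsIrreducible.exists_smul_of_invariant ρ Φ hΦ
    (B.dualMap ∘ₗ Φ.toLinearMap ∘ₗ B) (by intro n v w; simp [hBn, hΦ])
  replace hc (v w : V) : Φ (B v) (B w) = c * Φ v w := hc v w
  have hc0 : c ≠ 0 := by
    rintro rfl
    refine hB0 (LinearMap.ext fun v ↦ ?_)
    have : Φ (B v) = 0 := by
      ext w
      obtain ⟨w, rfl⟩ := ((Module.End.isUnit_iff B).1 hBu).2 w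
      simpa using hc v w
    simpa using this
  obtain ⟨d, rfl⟩ := IsAlgClosed.exists_eq_mul_self c
  have hd : d ≠ 0 := by rintro rfl; simp at hc0
  have key (s : ℂ) (hs0 : s ≠ 0) (hs : s * s * (d * d) = 1)
      (hdet : LinearMap.det (s • B) = 1) : ∃ A, (g, A) ∈ twistedIsometries ρ Φ := by
    obtain ⟨A, hA⟩ : IsUnit (s • B) := hBu.smul (Units.mk0 s hs0)
    refine ⟨A, ?_⟩
    rw [mem_twistedIsometries, hA]
    refine ⟨fun n ↦ by simp [hB], fun v w ↦ ?_, hdet⟩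
    simp only [LinearMap.smul_apply, map_smul, smul_eq_mul, hc]
    linear_combination (Φ v w) * hs
  have hs : d⁻¹ * d⁻¹ * (d * d) = 1 := by field_simp
  rcases det_eq_one_or_eq_neg_one_of_isometry Φ (A := d⁻¹ • B) (fun v w ↦ by
    simp only [LinearMap.smul_apply, map_smul, smul_eq_mul, hc]
    linear_combination (Φ v w) * hs) with h | h
  · exact key d⁻¹ (inv_ne_zero hd) hs h
  · refine key (-d⁻¹) (neg_ne_zero.2 (inv_ne_zero hd)) (by simpa using hs) ?_
    rw [neg_smul, ← neg_one_smul ℂ, LinearMap.det_smul, hodd.neg_one_pow, h]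
    norm_num

end Isometry

/-- A representation preserving a nondegenerate bilinear form has a self-dual character. -/
theorem character_inv_of_invariant {G V : Type*} [Group G] [AddCommGroup V] [Module ℂ V]
    [FiniteDimensional ℂ V] (ρ : Representation ℂ G V) (Φ : V ≃ₗ[ℂ] Module.Dual ℂ V)
    (hΦ : ∀ g v w, Φ (ρ g v) (ρ g w) = Φ v w) (g : G) : ρ.character g⁻¹ = ρ.character g := by
  rw [← char_dual]
  refine (congrFun (char_iso (Equiv.mk Φ fun g ↦ ?_)) g).symm
  ext v w
  change Φ (ρ g v) w = Φ v (ρ g⁻¹ w)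
  have h := hΦ g v (ρ g⁻¹ w)
  rwa [self_inv_apply] at h

section EquivariantFunctions

variable {G V : Type*} [Group G] [AddCommGroup V] [Module ℂ V]
  (K : Subgroup (G × (Module.End ℂ V)ˣ))

/-- The functions `G → V` that are equivariant under the partial action of `G` on `V` given
by `K`. If `K` is the graph of a representation of a subgroup, this is the coinduced module. -/
def equivariantFunctions : Submodule ℂ (G → V) where
  carrier := {f | ∀ p ∈ K, ∀ x, f (p.1 * x) = (p.2 : Module.End ℂ V) (f x)}
  add_mem' hf hg p hp x := by simp [hf p hp, hg p hp]
  zero_mem' p hp x := by simp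
  smul_mem' c f hf p hp x := by simp [hf p hp]

/-- The action of `G` on `equivariantFunctions K` by right translation. -/
def translation : Representation ℂ G (equivariantFunctions K) where
  toFun g := (LinearMap.funLeft ℂ V (· * g)).restrict fun f hf p hp x ↦ by
    simpa [LinearMap.funLeft_apply, mul_assoc] using hf p hp (x * g)
  map_one' := by ext; simp [LinearMap.funLeft_apply]
  map_mul' g h := by
    ext f x
    exact congrArg (f : G → V) (mul_assoc x g h).symm

@[simp]
theorem translation_apply_coe (g : G) (f : equivariantFunctions K) (x : G) :
    (translation K g f : G → V) x = (f : G → V) (x * g) :=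
  rfl

open scoped Classical in
/-- The operator attached to `g` by `K`, or zero if there is none. -/
noncomputable def operator (g : G) : Module.End ℂ V :=
  if h : ∃ A, (g, A) ∈ K then (h.choose : (Module.End ℂ V)ˣ) else 0

theorem operator_of_forall_notMem {g : G} (h : ¬ ∃ A, (g, A) ∈ K) : operator K g = 0 :=
  dif_neg h

theorem exists_mem_operator {g : G} (h : ∃ A, (g, A) ∈ K) : ∃ A, (g, A) ∈ K ∧ operator K g = A :=
  ⟨h.choose, h.choose_spec, dif_pos h⟩

variable {K} (hK : ∀ ⦃g : G⦄ ⦃A B : (Module.End ℂ V)ˣ⦄, (g, A) ∈ K → (g, B) ∈ K → A = B)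

include hK in
theorem operator_eq {g : G} {A : (Module.End ℂ V)ˣ} (h : (g, A) ∈ K) : operator K g = A := by
  obtain ⟨B, hB, hB'⟩ := exists_mem_operator K ⟨A, h⟩
  rw [hB', hK h hB]

include hK in
theorem operator_mul {g x : G} {A : (Module.End ℂ V)ˣ} (h : (g, A) ∈ K) :
    operator K (g * x) = A * operator K x := by
  by_cases hx : ∃ B, (x, B) ∈ K
  · obtain ⟨B, hB⟩ := hx
    rw [operator_eq hK hB, operator_eq hK (show (g * x, A * B) ∈ K from mul_mem h hB)]
    rfl
  · rw [operator_of_forall_notMem K hx, operator_of_forall_notMem, mul_zero]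
    rintro ⟨B, hB⟩
    exact hx ⟨A⁻¹ * B, by simpa using mul_mem (inv_mem h) hB⟩

include hK in
theorem operator_mul_right {g x : G} {A : (Module.End ℂ V)ˣ} (h : (x, A) ∈ K) :
    operator K (g * x) = operator K g * A := by
  by_cases hg : ∃ B, (g, B) ∈ K
  · obtain ⟨B, hB⟩ := hg
    rw [operator_eq hK hB, operator_eq hK (show (g * x, B * A) ∈ K from mul_mem hB h)]
    rfl
  · rw [operator_of_forall_notMem K hg, operator_of_forall_notMem, zero_mul]
    rintro ⟨B, hB⟩
    exact hg ⟨B * A⁻¹, by simpa using mul_mem hB (inv_mem h)⟩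

include hK in
theorem operator_one : operator K 1 = 1 :=
  operator_eq hK (one_mem K)

/-- The equivariant functions supported on the projection of `K` to `G`. -/
noncomputable def supported : V →ₗ[ℂ] equivariantFunctions K where
  toFun v := ⟨fun x ↦ operator K x v, fun p hp x ↦ by simp [operator_mul hK hp]⟩
  map_add' v w := by ext; simp
  map_smul' c v := by ext; simp

@[simp]
theorem supported_apply_coe (v : V) (x : G) : (supported hK v : G → V) x = operator K x v :=
  rfl

theorem operator_apply_of_equivariant (f : equivariantFunctions K) {g x : G}
    (h : ∃ A, (g, A) ∈ K) : operator K g ((f : G → V) x) = (f : G → V) (g * x) := by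
  obtain ⟨A, hA, hA'⟩ := exists_mem_operator K h
  rw [hA']
  exact (f.2 _ hA x).symm

theorem eq_top_of_supported_mem [Finite G] (U : Subrepresentation (translation K))
    (hU : ∀ v, supported hK v ∈ U) : U = ⊤ := by
  classical
  have := Fintype.ofFinite G
  refine eq_top_iff.2 fun f _ ↦ ?_
  let T : Finset G := {g | ∃ A, (g, A) ∈ K}
  have hT : (T.card : ℂ) ≠ 0 := by
    rw [Nat.cast_ne_zero, Finset.card_ne_zero]
    exact ⟨1, by simpa [T] using ⟨1, one_mem K⟩⟩
  have hf : (T.card : ℂ) • f = ∑ x, translation K x⁻¹ (supported hK ((f : G → V) x)) := by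
    ext y
    rw [AddSubmonoidClass.coe_finsetSum, Finset.sum_apply]
    simp only [translation_apply_coe, supported_apply_coe]
    rw [← Fintype.sum_equiv ((Equiv.inv G).trans (Equiv.mulRight y))
      (fun g ↦ if g ∈ T then (f : G → V) y else 0)]
    · rw [← Finset.sum_filter, Finset.filter_mem_eq_inter, Finset.univ_inter, Finset.sum_const,
        Submodule.coe_smul, Pi.smul_apply, Nat.cast_smul_eq_nsmul]
    · intro g
      have hg : y * ((Equiv.inv G).trans (Equiv.mulRight y) g)⁻¹ = g := by simp
      rw [hg]
      split_ifs with h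
      · rw [operator_apply_of_equivariant f (by simpa [T] using h)]
        simp
      · rw [operator_of_forall_notMem K (by simpa [T] using h)]
        rfl
  have hmem : (T.card : ℂ) • f ∈ U.toSubmodule := by
    rw [hf]
    exact Submodule.sum_mem _ fun x _ ↦ U.apply_mem_toSubmodule _ (hU _)
  exact (Submodule.smul_mem_iff _ hT).1 hmem

include hK in
/-- If `K` preserves a nondegenerate bilinear form, then its equivariant functions are
self-dual. -/
theorem character_translation_inv [Finite G] [FiniteDimensional ℂ V]
    (Φ : V ≃ₗ[ℂ] Module.Dual ℂ V)
    (hΦ : ∀ p ∈ K, ∀ v w,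
      Φ ((p.2 : Module.End ℂ V) v) ((p.2 : Module.End ℂ V) w) = Φ v w) (g : G) :
    (translation K).character g⁻¹ = (translation K).character g := by
  classical
  have := Fintype.ofFinite G
  let ev (x : G) : equivariantFunctions K →ₗ[ℂ] V :=
    LinearMap.proj x ∘ₗ (equivariantFunctions K).subtype
  let Ψ : equivariantFunctions K →ₗ[ℂ] Module.Dual ℂ (equivariantFunctions K) :=
    ∑ x, (ev x).dualMap ∘ₗ Φ.toLinearMap ∘ₗ ev x
  have hΨ (f f' : equivariantFunctions K) :
      Ψ f f' = ∑ x, Φ ((f : G → V) x) ((f' : G → V) x) := by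
    simp [Ψ, ev, LinearMap.sum_apply]
  let T : Finset G := {g | ∃ A, (g, A) ∈ K}
  have hT : (T.card : ℂ) ≠ 0 := by
    rw [Nat.cast_ne_zero, Finset.card_ne_zero]
    exact ⟨1, by simpa [T] using ⟨1, one_mem K⟩⟩
  have hinj : Function.Injective Ψ := by
    rw [injective_iff_map_eq_zero]
    intro f hf
    ext y
    suffices Φ ((f : G → V) y) = 0 by simpa using this
    ext w
    have h : Ψ f (translation K y⁻¹ (supported hK w)) = T.card * Φ ((f : G → V) y) w := by
      rw [hΨ, ← Fintype.sum_equiv (Equiv.mulRight y)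
        (fun g ↦ if g ∈ T then Φ ((f : G → V) y) w else 0)]
      · rw [← Finset.sum_filter, Finset.filter_mem_eq_inter, Finset.univ_inter, Finset.sum_const,
          nsmul_eq_mul]
      · intro g
        rw [translation_apply_coe, supported_apply_coe, Equiv.coe_mulRight, mul_inv_cancel_right]
        split_ifs with h
        · have h' : ∃ A, (g, A) ∈ K := by simpa [T] using h
          obtain ⟨A, hA, hA'⟩ := exists_mem_operator K h'
          rw [← operator_apply_of_equivariant f h', hA', hΦ _ hA]
        · rw [operator_of_forall_notMem K (by simpa [T] using h)]
          simp
    rw [hf] at h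
    simpa [hT] using h.symm
  refine character_inv_of_invariant _
    (LinearEquiv.ofInjectiveOfFinrankEq Ψ hinj Subspace.dual_finrank_eq.symm)
    (fun g f f' ↦ ?_) g
  change Ψ _ _ = Ψ _ _
  rw [hΨ, hΨ]
  exact Fintype.sum_equiv (Equiv.mulRight g) _ _ fun x ↦ rfl

end EquivariantFunctions

section Extension

variable {G V : Type*} [Group G] [Finite G] {N : Subgroup G} [N.Normal] [AddCommGroup V]
  [Module ℂ V] [FiniteDimensional ℂ V] (ρ : Representation ℂ N V) [ρ.IsIrreducible]
  (Φ : V ≃ₗ[ℂ] Module.Dual ℂ V) (hperf : commutator N = ⊤)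
  (hodd : Odd (Module.finrank ℂ V)) (hΦ : ∀ n v w, Φ (ρ n v) (ρ n w) = Φ v w)

omit [Finite G] [FiniteDimensional ℂ V] [ρ.IsIrreducible] in
include hperf hΦ in
theorem equivariantFunctions_apply_mul (f : equivariantFunctions (twistedIsometries ρ Φ)) (x : G)
    (n : N) : (f : G → V) (x * n) = ρ (MulAut.conjNormal x n) ((f : G → V) x) := by
  have h := f.2 _ (asGroupHom_mem_twistedIsometries ρ Φ hperf hΦ (MulAut.conjNormal x n)) x
  simpa [asGroupHom_apply] using h

omit [Finite G] in
include hodd in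
theorem twistedIsometries_functional ⦃g : G⦄ ⦃A B : (Module.End ℂ V)ˣ⦄
    (hA : (g, A) ∈ twistedIsometries ρ Φ) (hB : (g, B) ∈ twistedIsometries ρ Φ) : A = B :=
  eq_of_mem_twistedIsometries ρ Φ hodd hA hB

include hperf hodd hΦ in
theorem supported_mem_of_surjective
    (U : Subrepresentation (translation (twistedIsometries ρ Φ (G := G))))
    (hU : ∀ v, ∃ f ∈ U, (f : G → V) 1 = v) (v : V) :
    supported (twistedIsometries_functional ρ Φ hodd) v ∈ U := by
  have := Fintype.ofFinite N
  let W := equivariantFunctions (twistedIsometries ρ Φ (G := G))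
  let ev : U.toSubmodule →ₗ[ℂ] V := LinearMap.proj 1 ∘ₗ W.subtype ∘ₗ U.toSubmodule.subtype
  obtain ⟨s, hs⟩ := ev.exists_rightInverse_of_surjective <| LinearMap.range_eq_top.2 fun v ↦ by
    obtain ⟨f, hf, hfv⟩ := hU v
    exact ⟨⟨f, hf⟩, hfv⟩
  have hs1 (v : V) : ((s v : W) : G → V) 1 = v := congrArg (fun A : V →ₗ[ℂ] V ↦ A v) hs
  let F : V →ₗ[ℂ] W := ∑ n : N, translation _ (n : G) ∘ₗ U.toSubmodule.subtype ∘ₗ s ∘ₗ ρ n⁻¹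
  have hF (v : V) : F v = ∑ n : N, translation _ (n : G) (s (ρ n⁻¹ v) : W) := by
    simp [F, LinearMap.sum_apply]
  have hFx (v : V) (x : G) : (F v : G → V) x = ∑ n : N, ((s (ρ n⁻¹ v) : W) : G → V) (x * n) := by
    rw [hF, AddSubmonoidClass.coe_finsetSum, Finset.sum_apply]
    rfl
  have hFU (v : V) : F v ∈ U.toSubmodule := by
    rw [hF]
    exact Submodule.sum_mem _ fun n _ ↦ U.apply_mem_toSubmodule _ (s _).2
  have hF1 (v : V) : (F v : G → V) 1 = (Nat.card N : ℂ) • v := by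
    rw [hFx, Finset.sum_congr rfl fun n _ ↦ show _ = v from ?_]
    · simp [Nat.cast_smul_eq_nsmul]
    · rw [equivariantFunctions_apply_mul ρ Φ hperf hΦ, hs1]
      simp
  have hFtwist (x : G) (m : N) (v : V) :
      (F (ρ m v) : G → V) x = ρ (MulAut.conjNormal x m) ((F v : G → V) x) := by
    rw [← equivariantFunctions_apply_mul ρ Φ hperf hΦ, hFx, hFx]
    refine (Fintype.sum_equiv (Equiv.mulLeft m) _ _ fun n ↦ ?_).symm
    simp [mul_assoc, ← Module.End.mul_apply, ← map_mul]
  have hFs : F v = (Nat.card N : ℂ) • supported (twistedIsometries_functional ρ Φ hodd) v := by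
    ext x
    rw [Submodule.coe_smul, Pi.smul_apply, supported_apply_coe]
    by_cases hx : ∃ A, (x, A) ∈ twistedIsometries ρ Φ
    · rw [← map_smul, ← hF1, operator_apply_of_equivariant _ hx, mul_one]
    · rw [operator_of_forall_notMem _ hx]
      let B : Module.End ℂ V := LinearMap.proj x ∘ₗ W.subtype ∘ₗ F
      have hB : B = 0 := by
        by_contra hB
        exact hx (exists_mem_twistedIsometries ρ Φ hodd hΦ hB fun m ↦
          LinearMap.ext (hFtwist x m))
      have : (F v : G → V) x = B v := rfl
      simp [this, hB]
  exact (U.toSubmodule.smul_mem_iff (NeZero.ne (Nat.card N : ℂ))).1 (hFs ▸ hFU v)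

include hperf hodd hΦ in
/-- The projection of `twistedIsometries ρ Φ` to `G` is the inertia group of `ρ`, so the extension
of `ρ` to it induces irreducibly to `G`. -/
theorem translation_twistedIsometries_isIrreducible :
    (translation (twistedIsometries ρ Φ (G := G))).IsIrreducible := by
  have hK := twistedIsometries_functional (G := G) ρ Φ hodd
  have := IsIrreducible.nontrivial ρ
  refine { exists_pair_ne := ⟨⊥, ⊤, fun h ↦ ?_⟩, eq_bot_or_eq_top := fun U ↦ ?_ }
  · obtain ⟨v, hv⟩ := exists_ne (0 : V)
    have hmem : supported hK v ∈ (⊤ : Subrepresentation (translation _)) :=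
      Submodule.mem_top (R := ℂ)
    rw [← h] at hmem
    have h0 : supported hK v = 0 := (Submodule.mem_bot ℂ).1 hmem
    have h1 : (supported hK v : G → V) 1 = 0 := by rw [h0]; rfl
    rw [supported_apply_coe, operator_one hK] at h1
    exact hv h1
  · refine or_iff_not_imp_left.2 fun hU ↦ ?_
    refine eq_top_of_supported_mem hK U
      (supported_mem_of_surjective ρ Φ hperf hodd hΦ U ?_)
    let E : Subrepresentation ρ :=
      ⟨U.toSubmodule.map (LinearMap.proj 1 ∘ₗ
        (equivariantFunctions (twistedIsometries ρ Φ (G := G))).subtype), by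
        rintro n _ ⟨f, hf, rfl⟩
        refine ⟨translation _ (n : G) f, U.apply_mem_toSubmodule _ hf, ?_⟩
        have := equivariantFunctions_apply_mul ρ Φ hperf hΦ f 1 n
        simpa using this⟩
    rcases eq_bot_or_eq_top E with hE | hE
    · refine absurd (eq_bot_iff.2 fun f hf ↦ (Submodule.mem_bot ℂ).2 ?_) hU
      ext x
      have : (f : G → V) x ∈ E :=
        ⟨translation _ x f, U.apply_mem_toSubmodule _ hf, by simp⟩
      rw [hE] at this
      exact (Submodule.mem_bot ℂ).1 this
    · intro v
      have : v ∈ E := by rw [hE]; exact Submodule.mem_top (R := ℂ)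
      exact this

omit [Finite G] [FiniteDimensional ℂ V] [ρ.IsIrreducible] in
include hperf hΦ in
theorem operator_mul_coe
    (hK : ∀ ⦃g : G⦄ ⦃A B : (Module.End ℂ V)ˣ⦄, (g, A) ∈ twistedIsometries ρ Φ →
      (g, B) ∈ twistedIsometries ρ Φ → A = B) (x : G) (n : N) (v : V) :
    operator (twistedIsometries ρ Φ) (x * n) v = operator (twistedIsometries ρ Φ) x (ρ n v) := by
  rw [operator_mul_right hK (asGroupHom_mem_twistedIsometries ρ Φ hperf hΦ n)]
  rfl

include hperf hodd hΦ in
/-- The restriction of the induced representation to `N` contains `ρ`. -/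
theorem sum_character_translation_ne_zero [Fintype N] :
    ∑ n : N, (translation (twistedIsometries ρ Φ (G := G))).character n * ρ.character n⁻¹ ≠ 0 := by
  have hK := twistedIsometries_functional (G := G) ρ Φ hodd
  have := invertibleOfNonzero (NeZero.ne (Nat.card N : ℂ))
  let σ : Representation ℂ N _ := (translation (twistedIsometries ρ Φ (G := G))).comp N.subtype
  have hσ (n : N) (f) : σ n f = translation (twistedIsometries ρ Φ (G := G)) n f := rfl
  let f : IntertwiningMap ρ σ := ⟨supported hK, fun n ↦ by
    ext v x
    rw [LinearMap.comp_apply, LinearMap.comp_apply, hσ, translation_apply_coe,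
      supported_apply_coe, supported_apply_coe, operator_mul_coe ρ Φ hperf hΦ hK]⟩
  have hf : f ≠ 0 := by
    intro h
    have := IsIrreducible.nontrivial ρ
    obtain ⟨v, hv⟩ := exists_ne (0 : V)
    have h0 : supported hK v = 0 := congrArg (fun f : IntertwiningMap ρ σ ↦ f v) h
    have h1 : (supported hK v : G → V) 1 = 0 := by rw [h0]; rfl
    rw [supported_apply_coe, operator_one hK] at h1
    exact hv h1
  have : Nontrivial (IntertwiningMap ρ σ) := ⟨f, 0, hf⟩
  have hfin : FiniteDimensional ℂ (IntertwiningMap ρ σ) :=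
    Module.Finite.equiv (invariantsEquivIntertwiningMap ρ σ)
  have h := card_inv_mul_sum_char_mul_char_eq_finrank ρ σ
  have hchar (n : N) :
      σ.character n = (translation (twistedIsometries ρ Φ (G := G))).character n := rfl
  simp only [hchar] at h
  intro h0
  rw [h0] at h
  have hpos := Module.finrank_pos (R := ℂ) (M := IntertwiningMap ρ σ)
  rw [mul_zero, eq_comm, Nat.cast_eq_zero] at h
  exact hpos.ne' h

end Extension

end Representation

/-- If `N ⊴ G` is perfect (so every character of `N` has trivial determinantal order)
and `θ ∈ Irr(N)` is real-valued of odd degree, then some real-valued irreducible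
character of `G` lies over `θ`. -/
theorem exists_real_irr_char_over_real_odd_of_perfect
    (G : Type) [Group G] [Fintype G] (N : Subgroup G) (hN : N.Normal)
    (hperf : commutator ↥N = ⊤)
    (θ : ↥N → ℂ) (hθ : IsIrrChar ↥N θ) (hreal : IsRealValued θ)
    (hodd : ∃ n : ℕ, Odd n ∧ θ 1 = (n : ℂ)) :
    ∃ χ : G → ℂ, IsIrrChar G χ ∧ IsRealValued χ ∧ LiesOver N χ θ := by
  obtain ⟨V, hV, rfl⟩ := hθ
  have hirr := FDRep.isIrreducible_of_simple V
  obtain ⟨Φ, hΦ⟩ := Representation.IsIrreducible.exists_equiv_dual V.ρ hreal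
  have hdim : Odd (Module.finrank ℂ V) := by
    obtain ⟨n, hn, h⟩ := hodd
    rw [FDRep.char_one, Nat.cast_inj] at h
    rwa [h]
  let τ := Representation.translation (Representation.twistedIsometries V.ρ Φ (G := G))
  have hτ : τ.IsIrreducible :=
    Representation.translation_twistedIsometries_isIrreducible V.ρ Φ hperf hdim hΦ
  refine ⟨τ.character, ⟨FDRep.of τ, FDRep.simple_of_isIrreducible_s16 τ, rfl⟩, fun g ↦ ?_, ?_⟩
  · have h := Representation.character_translation_inv
      (Representation.twistedIsometries_functional V.ρ Φ hdim) Φ (fun p hp ↦ hp.2.1) g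
    rw [Representation.character_inv_eq_conj] at h
    exact Complex.conj_eq_iff_im.1 h
  · have := Fintype.ofFinite N
    have h := Representation.sum_character_translation_ne_zero (G := G) V.ρ Φ hperf hdim hΦ
    simp only [Representation.character_inv_eq_conj] at h
    unfold LiesOver
    convert h
    rfl
end
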